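/- Let c > 1 be a non-integral real number, let k be a positive integer, and let ε > 0. Set η = (1/2)·1/(2^{⌈c⌉+1} − 1) if c > k, and η = 1/(2^{k−1}(k+2)) if c < k. Then there exist C > 0 and N₀ ∈ ℕ, depending only on c, k and ε, such that for every real number ξ and every integer N ≥ N₀ one has min_{1 ≤ n ≤ N} ‖ξ⌊n^c + n^k⌋‖ ≤ C·N^{−η+ε}. -/

import Mathlib

/-- Distance from a real number to the nearest integer. -/
noncomputable def nearestIntDist (x : ℝ) : ℝ := |x - round x|

/-- The additive character `x ↦ exp (2πix)`. -/
noncomputable def unitExp (x : ℝ) : ℂ := Complex.exp (Complex.I * ((2 * Real.pi * x : ℝ) : ℂ))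

lemma norm_unitExp (x : ℝ) : ‖unitExp x‖ = 1 := Complex.norm_exp_I_mul_ofReal _

lemma unitExp_add (x y : ℝ) : unitExp (x + y) = unitExp x * unitExp y := by
  rw [unitExp, unitExp, unitExp, ← Complex.exp_add]
  congr 1
  push_cast
  ring

lemma unitExp_zero : unitExp 0 = 1 := by simp [unitExp]

lemma unitExp_neg (x : ℝ) : unitExp (-x) = (starRingEnd ℂ) (unitExp x) := by
  rw [unitExp, unitExp, ← Complex.exp_conj]
  congr 1
  rw [map_mul, Complex.conj_I, Complex.conj_ofReal]
  push_cast
  ring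

lemma unitExp_sub (x y : ℝ) : unitExp (x - y) = unitExp x * (starRingEnd ℂ) (unitExp y) := by
  rw [sub_eq_add_neg, unitExp_add, unitExp_neg]

lemma unitExp_intCast (m : ℤ) : unitExp m = 1 := by
  rw [unitExp, Complex.exp_eq_one_iff]
  exact ⟨m, by push_cast; ring⟩

lemma unitExp_add_intCast (x : ℝ) (m : ℤ) : unitExp (x + m) = unitExp x := by
  rw [unitExp_add, unitExp_intCast, mul_one]

lemma unitExp_re (x : ℝ) : (unitExp x).re = Real.cos (2 * Real.pi * x) := by
  rw [unitExp, mul_comm, Complex.exp_ofReal_mul_I_re]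

lemma norm_unitExp_sub_one_le (x : ℝ) : ‖unitExp x - 1‖ ≤ 2 * Real.pi * |x| := by
  refine (Real.norm_exp_I_mul_ofReal_sub_one_le).trans_eq ?_
  rw [Real.norm_eq_abs, abs_mul, abs_of_pos (by positivity : (0 : ℝ) < 2 * Real.pi)]

lemma norm_unitExp_sub_le (x y : ℝ) : ‖unitExp x - unitExp y‖ ≤ 2 * Real.pi * |x - y| := by
  have h : unitExp x - unitExp y = unitExp y * (unitExp (x - y) - 1) := by
    rw [mul_sub, ← unitExp_add]
    simp
  rw [h, norm_mul, norm_unitExp, one_mul]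
  exact norm_unitExp_sub_one_le _

lemma four_mul_le_norm_unitExp_sub_one {x : ℝ} (h0 : 0 ≤ x) (h1 : x ≤ 1 / 2) :
    4 * x ≤ ‖unitExp x - 1‖ := by
  rw [unitExp, Complex.norm_exp_I_mul_ofReal_sub_one, Real.norm_eq_abs]
  have hpi := Real.pi_pos
  have h := Real.mul_le_sin (x := Real.pi * x) (by positivity) (by nlinarith)
  have h2 : 2 / Real.pi * (Real.pi * x) = 2 * x := by field_simp
  have h3 : 2 * Real.pi * x / 2 = Real.pi * x := by ring
  rw [h3]
  refine le_trans ?_ (le_abs_self _)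
  linarith

lemma sum_eq_boundary_sub_sum (E w : ℕ → ℂ) (n : ℕ)
    (h : ∀ i, i < n + 1 → E i = w i * (E (i + 1) - E i)) :
    ∑ i ∈ Finset.range (n + 1), E i =
      w n * E (n + 1) - w 0 * E 0 - ∑ i ∈ Finset.range n, E (i + 1) * (w (i + 1) - w i) := by
  induction n with
  | zero =>
    have h0 := h 0 (by omega)
    rw [Finset.sum_range_one, Finset.sum_range_zero]
    linear_combination h0
  | succ n ih =>
    rw [Finset.sum_range_succ, ih (fun i hi => h i (by omega)),
      Finset.sum_range_succ _ n]
    have := h (n + 1) (by omega)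
    linear_combination this

/-- A Kusmin–Landau inequality with the monotonicity hypothesis replaced by a bound for the second
differences. -/
lemma norm_sum_unitExp_le_of_diff (u : ℕ → ℝ) (L : ℕ) (lam nu : ℝ) (hlam : 0 < lam)
    (hnu : 0 ≤ nu)
    (h1 : ∀ i, i + 1 < L → lam ≤ u (i + 1) - u i ∧ u (i + 1) - u i ≤ 1 / 2)
    (h2 : ∀ i, i + 2 < L → |u (i + 2) - u (i + 1) - (u (i + 1) - u i)| ≤ nu) (hl : lam ≤ 1 / 2) :
    ‖∑ i ∈ Finset.range L, unitExp (u i)‖ ≤ 1 / lam + L * nu / lam ^ 2 := by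
  have hone : (1 : ℝ) ≤ 1 / (2 * lam) := by
    rw [le_div_iff₀ (by positivity)]
    linarith
  have hhalf : 1 / (2 * lam) + 1 / (2 * lam) = 1 / lam := by field_simp; norm_num
  have hnn : 0 ≤ L * nu / lam ^ 2 := by positivity
  rcases L with _ | _ | n
  · simp
    positivity
  · simp only [zero_add, Finset.range_one, Finset.sum_singleton, norm_unitExp] at *
    linarith
  set w : ℕ → ℂ := fun i => (unitExp (u (i + 1) - u i) - 1)⁻¹ with hw
  have hpos : ∀ i, i < n + 1 → 4 * lam ≤ ‖unitExp (u (i + 1) - u i) - 1‖ := by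
    intro i hi
    have h := h1 i (by omega)
    have := four_mul_le_norm_unitExp_sub_one (hlam.le.trans h.1) h.2
    linarith
  have hne : ∀ i, i < n + 1 → unitExp (u (i + 1) - u i) - 1 ≠ 0 := by
    intro i hi h
    have := hpos i hi
    rw [h, norm_zero] at this
    linarith
  have hwn : ∀ i, i < n + 1 → ‖w i‖ ≤ 1 / (4 * lam) := by
    intro i hi
    rw [hw]
    simp only [norm_inv]
    rw [inv_eq_one_div]
    exact one_div_le_one_div_of_le (by positivity) (hpos i hi)
  have hwd : ∀ i, i < n → ‖w (i + 1) - w i‖ ≤ nu / lam ^ 2 / 2 := by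
    intro i hi
    rw [hw]
    simp only
    rw [inv_sub_inv (hne _ (by omega)) (hne _ (by omega)), norm_div, norm_mul]
    have ha := hpos (i + 1) (by omega)
    have hb := hpos i (by omega)
    have hc := norm_unitExp_sub_le (u (i + 1) - u i) (u (i + 1 + 1) - u (i + 1))
    have hd := h2 i (by omega)
    rw [abs_sub_comm] at hd
    have he : ‖unitExp (u (i + 1) - u i) - 1 - (unitExp (u (i + 1 + 1) - u (i + 1)) - 1)‖
        ≤ 8 * nu := by
      rw [sub_sub_sub_cancel_right]
      refine hc.trans ?_
      have := Real.pi_lt_four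
      have := Real.pi_pos
      have h0 := abs_nonneg (u (i + 1) - u i - (u (i + 1 + 1) - u (i + 1)))
      have hd' : |u (i + 1) - u i - (u (i + 1 + 1) - u (i + 1))| ≤ nu := hd
      nlinarith
    calc _ ≤ 8 * nu / ((4 * lam) * (4 * lam)) := by
            gcongr
      _ = _ := by field_simp; ring
  have key := sum_eq_boundary_sub_sum (fun i => unitExp (u i)) w n (by
    intro i hi
    have h := hne i hi
    have h' : unitExp (u (i + 1)) = unitExp (u i) * unitExp (u (i + 1) - u i) := by
      rw [← unitExp_add]
      congr 1
      ring
    simp only [hw]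
    rw [h']
    field_simp)
  rw [Finset.sum_range_succ, key]
  have hb1 : ‖w n * unitExp (u (n + 1))‖ ≤ 1 / (4 * lam) := by
    rw [norm_mul, norm_unitExp, mul_one]
    exact hwn n (by omega)
  have hb2 : ‖w 0 * unitExp (u 0)‖ ≤ 1 / (4 * lam) := by
    rw [norm_mul, norm_unitExp, mul_one]
    exact hwn 0 (by omega)
  have hb3 : ‖∑ i ∈ Finset.range n, unitExp (u (i + 1)) * (w (i + 1) - w i)‖
      ≤ n * (nu / lam ^ 2 / 2) := by
    refine (norm_sum_le _ _).trans ?_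
    refine (Finset.sum_le_card_nsmul _ _ (nu / lam ^ 2 / 2) ?_).trans ?_
    · intro i hi
      rw [norm_mul, norm_unitExp, one_mul]
      exact hwd i (Finset.mem_range.1 hi)
    · simp
  have hq : 1 / (4 * lam) + 1 / (4 * lam) = 1 / (2 * lam) := by field_simp; norm_num
  have hfin : (n : ℝ) * (nu / lam ^ 2 / 2) ≤ ((n + 1 + 1 : ℕ) : ℝ) * nu / lam ^ 2 := by
    push_cast
    have : 0 ≤ nu / lam ^ 2 := by positivity
    have h3 : ((n : ℝ) + 1 + 1) * nu / lam ^ 2 = (n + 1 + 1) * (nu / lam ^ 2) := by ring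
    rw [h3]
    have : (0 : ℝ) ≤ n := by positivity
    nlinarith
  calc _ ≤ ‖w n * unitExp (u (n + 1)) - w 0 * unitExp (u 0) -
        ∑ i ∈ Finset.range n, unitExp (u (i + 1)) * (w (i + 1) - w i)‖ + ‖unitExp (u (n + 1))‖ :=
          norm_add_le _ _
    _ ≤ (‖w n * unitExp (u (n + 1))‖ + ‖w 0 * unitExp (u 0)‖ +
        ‖∑ i ∈ Finset.range n, unitExp (u (i + 1)) * (w (i + 1) - w i)‖) + 1 := by
          rw [norm_unitExp]
          gcongr
          exact (norm_sub_le _ _).trans (by gcongr; exact norm_sub_le _ _)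
    _ ≤ _ := by linarith

/-- The van der Corput inequality, with shifts restricted to multiples of `q`. -/
lemma van_der_corput_inequality (z : ℕ → ℂ) (L H q : ℕ) :
    ‖∑ i ∈ Finset.range L, z i‖ ^ 2 * H ≤ 2 * (L + q * H) *
      ∑ d ∈ Finset.range H,
        ‖∑ i ∈ Finset.range (L - q * d), z (i + q * d) * (starRingEnd ℂ) (z i)‖ := by
  rcases Nat.eq_zero_or_pos H with rfl | hH
  · simp
  set S := ∑ i ∈ Finset.range L, z i with hS
  set T := Finset.range (L + q * H) with hT
  set a : ℕ → ℕ → ℂ := fun n h => if q * h ≤ n ∧ n - q * h < L then z (n - q * h) else 0 with ha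
  set C : ℕ → ℝ := fun d =>
    ‖∑ i ∈ Finset.range (L - q * d), z (i + q * d) * (starRingEnd ℂ) (z i)‖ with hC
  have hrow : ∀ h ∈ Finset.range H, ∑ n ∈ T, a n h = S := by
    intro h hh
    have hle : q * h ≤ q * H := Nat.mul_le_mul_left _ (Finset.mem_range.1 hh).le
    rw [ha, hS]
    simp only
    rw [← Finset.sum_filter]
    refine Finset.sum_nbij' (fun n => n - q * h) (fun i => i + q * h) ?_ ?_ ?_ ?_ ?_
    · intro n hn
      simp only [Finset.mem_filter, hT, Finset.mem_range] at hn ⊢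
      exact hn.2.2
    · intro i hi
      simp only [Finset.mem_filter, hT, Finset.mem_range] at hi ⊢
      omega
    · intro n hn
      simp only [Finset.mem_filter, hT, Finset.mem_range] at hn ⊢
      omega
    · intro i hi
      simp
    · intro n hn
      rfl
  have hcorr : ∀ h h', h ≤ h' → h' < H →
      ∑ n ∈ T, a n h * (starRingEnd ℂ) (a n h') =
        ∑ i ∈ Finset.range (L - q * (h' - h)),
          z (i + q * (h' - h)) * (starRingEnd ℂ) (z i) := by
    intro h h' hhh hh'
    have hle : q * h' ≤ q * H := Nat.mul_le_mul_left _ hh'.le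
    have hle2 : q * h ≤ q * h' := Nat.mul_le_mul_left _ hhh
    have hsub : q * (h' - h) = q * h' - q * h := Nat.mul_sub _ _ _
    have : ∀ n ∈ T, a n h * (starRingEnd ℂ) (a n h') =
        if q * h' ≤ n ∧ n - q * h < L then z (n - q * h) * (starRingEnd ℂ) (z (n - q * h'))
        else 0 := by
      intro n hn
      rw [ha]
      simp only
      by_cases hc : q * h' ≤ n ∧ n - q * h < L
      · rw [if_pos hc, if_pos (by omega), if_pos (by omega)]
      · rw [if_neg hc]
        by_cases h1 : q * h ≤ n ∧ n - q * h < L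
        · rw [if_neg (c := q * h' ≤ n ∧ n - q * h' < L) (by omega), map_zero, mul_zero]
        · rw [if_neg h1, zero_mul]
    rw [Finset.sum_congr rfl this, ← Finset.sum_filter]
    refine Finset.sum_nbij' (fun n => n - q * h') (fun i => i + q * h') ?_ ?_ ?_ ?_ ?_
    · intro n hn
      simp only [Finset.mem_filter, hT, Finset.mem_range] at hn ⊢
      omega
    · intro i hi
      simp only [Finset.mem_filter, hT, Finset.mem_range] at hi ⊢
      omega
    · intro n hn
      simp only [Finset.mem_filter, hT, Finset.mem_range] at hn ⊢
      omega
    · intro i hi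
      simp
    · intro n hn
      simp only [Finset.mem_filter, hT, Finset.mem_range] at hn
      congr 2
      omega
  have hpair : ∀ h h', h < H → h' < H → ‖∑ n ∈ T, a n h * (starRingEnd ℂ) (a n h')‖ =
      if h ≤ h' then C (h' - h) else C (h - h') := by
    intro h h' hh hh'
    split_ifs with hc
    · rw [hcorr h h' hc hh']
    · rw [hC]
      simp only
      rw [← hcorr h' h (by omega) hh, ← Complex.norm_conj, map_sum]
      congr 1
      refine Finset.sum_congr rfl fun n _ => ?_
      rw [map_mul, Complex.conj_conj, mul_comm]
  have hCnn : ∀ d, 0 ≤ C d := fun d => norm_nonneg _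
  have hinner : ∀ h ∈ Finset.range H,
      ∑ h' ∈ Finset.range H, ‖∑ n ∈ T, a n h * (starRingEnd ℂ) (a n h')‖ ≤
        2 * ∑ d ∈ Finset.range H, C d := by
    intro h hh
    rw [Finset.mem_range] at hh
    rw [Finset.sum_congr rfl (fun h' hh' => hpair h h' hh (Finset.mem_range.1 hh')),
      Finset.sum_ite, two_mul]
    gcongr
    · rw [← Finset.sum_image (s := {x ∈ Finset.range H | h ≤ x}) (g := fun x => x - h)
        (f := C) (by
          intro x hx y hy hxy
          simp at hx hy hxy
          omega)]
      refine Finset.sum_le_sum_of_subset_of_nonneg ?_ (fun _ _ _ => hCnn _)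
      intro x hx
      simp at hx ⊢
      omega
    · rw [← Finset.sum_image (s := {x ∈ Finset.range H | ¬ h ≤ x}) (g := fun x => h - x)
        (f := C) (by
          intro x hx y hy hxy
          simp at hx hy hxy
          omega)]
      refine Finset.sum_le_sum_of_subset_of_nonneg ?_ (fun _ _ _ => hCnn _)
      intro x hx
      simp at hx ⊢
      omega
  have hHS : (H : ℂ) * S = ∑ n ∈ T, ∑ h ∈ Finset.range H, a n h := by
    rw [Finset.sum_comm, Finset.sum_congr rfl hrow]
    simp
  have hnormsq : ∀ n, ((‖∑ h ∈ Finset.range H, a n h‖ ^ 2 : ℝ) : ℂ) =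
      ∑ h ∈ Finset.range H, ∑ h' ∈ Finset.range H, a n h * (starRingEnd ℂ) (a n h') := by
    intro n
    rw [← Complex.normSq_eq_norm_sq, ← Complex.mul_conj, map_sum, Finset.sum_mul_sum]
  have hsq : ∑ n ∈ T, ‖∑ h ∈ Finset.range H, a n h‖ ^ 2 ≤
      H * (2 * ∑ d ∈ Finset.range H, C d) := by
    have h1 : ((∑ n ∈ T, ‖∑ h ∈ Finset.range H, a n h‖ ^ 2 : ℝ) : ℂ) =
        ∑ h ∈ Finset.range H, ∑ h' ∈ Finset.range H,
          ∑ n ∈ T, a n h * (starRingEnd ℂ) (a n h') := by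
      rw [Complex.ofReal_sum, Finset.sum_congr rfl (fun n _ => hnormsq n), Finset.sum_comm]
      refine Finset.sum_congr rfl fun h _ => ?_
      rw [Finset.sum_comm]
    have h2 : ∑ n ∈ T, ‖∑ h ∈ Finset.range H, a n h‖ ^ 2 =
        ‖((∑ n ∈ T, ‖∑ h ∈ Finset.range H, a n h‖ ^ 2 : ℝ) : ℂ)‖ := by
      rw [Complex.norm_real, Real.norm_of_nonneg (by positivity)]
    rw [h2, h1]
    calc _ ≤ ∑ h ∈ Finset.range H, ∑ h' ∈ Finset.range H,
          ‖∑ n ∈ T, a n h * (starRingEnd ℂ) (a n h')‖ :=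
            (norm_sum_le _ _).trans (Finset.sum_le_sum fun h _ => norm_sum_le _ _)
      _ ≤ ∑ h ∈ Finset.range H, 2 * ∑ d ∈ Finset.range H, C d := Finset.sum_le_sum hinner
      _ = _ := by simp
  have hcs : (H * ‖S‖) ^ 2 ≤ (L + q * H) * (H * (2 * ∑ d ∈ Finset.range H, C d)) := by
    have h1 : (H : ℝ) * ‖S‖ = ‖(H : ℂ) * S‖ := by simp
    rw [h1, hHS]
    calc _ ≤ (∑ n ∈ T, ‖∑ h ∈ Finset.range H, a n h‖) ^ 2 := by
            gcongr
            exact norm_sum_le _ _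
      _ ≤ T.card * ∑ n ∈ T, ‖∑ h ∈ Finset.range H, a n h‖ ^ 2 := sq_sum_le_card_mul_sum_sq
      _ ≤ _ := by
        rw [hT, Finset.card_range]
        push_cast
        gcongr
  have hHpos : (0 : ℝ) < H := by exact_mod_cast hH
  refine le_of_mul_le_mul_left ?_ hHpos
  calc (H : ℝ) * (‖S‖ ^ 2 * H) = (H * ‖S‖) ^ 2 := by ring
    _ ≤ _ := hcs
    _ = _ := by ring

lemma fwdDiff_iter_fwdDiff (u : ℕ → ℝ) (d r i : ℕ) :
    (fwdDiff 1)^[r] (fwdDiff d u) i =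
      ∑ j ∈ Finset.range d, (fwdDiff 1)^[r + 1] u (i + j) := by
  have hcomm : Function.Commute (fwdDiff (1 : ℕ) : (ℕ → ℝ) → ℕ → ℝ) (fwdDiff d) := by
    intro f
    funext n
    simp only [fwdDiff]
    rw [show n + 1 + d = n + d + 1 by ring]
    ring
  have h := (hcomm.iterate_left r) u
  rw [h]
  simp only [Function.iterate_succ_apply', fwdDiff]
  exact (Finset.sum_range_sub (fun j => (fwdDiff 1)^[r] u (i + j)) d).symm

lemma fwdDiff_iter_fwdDiff_mem (u : ℕ → ℝ) (D r L : ℕ) (lam mu : ℝ)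
    (h : ∀ i, i + (r + 1) < L →
      lam ≤ (fwdDiff 1)^[r + 1] u i ∧ (fwdDiff 1)^[r + 1] u i ≤ mu) :
    ∀ i, i + r < L - D →
      D * lam ≤ (fwdDiff 1)^[r] (fwdDiff D u) i ∧ (fwdDiff 1)^[r] (fwdDiff D u) i ≤ D * mu := by
  intro i hi
  rw [fwdDiff_iter_fwdDiff]
  constructor
  · have := Finset.card_nsmul_le_sum (Finset.range D)
      (fun j => (fwdDiff 1)^[r + 1] u (i + j)) lam (fun j hj => (h (i + j) (by
        have := Finset.mem_range.1 hj
        omega)).1)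
    simpa using this
  · have := Finset.sum_le_card_nsmul (Finset.range D)
      (fun j => (fwdDiff 1)^[r + 1] u (i + j)) mu (fun j hj => (h (i + j) (by
        have := Finset.mem_range.1 hj
        omega)).2)
    simpa using this

lemma abs_fwdDiff_iter_fwdDiff_le (u : ℕ → ℝ) (D r L : ℕ) (nu : ℝ)
    (h : ∀ i, i + (r + 1) < L → |(fwdDiff 1)^[r + 1] u i| ≤ nu) :
    ∀ i, i + r < L - D → |(fwdDiff 1)^[r] (fwdDiff D u) i| ≤ D * nu := by
  intro i hi
  have := fwdDiff_iter_fwdDiff_mem u D r L (-nu) nu (fun i hi => abs_le.1 (h i hi)) i hi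
  rw [abs_le]
  constructor <;> linarith

lemma sum_range_le_add_sum_inv (C : ℕ → ℝ) (H : ℕ) (L0 W : ℝ) (hW : 0 ≤ W) (hL0 : 0 ≤ L0)
    (h0 : C 0 ≤ L0) (h : ∀ d, 1 ≤ d → d < H → C d ≤ W / d) :
    ∑ d ∈ Finset.range H, C d ≤ L0 + W * (1 + Real.log H) := by
  rcases H with _ | n
  · simp
    positivity
  rw [Finset.sum_range_succ']
  have h1 : ∑ d ∈ Finset.range n, C (d + 1) ≤ W * (1 + Real.log ((n + 1 : ℕ) : ℝ)) := by
    calc _ ≤ ∑ d ∈ Finset.range n, W * ((d : ℝ) + 1)⁻¹ := by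
            refine Finset.sum_le_sum fun d hd => ?_
            have := h (d + 1) (by omega) (by have := Finset.mem_range.1 hd; omega)
            push_cast at this
            rwa [div_eq_mul_inv] at this
      _ = W * ((harmonic n : ℚ) : ℝ) := by
            rw [← Finset.mul_sum, harmonic]
            push_cast
            rfl
      _ ≤ W * (1 + Real.log n) := by
            gcongr
            exact harmonic_le_one_add_log n
      _ ≤ _ := by
            rcases Nat.eq_zero_or_pos n with rfl | hn
            · simp
            · gcongr
              omega
  linarith

/-- Exponential sums over a phase whose difference of order `j + 2` has constant sign and
controlled size: `j` Weyl differencings with few shifts, followed by one with `H` shifts and the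
Kusmin–Landau inequality. The first differencing uses multiples of `q` as shifts, so only the
differences `F (i + q * d) - F i` modulo `1` matter. -/
theorem exists_norm_sum_unitExp_le (j : ℕ) :
    ∃ C : ℝ, 1 ≤ C ∧ ∀ (δ L0 lam mu nu : ℝ) (H q L : ℕ) (F u : ℕ → ℝ),
      0 < δ → δ ≤ 1 → 0 < lam → lam ≤ mu → 0 ≤ nu → 1 ≤ q → (L : ℝ) ≤ L0 →
      1 ≤ H * δ ^ (2 ^ (j + 1)) →
      2 ^ (j + 1) * q * H * mu ≤ δ ^ (2 ^ (j + 1) - 2) →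
      (q : ℝ) * H ≤ L0 →
      (1 / lam + L0 * nu / lam ^ 2) * (1 + Real.log H) ≤ q * H * L0 * δ ^ (2 ^ (j + 1)) →
      (∀ i d, unitExp (F (i + q * d) - F i) = unitExp (u (i + q * d) - u i)) →
      (∀ i, i + (j + 2) < L →
        lam ≤ (fwdDiff 1)^[j + 2] u i ∧ (fwdDiff 1)^[j + 2] u i ≤ mu) →
      (∀ i, i + (j + 3) < L → |(fwdDiff 1)^[j + 3] u i| ≤ nu) →
      ‖∑ i ∈ Finset.range L, unitExp (F i)‖ ≤ C * L0 * δ := by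
  have hcorr : ∀ (L q d : ℕ) (F u : ℕ → ℝ),
      (∀ i d, unitExp (F (i + q * d) - F i) = unitExp (u (i + q * d) - u i)) →
      ∑ i ∈ Finset.range (L - q * d), unitExp (F (i + q * d)) * (starRingEnd ℂ) (unitExp (F i)) =
        ∑ i ∈ Finset.range (L - q * d), unitExp (fwdDiff (q * d) u i) := by
    intro L q d F u h
    refine Finset.sum_congr rfl fun i _ => ?_
    rw [← unitExp_sub, h]
    rfl
  have htriv : ∀ (L : ℕ) (L0 : ℝ) (u : ℕ → ℝ), (L : ℝ) ≤ L0 →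
      ‖∑ i ∈ Finset.range L, unitExp (u i)‖ ≤ L0 := by
    intro L L0 u h
    refine (norm_sum_le _ _).trans ?_
    simp only [norm_unitExp]
    simpa using h
  induction j with
  | zero =>
    refine ⟨3, by norm_num, ?_⟩
    intro δ L0 lam mu nu H q L F u hδ hδ1 hlam hlm hnu hq hL hc1 hc2 hc3 hc4 hF hu1 hu2
    simp only [zero_add, pow_one, Nat.sub_self, pow_zero] at *
    have hH : 0 < H := by
      rcases Nat.eq_zero_or_pos H with rfl | h
      · norm_num at hc1
      · exact h
    have hHr : (0 : ℝ) < H := by exact_mod_cast hH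
    have hqr : (0 : ℝ) < q := by exact_mod_cast hq
    have hL0 : 0 ≤ L0 := le_trans (by positivity) hL
    have hmu : 0 < mu := hlam.trans_le hlm
    set W := 1 / lam + L0 * nu / lam ^ 2 with hW
    have hWnn : 0 ≤ W := by positivity
    have hv := van_der_corput_inequality (fun i => unitExp (F i)) L H q
    have hS := sum_range_le_add_sum_inv
      (fun d => ‖∑ i ∈ Finset.range (L - q * d),
        unitExp (F (i + q * d)) * (starRingEnd ℂ) (unitExp (F i))‖) H L0 (W / q) (by positivity)
      hL0 (by
        rw [hcorr L q 0 F u hF]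
        exact htriv _ _ _ (by simpa using hL)) (by
        intro d hd1 hdH
        rw [hcorr L q d F u hF]
        have hdr : (0 : ℝ) < d := by exact_mod_cast hd1
        have hdH' : (d : ℝ) ≤ H := by exact_mod_cast hdH.le
        have hqd : ((q * d : ℕ) : ℝ) = q * d := by push_cast; rfl
        have hhalf : ((q * d : ℕ) : ℝ) * mu ≤ 1 / 2 := by
          rw [hqd]
          have : (q : ℝ) * d * mu ≤ q * H * mu := by gcongr
          linarith
        have hm1 := fwdDiff_iter_fwdDiff_mem u (q * d) 1 L lam mu hu1
        have hm2 := abs_fwdDiff_iter_fwdDiff_le u (q * d) 2 L nu hu2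
        have hkl := norm_sum_unitExp_le_of_diff (fwdDiff (q * d) u) (L - q * d)
          ((q * d : ℕ) * lam) ((q * d : ℕ) * nu) (by rw [hqd]; positivity) (by positivity)
          (fun i hi => ⟨(hm1 i hi).1, (hm1 i hi).2.trans hhalf⟩)
          (fun i hi => hm2 i hi)
          (le_trans (by gcongr) hhalf)
        refine hkl.trans ?_
        rw [hqd, hW]
        have hL' : ((L - q * d : ℕ) : ℝ) ≤ L0 := le_trans (by exact_mod_cast Nat.sub_le _ _) hL
        calc 1 / (q * d * lam) + ((L - q * d : ℕ) : ℝ) * (q * d * nu) / (q * d * lam) ^ 2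
            ≤ 1 / (q * d * lam) + L0 * (q * d * nu) / (q * d * lam) ^ 2 := by gcongr
          _ = _ := by field_simp)
    have hcombine : ‖∑ i ∈ Finset.range L, unitExp (F i)‖ ^ 2 * H ≤
        2 * (L0 + L0) * (L0 + W / q * (1 + Real.log H)) := by
      refine hv.trans ?_
      have : (0 : ℝ) ≤ ∑ d ∈ Finset.range H, ‖∑ i ∈ Finset.range (L - q * d),
        unitExp (F (i + q * d)) * (starRingEnd ℂ) (unitExp (F i))‖ := by positivity
      gcongr
    have h4 : W / q * (1 + Real.log H) ≤ H * L0 * δ ^ 2 := by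
      rw [div_mul_eq_mul_div, div_le_iff₀ hqr]
      linarith
    have h5 : ‖∑ i ∈ Finset.range L, unitExp (F i)‖ ^ 2 * H ≤ (3 * L0 * δ) ^ 2 * H := by
      have h6 : L0 ≤ L0 * (H * δ ^ 2) := le_mul_of_one_le_right hL0 hc1
      calc _ ≤ 2 * (L0 + L0) * (L0 + W / q * (1 + Real.log H)) := hcombine
        _ ≤ 2 * (L0 + L0) * (L0 * (H * δ ^ 2) + H * L0 * δ ^ 2) := by gcongr
        _ = 8 * (L0 ^ 2 * δ ^ 2 * H) := by ring
        _ ≤ 9 * (L0 ^ 2 * δ ^ 2 * H) := by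
            have : 0 ≤ L0 ^ 2 * δ ^ 2 * H := by positivity
            linarith
        _ = _ := by ring
    have h6 := le_of_mul_le_mul_right h5 hHr
    exact (pow_le_pow_iff_left₀ (norm_nonneg _) (by positivity) (by norm_num)).1 h6
  | succ j ih =>
    obtain ⟨C, hC1, ih⟩ := ih
    refine ⟨3 * C, by linarith, ?_⟩
    intro δ L0 lam mu nu H q L F u hδ hδ1 hlam hlm hnu hq hL hc1 hc2 hc3 hc4 hF hu1 hu2
    have hH : 0 < H := by
      rcases Nat.eq_zero_or_pos H with rfl | h
      · norm_num at hc1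
      · exact h
    have hHr : (0 : ℝ) < H := by exact_mod_cast hH
    have hqr : (0 : ℝ) < q := by exact_mod_cast hq
    have hq1 : (1 : ℝ) ≤ q := by exact_mod_cast hq
    have hL0 : 0 ≤ L0 := le_trans (by positivity) hL
    have hmu : 0 < mu := hlam.trans_le hlm
    have hpow4 : 2 ≤ 2 ^ (j + 1) := by
      calc 2 = 2 ^ 1 := rfl
        _ ≤ 2 ^ (j + 1) := Nat.pow_le_pow_right (by norm_num) (by omega)
    have hpow : 2 ^ (j + 1 + 1) = 2 * 2 ^ (j + 1) := by rw [pow_succ]; ring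
    set H' := ⌈(δ ^ 2)⁻¹⌉₊ with hH'
    have hd2 : 0 < δ ^ 2 := by positivity
    have hd21 : δ ^ 2 ≤ 1 := pow_le_one₀ hδ.le hδ1
    have hinv1 : 1 ≤ (δ ^ 2)⁻¹ := (one_le_inv₀ hd2).2 hd21
    have hH'lb : (δ ^ 2)⁻¹ ≤ H' := Nat.le_ceil _
    have hH'pos : (0 : ℝ) < H' := by linarith
    have hH'ub : (H' : ℝ) ≤ 2 * (δ ^ 2)⁻¹ := by
      have := Nat.ceil_lt_add_one (a := (δ ^ 2)⁻¹) (by positivity)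
      linarith
    have hH'H : H' ≤ H := by
      rw [hH', Nat.ceil_le, inv_le_iff_one_le_mul₀ hd2]
      refine hc1.trans ?_
      gcongr ?_ * ?_
      exact pow_le_pow_of_le_one hδ.le hδ1 (by omega)
    have hqH' : (q : ℝ) * H' ≤ L0 := by
      refine le_trans ?_ hc3
      gcongr
    have hv := van_der_corput_inequality (fun i => unitExp (F i)) L H' q
    have hlogH : 0 ≤ Real.log H := Real.log_nonneg (by exact_mod_cast hH)
    have hS : ∑ d ∈ Finset.range H', ‖∑ i ∈ Finset.range (L - q * d),
        unitExp (F (i + q * d)) * (starRingEnd ℂ) (unitExp (F i))‖ ≤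
        L0 + H' * (C * L0 * δ ^ 2) := by
      have hH'0 : 0 < H' := by exact_mod_cast hH'pos
      obtain ⟨n, hn⟩ : ∃ n, H' = n + 1 := ⟨H' - 1, by omega⟩
      rw [hn, Finset.sum_range_succ', add_comm L0]
      refine add_le_add ?_ ?_
      · have : ∀ d ∈ Finset.range n, ‖∑ i ∈ Finset.range (L - q * (d + 1)),
            unitExp (F (i + q * (d + 1))) * (starRingEnd ℂ) (unitExp (F i))‖ ≤
              C * L0 * δ ^ 2 := by
          intro d hd
          rw [hcorr L q (d + 1) F u hF]
          have hdH : d + 1 < H' := by have := Finset.mem_range.1 hd; omega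
          have hdr : ((d + 1 : ℕ) : ℝ) ≤ 2 * (δ ^ 2)⁻¹ :=
            le_trans (by exact_mod_cast hdH.le) hH'ub
          set D := d + 1 with hD
          have hDr : (1 : ℝ) ≤ D := by
            have : 1 ≤ D := by omega
            exact_mod_cast this
          have hqd : ((q * D : ℕ) : ℝ) = q * D := by push_cast; rfl
          have hDpos : (0 : ℝ) < D := by linarith
          refine ih (δ ^ 2) L0 ((q * D : ℕ) * lam) ((q * D : ℕ) * mu) ((q * D : ℕ) * nu) H 1
            (L - q * D) (fwdDiff (q * D) u) (fwdDiff (q * D) u) hd2 hd21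
            (by rw [hqd]; positivity) (by gcongr) (by positivity) le_rfl
            (le_trans (by exact_mod_cast Nat.sub_le _ _) hL) ?_ ?_ ?_ ?_ (fun _ _ => rfl)
            (fwdDiff_iter_fwdDiff_mem u (q * D) (j + 2) L lam mu hu1)
            (abs_fwdDiff_iter_fwdDiff_le u (q * D) (j + 3) L nu hu2)
          · rw [← pow_mul, ← hpow]
            exact hc1
          · rw [hqd, ← pow_mul, Nat.mul_sub, ← hpow]
            have h1 : δ ^ (2 ^ (j + 1 + 1) - 2) =
                δ ^ 2 * δ ^ (2 ^ (j + 1 + 1) - 2 * 2) := by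
              rw [← pow_add]
              congr 1
              omega
            rw [h1] at hc2
            calc (2 : ℝ) ^ (j + 1) * (1 : ℕ) * H * (q * D * mu)
                ≤ (2 : ℝ) ^ (j + 1) * (1 : ℕ) * H * (q * (2 * (δ ^ 2)⁻¹) * mu) := by gcongr
              _ = (2 ^ (j + 1 + 1) * q * H * mu) * (δ ^ 2)⁻¹ := by push_cast; ring
              _ ≤ (δ ^ 2 * δ ^ (2 ^ (j + 1 + 1) - 2 * 2)) * (δ ^ 2)⁻¹ := by gcongr
              _ = _ := by field_simp
          · push_cast
            refine le_trans ?_ hc3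
            gcongr
          · rw [hqd, ← pow_mul, ← hpow]
            have h1 : 1 / (q * D * lam) + L0 * (q * D * nu) / (q * D * lam) ^ 2 =
                (1 / lam + L0 * nu / lam ^ 2) / (q * D) := by field_simp
            rw [h1, div_mul_eq_mul_div, div_le_iff₀ (by positivity)]
            refine hc4.trans ?_
            have : 0 ≤ q * H * L0 * δ ^ (2 ^ (j + 1 + 1)) := by positivity
            push_cast
            nlinarith
        refine (Finset.sum_le_card_nsmul _ _ _ this).trans ?_
        rw [Finset.card_range, nsmul_eq_mul]
        gcongr
        omega
      · rw [hcorr L q 0 F u hF]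
        exact htriv _ _ _ (by simpa using hL)
    have hcombine : ‖∑ i ∈ Finset.range L, unitExp (F i)‖ ^ 2 * H' ≤
        2 * (L0 + L0) * (L0 + H' * (C * L0 * δ ^ 2)) := by
      refine hv.trans ?_
      have : (0 : ℝ) ≤ ∑ d ∈ Finset.range H', ‖∑ i ∈ Finset.range (L - q * d),
        unitExp (F (i + q * d)) * (starRingEnd ℂ) (unitExp (F i))‖ := by positivity
      gcongr
    have h5 : ‖∑ i ∈ Finset.range L, unitExp (F i)‖ ^ 2 * H' ≤ (3 * C * L0 * δ) ^ 2 * H' := by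
      have h6 : L0 ≤ L0 * (H' * δ ^ 2) := by
        refine le_mul_of_one_le_right hL0 ?_
        rwa [inv_le_iff_one_le_mul₀ hd2] at hH'lb
      have h7 : 0 ≤ L0 ^ 2 * δ ^ 2 * H' := by positivity
      calc _ ≤ 2 * (L0 + L0) * (L0 + H' * (C * L0 * δ ^ 2)) := hcombine
        _ ≤ 2 * (L0 + L0) * (L0 * (H' * δ ^ 2) + H' * (C * L0 * δ ^ 2)) := by gcongr
        _ = (4 + 4 * C) * (L0 ^ 2 * δ ^ 2 * H') := by ring
        _ ≤ (9 * C ^ 2) * (L0 ^ 2 * δ ^ 2 * H') := by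
            gcongr
            nlinarith
        _ = _ := by ring
    have h6 := le_of_mul_le_mul_right h5 hH'pos
    exact (pow_le_pow_iff_left₀ (norm_nonneg _) (by positivity) (by norm_num)).1 h6

set_option maxHeartbeats 1600000 in
/-- A power-saving form of the `(j + 2)`-nd derivative test on an interval of length `≤ 2 * X`,
whose hypotheses are inequalities between powers of `X`. -/
theorem exists_norm_sum_unitExp_le_rpow_pos (j : ℕ) (C0 η ω ε : ℝ) (hC0 : 1 ≤ C0) (hη : 0 < η)
    (hω : 0 ≤ ω) (hε : 0 < ε)
    (hB' : ((2 : ℝ) ^ (j + 2) - 2) * η + 2 * ω + ε ≤ 1) :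
    ∃ C : ℝ, 0 < C ∧ ∀ (X Λ : ℝ) (q L : ℕ) (F u : ℕ → ℝ),
      1 ≤ X → 0 < Λ → 1 ≤ q → (L : ℝ) ≤ 2 * X →
      (q : ℝ) * Λ ≤ X ^ (((j : ℝ) + 2) - ((2 : ℝ) ^ (j + 2) - 2) * η - ε) →
      (q : ℝ) ≤ X ^ (1 - (2 : ℝ) ^ (j + 1) * η - ε) →
      X ^ ((j : ℝ) + (2 : ℝ) ^ (j + 1) * η + 2 * ω + ε) ≤ Λ →
      (∀ i d, unitExp (F (i + q * d) - F i) = unitExp (u (i + q * d) - u i)) →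
      (∀ i, i + (j + 2) < L →
        X ^ (-ω) * Λ * X ^ (-((j : ℝ) + 2)) / C0 ≤ (fwdDiff 1)^[j + 2] u i ∧
          (fwdDiff 1)^[j + 2] u i ≤ C0 * Λ * X ^ (-((j : ℝ) + 2))) →
      (∀ i, i + (j + 3) < L →
        |(fwdDiff 1)^[j + 3] u i| ≤ C0 * Λ * X ^ (-((j : ℝ) + 3))) →
      ‖∑ i ∈ Finset.range L, unitExp (F i)‖ ≤ C * X ^ (1 - η) := by
  obtain ⟨C, hC1, hmain⟩ := exists_norm_sum_unitExp_le j
  set K0 : ℝ := 2 ^ (j + 1) * C0 + 3 * C0 ^ 3 * (1 + 8 / ε) + 2 with hK0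
  have hC0pos : 0 < C0 := by linarith
  have hK2 : 2 ≤ K0 := by rw [hK0]; have : 0 ≤ 2 ^ (j + 1) * C0 + 3 * C0 ^ 3 * (1 + 8 / ε) := by positivity
                          linarith
  have hKa : 2 ^ (j + 1) * C0 ≤ K0 := by
    rw [hK0]; have : 0 ≤ 3 * C0 ^ 3 * (1 + 8 / ε) := by positivity
    linarith
  have hKb : 3 * C0 ^ 3 * (1 + 8 / ε) ≤ K0 := by
    rw [hK0]; have : 0 ≤ 2 ^ (j + 1) * C0 := by positivity
    linarith
  refine ⟨2 * C + 2 * K0 ^ (8 / ε * η), by positivity, ?_⟩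
  intro X Λ q L F u hX hΛ hq hL hA hA' hB hF hu1 hu2
  have hX0 : 0 < X := by linarith
  have hq0 : (0 : ℝ) < q := by exact_mod_cast hq
  have hX1η : 0 < X ^ (1 - η) := Real.rpow_pos_of_pos hX0 _
  rcases le_or_gt K0 (X ^ (ε / 8)) with hbig | hsmall
  swap
  · have h1 : X ≤ K0 ^ (8 / ε) := by
      have := Real.rpow_le_rpow (by positivity) hsmall.le (by positivity : 0 ≤ 8 / ε)
      rwa [← Real.rpow_mul hX0.le, show ε / 8 * (8 / ε) = 1 by field_simp, Real.rpow_one] at this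
    have h2 : X ^ η ≤ K0 ^ (8 / ε * η) := by
      rw [Real.rpow_mul (by linarith)]
      exact Real.rpow_le_rpow hX0.le h1 hη.le
    calc ‖∑ i ∈ Finset.range L, unitExp (F i)‖ ≤ ∑ i ∈ Finset.range L, ‖unitExp (F i)‖ :=
          norm_sum_le _ _
      _ = L := by simp [norm_unitExp]
      _ ≤ 2 * X := hL
      _ = 2 * X ^ η * X ^ (1 - η) := by
          rw [mul_assoc, ← Real.rpow_add hX0]; norm_num
      _ ≤ 2 * K0 ^ (8 / ε * η) * X ^ (1 - η) := by gcongr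
      _ ≤ _ := by
          gcongr
          linarith
  · set M : ℝ := (2 : ℝ) ^ (j + 1) with hM
    have hM2 : (2 : ℝ) ^ (j + 2) = 2 * M := by rw [hM, pow_succ _ (j + 1)]; ring
    rw [hM2] at hB' hA
    have hMge : 2 ≤ M := by
      rw [hM, pow_succ]
      have : (1 : ℝ) ≤ 2 ^ j := one_le_pow₀ (by norm_num)
      linarith
    set P : ℝ := X ^ ((j : ℝ) + 2 - (M - 2) * η - ε / 2) with hP
    have hPpos : 0 < P := Real.rpow_pos_of_pos hX0 _
    set Z : ℝ := min (X / q) (P / (q * Λ)) with hZ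
    have hZ1 : Z ≤ X / q := min_le_left _ _
    have hZ2 : Z ≤ P / (q * Λ) := min_le_right _ _
    have hZlb : X ^ (M * η) * X ^ (ε / 2) ≤ Z := by
      rw [← Real.rpow_add hX0]
      refine le_min ?_ ?_
      · rw [le_div_iff₀ hq0]
        calc X ^ (M * η + ε / 2) * q ≤ X ^ (M * η + ε / 2) * X ^ (1 - M * η - ε) := by gcongr
          _ = X ^ (1 - ε / 2) := by rw [← Real.rpow_add hX0]; ring_nf
          _ ≤ X ^ (1 : ℝ) := Real.rpow_le_rpow_of_exponent_le hX (by linarith)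
          _ = X := Real.rpow_one X
      · rw [le_div_iff₀ (by positivity)]
        calc X ^ (M * η + ε / 2) * (q * Λ)
            ≤ X ^ (M * η + ε / 2) * X ^ (((j : ℝ) + 2) - (2 * M - 2) * η - ε) := by gcongr
          _ = P := by rw [← Real.rpow_add hX0, hP]; ring_nf
    have hXε : X ^ (ε / 8) ≤ X ^ (ε / 2) := Real.rpow_le_rpow_of_exponent_le hX (by linarith)
    have hXMη : 1 ≤ X ^ (M * η) := Real.one_le_rpow hX (by positivity)
    have hZ2' : 2 * X ^ (M * η) ≤ Z := by
      refine le_trans ?_ hZlb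
      rw [mul_comm]
      gcongr
      linarith
    set H : ℕ := ⌊Z⌋₊ with hH
    have hHZ : (H : ℝ) ≤ Z := Nat.floor_le (by linarith)
    have hZH : Z / 2 ≤ H := by
      have := Nat.lt_floor_add_one Z
      rw [← hH] at this
      linarith
    have hδ : 0 < X ^ (-η) := Real.rpow_pos_of_pos hX0 _
    have hδM : (X ^ (-η)) ^ (2 ^ (j + 1)) = X ^ (-(M * η)) := by
      rw [← Real.rpow_natCast, ← Real.rpow_mul hX0.le]
      congr 1
      push_cast
      rw [hM]; ring
    have hpow4 : 2 ≤ 2 ^ (j + 1) := by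
      calc 2 = 2 ^ 1 := rfl
        _ ≤ 2 ^ (j + 1) := Nat.pow_le_pow_right (by norm_num) (by omega)
    have hδM2 : (X ^ (-η)) ^ (2 ^ (j + 1) - 2) = X ^ (-((M - 2) * η)) := by
      rw [← Real.rpow_natCast, ← Real.rpow_mul hX0.le]
      congr 1
      rw [Nat.cast_sub hpow4]
      push_cast
      rw [hM]; ring
    have hcancel : X ^ (M * η) * X ^ (-(M * η)) = 1 := by
      rw [← Real.rpow_add hX0]; simp
    have hXω : X ^ (-ω) ≤ 1 := Real.rpow_le_one_of_one_le_of_nonpos hX (by linarith)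
    have hXr : 0 < X ^ (-((j : ℝ) + 2)) := Real.rpow_pos_of_pos hX0 _
    have hXr3 : X ^ (-((j : ℝ) + 3)) = X ^ (-((j : ℝ) + 2)) / X := by
      rw [← Real.rpow_sub_one hX0.ne']; ring_nf
    have hXωpos : 0 < X ^ (-ω) := Real.rpow_pos_of_pos hX0 _
    have hHpos : 0 < H := by
      have : (0 : ℝ) < H := by linarith
      exact_mod_cast this
    have hHr : (1 : ℝ) ≤ H := by exact_mod_cast hHpos
    have hqH : (q : ℝ) * H ≤ X := by
      have : (H : ℝ) ≤ X / q := hHZ.trans hZ1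
      rw [le_div_iff₀ hq0] at this
      linarith
    have hHX : (H : ℝ) ≤ X := by
      have hq1 : (1 : ℝ) ≤ q := by exact_mod_cast hq
      nlinarith
    have hlog : 1 + Real.log H ≤ (1 + 8 / ε) * X ^ (ε / 8) := by
      have h1 : Real.log H ≤ Real.log X := Real.log_le_log (by linarith) hHX
      have h2 := Real.log_le_rpow_div hX0.le (by positivity : 0 < ε / 8)
      have h3 : 1 ≤ X ^ (ε / 8) := by linarith
      have h4 : X ^ (ε / 8) / (ε / 8) = 8 / ε * X ^ (ε / 8) := by field_simp
      linarith
    have hlog0 : 0 ≤ 1 + Real.log H := by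
      have := Real.log_nonneg hHr
      linarith
    have key := hmain (X ^ (-η)) (2 * X) (X ^ (-ω) * Λ * X ^ (-((j : ℝ) + 2)) / C0)
      (C0 * Λ * X ^ (-((j : ℝ) + 2))) (C0 * Λ * X ^ (-((j : ℝ) + 3))) H q L F u hδ
      (Real.rpow_le_one_of_one_le_of_nonpos hX (by linarith)) (by positivity) ?_ (by positivity)
      hq hL ?_ ?_ (by linarith) ?_ hF hu1 hu2
    · refine key.trans ?_
      have : X ^ (1 - η) = X * X ^ (-η) := by
        rw [sub_eq_add_neg, Real.rpow_add hX0, Real.rpow_one]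
      rw [this] at hX1η ⊢
      have : 0 ≤ 2 * K0 ^ (8 / ε * η) := by positivity
      nlinarith
    · rw [div_le_iff₀ hC0pos]
      calc X ^ (-ω) * Λ * X ^ (-((j : ℝ) + 2)) ≤ 1 * Λ * X ^ (-((j : ℝ) + 2)) := by gcongr
        _ = 1 * (Λ * X ^ (-((j : ℝ) + 2))) * 1 := by ring
        _ ≤ C0 * (Λ * X ^ (-((j : ℝ) + 2))) * C0 := by gcongr
        _ = _ := by ring
    · rw [hδM]
      calc 1 = X ^ (M * η) * X ^ (-(M * η)) := hcancel.symm
        _ ≤ _ := by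
            gcongr
            linarith
    · rw [hδM2]
      have h1 : (q : ℝ) * H * Λ ≤ P := by
        have : (H : ℝ) ≤ P / (q * Λ) := hHZ.trans hZ2
        rw [le_div_iff₀ (by positivity)] at this
        linarith
      calc 2 ^ (j + 1) * q * H * (C0 * Λ * X ^ (-((j : ℝ) + 2)))
          = (2 ^ (j + 1) * C0) * (q * H * Λ) * X ^ (-((j : ℝ) + 2)) := by ring
        _ ≤ X ^ (ε / 2) * P * X ^ (-((j : ℝ) + 2)) := by
            gcongr
            exact hKa.trans (hbig.trans hXε)
        _ = X ^ (-((M - 2) * η)) := by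
            rw [hP, ← Real.rpow_add hX0, ← Real.rpow_add hX0]; ring_nf
    · rw [hδM, hXr3]
      have hR0 : X ^ ((j : ℝ) + 2) * X ^ (-((j : ℝ) + 2)) = 1 := by
        rw [← Real.rpow_add hX0]; simp
      have hω0 : X ^ ω * X ^ (-ω) = 1 := by
        rw [← Real.rpow_add hX0]; simp
      have e1 : X ^ ω = (X ^ (-ω))⁻¹ := eq_inv_of_mul_eq_one_left hω0
      have e2 : X ^ ((j : ℝ) + 2) = (X ^ (-((j : ℝ) + 2)))⁻¹ := eq_inv_of_mul_eq_one_left hR0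
      have hXω1 : 1 ≤ X ^ ω := Real.one_le_rpow hX hω
      have hlhs : 1 / (X ^ (-ω) * Λ * X ^ (-((j : ℝ) + 2)) / C0) +
          2 * X * (C0 * Λ * (X ^ (-((j : ℝ) + 2)) / X)) /
            (X ^ (-ω) * Λ * X ^ (-((j : ℝ) + 2)) / C0) ^ 2 =
          (C0 * X ^ ω + 2 * C0 ^ 3 * (X ^ ω * X ^ ω)) * (X ^ ((j : ℝ) + 2) / Λ) := by
        rw [e1, e2]
        field_simp
      rw [hlhs]
      have hle : (C0 * X ^ ω + 2 * C0 ^ 3 * (X ^ ω * X ^ ω)) ≤ 3 * C0 ^ 3 * (X ^ ω * X ^ ω) := by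
        have a1 : C0 ≤ C0 ^ 3 := le_self_pow₀ hC0 (by norm_num)
        have a2 : X ^ ω ≤ X ^ ω * X ^ ω := le_mul_of_one_le_left (by positivity) hXω1
        have : C0 * X ^ ω ≤ C0 ^ 3 * (X ^ ω * X ^ ω) := by gcongr
        linarith
      have hXr' : 0 < X ^ ((j : ℝ) + 2) := Real.rpow_pos_of_pos hX0 _
      have hqZ : X ^ (2 * ω + ((j : ℝ) + 2) + ε / 4 - 1 + M * η) / Λ ≤ q * Z := by
        rw [hZ, mul_min_of_nonneg _ _ hq0.le]
        refine le_min ?_ ?_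
        · rw [mul_div_cancel₀ _ hq0.ne', div_le_iff₀ hΛ]
          calc X ^ (2 * ω + ((j : ℝ) + 2) + ε / 4 - 1 + M * η)
              ≤ X ^ (1 + ((j : ℝ) + M * η + 2 * ω + ε)) :=
                Real.rpow_le_rpow_of_exponent_le hX (by linarith)
            _ = X * X ^ ((j : ℝ) + M * η + 2 * ω + ε) := by
                rw [Real.rpow_add hX0, Real.rpow_one]
            _ ≤ X * Λ := by gcongr
        · have : (q : ℝ) * (P / (q * Λ)) = P / Λ := by field_simp
          rw [this]
          gcongr
          exact Real.rpow_le_rpow_of_exponent_le hX (by nlinarith)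
      calc (C0 * X ^ ω + 2 * C0 ^ 3 * (X ^ ω * X ^ ω)) * (X ^ ((j : ℝ) + 2) / Λ) *
            (1 + Real.log H)
          ≤ (3 * C0 ^ 3 * (X ^ ω * X ^ ω)) * (X ^ ((j : ℝ) + 2) / Λ) *
            ((1 + 8 / ε) * X ^ (ε / 8)) := by gcongr
        _ = (3 * C0 ^ 3 * (1 + 8 / ε)) * (X ^ ω * X ^ ω * X ^ ((j : ℝ) + 2) * X ^ (ε / 8) / Λ) := by
            ring
        _ ≤ X ^ (ε / 8) * (X ^ ω * X ^ ω * X ^ ((j : ℝ) + 2) * X ^ (ε / 8) / Λ) := by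
            gcongr
            exact hKb.trans hbig
        _ = (X ^ (2 * ω + ((j : ℝ) + 2) + ε / 4 - 1 + M * η) / Λ) * (X * X ^ (-(M * η))) := by
            have : X ^ (ε / 8) * (X ^ ω * X ^ ω * X ^ ((j : ℝ) + 2) * X ^ (ε / 8)) =
              X ^ (2 * ω + ((j : ℝ) + 2) + ε / 4 - 1 + M * η) * (X * X ^ (-(M * η))) := by
              rw [show X * X ^ (-(M * η)) = X ^ (1 + -(M * η)) by
                rw [Real.rpow_add hX0, Real.rpow_one]]
              simp only [← Real.rpow_add hX0]
              ring_nf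
            rw [mul_div_assoc', this]
            ring
        _ ≤ (q * Z) * (X * X ^ (-(M * η))) := by gcongr
        _ ≤ (q * (2 * H)) * (X * X ^ (-(M * η))) := by
            gcongr
            linarith
        _ = _ := by ring

/-- A version of `exists_norm_sum_unitExp_le_rpow_pos` for derivatives of either sign `σ = ±1`. -/
theorem exists_norm_sum_unitExp_le_rpow (j : ℕ) (C0 η ω ε : ℝ) (hC0 : 1 ≤ C0) (hη : 0 < η)
    (hω : 0 ≤ ω) (hε : 0 < ε)
    (hB' : ((2 : ℝ) ^ (j + 2) - 2) * η + 2 * ω + ε ≤ 1) :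
    ∃ C : ℝ, 0 < C ∧ ∀ (σ X Λ : ℝ) (q L : ℕ) (F u : ℕ → ℝ), (σ = 1 ∨ σ = -1) →
      1 ≤ X → 0 < Λ → 1 ≤ q → (L : ℝ) ≤ 2 * X →
      (q : ℝ) * Λ ≤ X ^ (((j : ℝ) + 2) - ((2 : ℝ) ^ (j + 2) - 2) * η - ε) →
      (q : ℝ) ≤ X ^ (1 - (2 : ℝ) ^ (j + 1) * η - ε) →
      X ^ ((j : ℝ) + (2 : ℝ) ^ (j + 1) * η + 2 * ω + ε) ≤ Λ →
      (∀ i d, unitExp (F (i + q * d) - F i) = unitExp (u (i + q * d) - u i)) →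
      (∀ i, i + (j + 2) < L →
        X ^ (-ω) * Λ * X ^ (-((j : ℝ) + 2)) / C0 ≤ σ * (fwdDiff 1)^[j + 2] u i ∧
          σ * (fwdDiff 1)^[j + 2] u i ≤ C0 * Λ * X ^ (-((j : ℝ) + 2))) →
      (∀ i, i + (j + 3) < L →
        |(fwdDiff 1)^[j + 3] u i| ≤ C0 * Λ * X ^ (-((j : ℝ) + 3))) →
      ‖∑ i ∈ Finset.range L, unitExp (F i)‖ ≤ C * X ^ (1 - η) := by
  obtain ⟨C, hC, h⟩ := exists_norm_sum_unitExp_le_rpow_pos j C0 η ω ε hC0 hη hω hε hB'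
  refine ⟨C, hC, ?_⟩
  rintro σ X Λ q L F u (rfl | rfl) hX hΛ hq hL hA hA' hB hF hu1 hu2
  · simp only [one_mul] at hu1
    exact h X Λ q L F u hX hΛ hq hL hA hA' hB hF hu1 hu2
  · have hiter : ∀ r i, (fwdDiff 1)^[r] ((-1 : ℝ) • u) i = -1 * (fwdDiff 1)^[r] u i := by
      intro r i
      rw [fwdDiff_iter_const_smul]
      rfl
    have key := h X Λ q L (fun i => -F i) ((-1 : ℝ) • u) hX hΛ hq hL hA hA' hB ?_ ?_ ?_
    · have : ∑ i ∈ Finset.range L, unitExp (-F i) =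
          (starRingEnd ℂ) (∑ i ∈ Finset.range L, unitExp (F i)) := by
        rw [map_sum]
        exact Finset.sum_congr rfl fun i _ => unitExp_neg _
      rwa [this, RCLike.norm_conj] at key
    · intro i d
      have := congrArg (starRingEnd ℂ) (hF i d)
      rw [← unitExp_neg, ← unitExp_neg] at this
      convert this using 2 <;> simp <;> ring
    · intro i hi
      rw [hiter]
      exact hu1 i hi
    · intro i hi
      rw [hiter, neg_one_mul, abs_neg]
      exact hu2 i hi

lemma exists_fwdDiff_iter_eq (r : ℕ) : ∀ (G : ℕ → ℝ → ℝ)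
    (_ : ∀ i t, 0 < t → HasDerivAt (G i) (G (i + 1) t) t) (a : ℝ) (_ : 0 < a),
    ∃ ζ ∈ Set.Icc a (a + r), (fwdDiff (1 : ℝ))^[r] (G 0) a = G r ζ := by
  induction r with
  | zero => intro G _ a _; exact ⟨a, by simp, rfl⟩
  | succ r ih =>
    intro G hG a ha
    obtain ⟨ζ, hζ, h⟩ := ih (fun i => fwdDiff (1 : ℝ) (G i)) (fun i t ht => by
      have h1 : HasDerivAt (fun s => G i (s + 1)) (G (i + 1) (t + 1)) t := by
        simpa using (hG i (t + 1) (by linarith)).comp_add_const t 1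
      exact h1.sub (hG i t ht)) a ha
    have hζ0 : 0 < ζ := ha.trans_le hζ.1
    obtain ⟨ζ', hζ', h'⟩ := exists_hasDerivAt_eq_slope (G r) (G (r + 1))
      (show ζ < ζ + 1 by linarith)
      (fun t ht => (hG r t (hζ0.trans_le ht.1)).continuousAt.continuousWithinAt)
      (fun t ht => hG r t (hζ0.trans ht.1))
    refine ⟨ζ', ⟨hζ.1.trans hζ'.1.le, ?_⟩, ?_⟩
    · have := hζ'.2; have := hζ.2; push_cast; linarith
    · rw [Function.iterate_succ_apply, h, h']
      simp [fwdDiff]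

lemma fwdDiff_iter_nat (f : ℝ → ℝ) (A r : ℕ) : ∀ i : ℕ,
    (fwdDiff 1)^[r] (fun i : ℕ => f ((A + i : ℕ) : ℝ)) i =
      (fwdDiff (1 : ℝ))^[r] f ((A + i : ℕ) : ℝ) := by
  induction r with
  | zero => intro i; rfl
  | succ r ih =>
    intro i
    rw [Function.iterate_succ_apply', Function.iterate_succ_apply']
    simp only [fwdDiff]
    rw [ih, ih]
    push_cast
    ring_nf

/-- The falling factorial `c (c - 1) ⋯ (c - r + 1)`. -/
noncomputable def fallingFact (c : ℝ) (r : ℕ) : ℝ := ∏ i ∈ Finset.range r, (c - i)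

lemma fallingFact_succ (c : ℝ) (r : ℕ) : fallingFact c (r + 1) = fallingFact c r * (c - r) :=
  Finset.prod_range_succ _ _

lemma fallingFact_ne_zero {c : ℝ} (hc : ∀ m : ℤ, c ≠ m) (r : ℕ) : fallingFact c r ≠ 0 :=
  Finset.prod_ne_zero_iff.2 fun i _ => sub_ne_zero.2 (by exact_mod_cast hc i)

lemma fallingFact_natCast_ne_zero {k r : ℕ} (h : r ≤ k) : fallingFact (k : ℝ) r ≠ 0 :=
  Finset.prod_ne_zero_iff.2 fun i hi => sub_ne_zero.2 (by
    have := Finset.mem_range.1 hi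
    exact_mod_cast (by omega : k ≠ i))

lemma fallingFact_natCast_eq_zero {k r : ℕ} (h : k < r) : fallingFact (k : ℝ) r = 0 :=
  Finset.prod_eq_zero (Finset.mem_range.2 h) (sub_self _)

/-- The values `y n ^ c + θ n ^ k` at the integers `n = A + i`. -/
noncomputable def phase (c : ℝ) (k : ℕ) (y θ : ℝ) (A i : ℕ) : ℝ :=
  y * ((A + i : ℕ) : ℝ) ^ c + θ * ((A + i : ℕ) : ℝ) ^ k

lemma phase_add (c : ℝ) (k : ℕ) (y θ : ℝ) (A B i : ℕ) :
    phase c k y θ (A + B) i = phase c k y θ A (B + i) := by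
  simp only [phase, add_assoc]

lemma exists_fwdDiff_iter_phase_eq (c : ℝ) (k : ℕ) (y θ : ℝ) (A r i : ℕ) (hA : 0 < A) :
    ∃ ζ : ℝ, (A : ℝ) + i ≤ ζ ∧ ζ ≤ A + i + r ∧ (fwdDiff 1)^[r] (phase c k y θ A) i =
      ζ ^ (c - r) * (y * fallingFact c r + θ * fallingFact k r * ζ ^ ((k : ℝ) - c)) := by
  have hd : ∀ (a : ℝ) (i : ℕ) (t : ℝ), 0 < t →
      HasDerivAt (fun t : ℝ => fallingFact a i * t ^ (a - i))
        (fallingFact a (i + 1) * t ^ (a - (i + 1 : ℕ))) t := by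
    intro a i t ht
    have := (Real.hasDerivAt_rpow_const (p := a - i) (Or.inl ht.ne')).const_mul (fallingFact a i)
    have h1 : fallingFact a (i + 1) * t ^ (a - (i + 1 : ℕ)) =
        fallingFact a i * ((a - i) * t ^ (a - i - 1)) := by
      rw [fallingFact_succ, mul_assoc]
      push_cast
      ring_nf
    rw [h1]
    exact this
  obtain ⟨ζ, hζ, h⟩ := exists_fwdDiff_iter_eq r
    (fun i t => y * (fallingFact c i * t ^ (c - i)) + θ * (fallingFact k i * t ^ ((k : ℝ) - i)))
    (fun i t ht => ((hd c i t ht).const_mul y).add ((hd k i t ht).const_mul θ))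
    ((A + i : ℕ) : ℝ) (by positivity)
  have hζ0 : 0 < ζ := lt_of_lt_of_le (by positivity) hζ.1
  refine ⟨ζ, by have := hζ.1; push_cast at this; linarith,
    by have := hζ.2; push_cast at this; linarith, ?_⟩
  have h0 := fwdDiff_iter_nat (fun t : ℝ => y * t ^ c + θ * t ^ k) A r i
  simp only [fallingFact, Finset.range_zero, Finset.prod_empty, Nat.cast_zero, sub_zero, one_mul,
    Real.rpow_natCast] at h
  have h1 : ζ ^ ((k : ℝ) - r) = ζ ^ (c - r) * ζ ^ ((k : ℝ) - c) := by
    rw [← Real.rpow_add hζ0]; ring_nf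
  rw [h1] at h
  calc _ = _ := h0
    _ = _ := h
    _ = _ := by simp only [fallingFact]; ring

lemma rpow_le_two_rpow_abs_mul {X t : ℝ} (a : ℝ) (hX : 0 < X) (h1 : X ≤ t) (h2 : t ≤ 2 * X) :
    t ^ a ≤ 2 ^ |a| * X ^ a ∧ X ^ a ≤ 2 ^ |a| * t ^ a := by
  have ht : 0 < t := hX.trans_le h1
  have hone : (1 : ℝ) ≤ 2 ^ |a| := Real.one_le_rpow (by norm_num) (abs_nonneg a)
  have hX' := Real.rpow_pos_of_pos hX a
  have ht' := Real.rpow_pos_of_pos ht a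
  rcases le_total 0 a with ha | ha
  · constructor
    · rw [abs_of_nonneg ha, ← Real.mul_rpow (by norm_num) hX.le]
      exact Real.rpow_le_rpow ht.le h2 ha
    · calc X ^ a ≤ t ^ a := Real.rpow_le_rpow hX.le h1 ha
        _ ≤ _ := le_mul_of_one_le_left ht'.le hone
  · constructor
    · calc t ^ a ≤ X ^ a := Real.rpow_le_rpow_of_nonpos hX h1 ha
        _ ≤ _ := le_mul_of_one_le_left hX'.le hone
    · rw [abs_of_nonpos ha]
      have := Real.rpow_le_rpow_of_nonpos ht h2 ha
      rw [Real.mul_rpow (by norm_num) hX.le] at this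
      calc X ^ a = 2 ^ (-a) * (2 ^ a * X ^ a) := by
            rw [← mul_assoc, ← Real.rpow_add (by norm_num)]; simp
        _ ≤ _ := by gcongr

lemma unitExp_phase_sub (c : ℝ) (k : ℕ) (y x θ : ℝ) (q : ℕ) (a : ℤ) (h : (x - θ) * q = a)
    (A i d : ℕ) :
    unitExp (phase c k y x A (i + q * d) - phase c k y x A i) =
      unitExp (phase c k y θ A (i + q * d) - phase c k y θ A i) := by
  have hdvd : ((q * d : ℕ) : ℤ) ∣ ((A + (i + q * d) : ℕ) : ℤ) ^ k - ((A + i : ℕ) : ℤ) ^ k := by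
    have h1 := sub_dvd_pow_sub_pow ((A + (i + q * d) : ℕ) : ℤ) ((A + i : ℕ) : ℤ) k
    rwa [show ((A + (i + q * d) : ℕ) : ℤ) - ((A + i : ℕ) : ℤ) = ((q * d : ℕ) : ℤ) by
      push_cast; ring] at h1
  obtain ⟨e, he⟩ := hdvd
  have he' : ((A + (i + q * d) : ℕ) : ℝ) ^ k - ((A + i : ℕ) : ℝ) ^ k = ((q * d : ℕ) : ℝ) * e := by
    exact_mod_cast he
  rw [← unitExp_add_intCast (phase c k y θ A (i + q * d) - phase c k y θ A i) (a * d * e)]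
  congr 1
  simp only [phase]
  push_cast at he' ⊢
  rw [← h]
  linear_combination (x - θ) * he'

lemma abs_fwdDiff_iter_phase_le (c : ℝ) (k r : ℕ) {X Λ y θ : ℝ} {A L i : ℕ} (hX : 1 ≤ X)
    (hA : X ≤ A) (hL : (A : ℝ) + L ≤ 2 * X + 1) (hy : |y| * X ^ c ≤ Λ) (hθ : k < r ∨ |θ| * X ^ k ≤ Λ)
    (hi : i + r < L) :
    |(fwdDiff 1)^[r] (phase c k y θ A) i| ≤
      2 ^ |c - r| * (|fallingFact c r| + |fallingFact k r| * 2 ^ |(k : ℝ) - c|) * Λ *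
        X ^ (-(r : ℝ)) := by
  have hX0 : 0 < X := by linarith
  have hA0 : 0 < A := by
    have : (0 : ℝ) < A := by linarith
    exact_mod_cast this
  obtain ⟨ζ, h1, h2, h3⟩ := exists_fwdDiff_iter_phase_eq c k y θ A r i hA0
  have hir : (i : ℝ) + r + 1 ≤ L := by exact_mod_cast hi
  have hi0 : (0 : ℝ) ≤ i := Nat.cast_nonneg i
  have hXζ : X ≤ ζ := by linarith
  have hζX : ζ ≤ 2 * X := by linarith
  have hζ0 : 0 < ζ := by linarith
  have hb1 := (rpow_le_two_rpow_abs_mul (c - r) hX0 hXζ hζX).1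
  have hb2 := (rpow_le_two_rpow_abs_mul ((k : ℝ) - c) hX0 hXζ hζX).1
  have hXc : 0 < X ^ c := Real.rpow_pos_of_pos hX0 c
  have hXc' : 0 < X ^ (c - r) := Real.rpow_pos_of_pos hX0 _
  have hy' : |y| ≤ Λ * X ^ (-c) := by
    rw [Real.rpow_neg hX0.le, ← div_eq_mul_inv, le_div_iff₀ hXc]
    exact hy
  have hθ' : |fallingFact k r| * 2 ^ |(k : ℝ) - c| * (|θ| * X ^ ((k : ℝ) - c)) ≤
      |fallingFact k r| * 2 ^ |(k : ℝ) - c| * (Λ * X ^ (-c)) := by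
    rcases hθ with hkr | hθ
    · simp [fallingFact_natCast_eq_zero hkr]
    · rw [sub_eq_add_neg, Real.rpow_add hX0, Real.rpow_natCast, ← mul_assoc |θ|]
      gcongr
  have hζc : 0 < ζ ^ ((k : ℝ) - c) := Real.rpow_pos_of_pos hζ0 _
  rw [h3, abs_mul, abs_of_pos (Real.rpow_pos_of_pos hζ0 (c - r))]
  calc ζ ^ (c - r) * |y * fallingFact c r + θ * fallingFact k r * ζ ^ ((k : ℝ) - c)|
      ≤ (2 ^ |c - r| * X ^ (c - r)) *
        (|y| * |fallingFact c r| + |fallingFact k r| * (|θ| * (2 ^ |(k : ℝ) - c| * X ^ ((k : ℝ) - c)))) := by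
        gcongr
        refine (abs_add_le _ _).trans ?_
        rw [abs_mul, abs_mul, abs_mul, abs_of_pos hζc]
        gcongr ?_ + ?_
        · exact le_rfl
        · calc |θ| * |fallingFact k r| * ζ ^ ((k : ℝ) - c) =
              |fallingFact k r| * (|θ| * ζ ^ ((k : ℝ) - c)) := by ring
            _ ≤ _ := by gcongr
    _ = (2 ^ |c - r| * X ^ (c - r)) *
        (|y| * |fallingFact c r| +
          |fallingFact k r| * 2 ^ |(k : ℝ) - c| * (|θ| * X ^ ((k : ℝ) - c))) := by ring
    _ ≤ (2 ^ |c - r| * X ^ (c - r)) *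
        ((Λ * X ^ (-c)) * |fallingFact c r| +
          |fallingFact k r| * 2 ^ |(k : ℝ) - c| * (Λ * X ^ (-c))) := by gcongr
    _ = 2 ^ |c - r| * (|fallingFact c r| + |fallingFact k r| * 2 ^ |(k : ℝ) - c|) * Λ *
        (X ^ (c - r) * X ^ (-c)) := by ring
    _ = _ := by
        rw [← Real.rpow_add hX0]
        ring_nf

/-- The derivative test for `y n ^ c + x n ^ k` when the relevant derivative has constant sign and
is not too small. -/
theorem exists_norm_sum_phase_le_of_sign (c : ℝ) (k j : ℕ) (C1 η ω ε : ℝ) (hC1 : 1 ≤ C1)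
    (hη : 0 < η) (hω : 0 ≤ ω) (hε : 0 < ε)
    (hB' : ((2 : ℝ) ^ (j + 2) - 2) * η + 2 * ω + ε ≤ 1) :
    ∃ C : ℝ, 0 < C ∧ ∀ (σ X Λ y x θ : ℝ) (q : ℕ) (a : ℤ) (A L : ℕ), (σ = 1 ∨ σ = -1) →
      1 ≤ X → 0 < Λ → 1 ≤ q → X ≤ A → (A : ℝ) + L ≤ 2 * X + 1 →
      |y| * X ^ c ≤ Λ → (k < j + 2 ∨ |θ| * X ^ k ≤ Λ) → (x - θ) * q = a →
      (q : ℝ) * Λ ≤ X ^ (((j : ℝ) + 2) - ((2 : ℝ) ^ (j + 2) - 2) * η - ε) →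
      (q : ℝ) ≤ X ^ (1 - (2 : ℝ) ^ (j + 1) * η - ε) →
      X ^ ((j : ℝ) + (2 : ℝ) ^ (j + 1) * η + 2 * ω + ε) ≤ Λ →
      (∀ t : ℝ, A ≤ t → t + 1 ≤ A + L → X ^ (-ω) * Λ * X ^ (-c) ≤ C1 * (σ *
        (y * fallingFact c (j + 2) + θ * fallingFact k (j + 2) * t ^ ((k : ℝ) - c)))) →
      ‖∑ i ∈ Finset.range L, unitExp (phase c k y x A i)‖ ≤ C * X ^ (1 - η) := by
  set E : ℕ → ℝ := fun r =>
    2 ^ |c - r| * (|fallingFact c r| + |fallingFact k r| * 2 ^ |(k : ℝ) - c|) with hE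
  have hE0 : ∀ r, 0 ≤ E r := fun r => by positivity
  set C0 : ℝ := 1 + C1 * 2 ^ |c - ((j + 2 : ℕ) : ℝ)| + E (j + 2) + E (j + 3) with hC0
  have hC1p : 0 < C1 * 2 ^ |c - ((j + 2 : ℕ) : ℝ)| := by positivity
  have hE2 := hE0 (j + 2)
  have hE3 := hE0 (j + 3)
  have hC01 : 1 ≤ C0 := by linarith
  obtain ⟨C, hC, h⟩ := exists_norm_sum_unitExp_le_rpow j C0 η ω ε hC01 hη hω hε hB'
  refine ⟨C, hC, ?_⟩
  intro σ X Λ y x θ q a A L hσ hX hΛ hq hA hL hy hθ hx h1 h2 h3 hsign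
  have hX0 : 0 < X := by linarith
  have hσabs : |σ| = 1 := by rcases hσ with rfl | rfl <;> simp
  refine h σ X Λ q L (phase c k y x A) (phase c k y θ A) hσ hX hΛ hq (by linarith) h1 h2 h3
    (fun i d => unitExp_phase_sub c k y x θ q a hx A i d) ?_ ?_
  · intro i hi
    have hXr : 0 < X ^ (-((j : ℝ) + 2)) := Real.rpow_pos_of_pos hX0 _
    constructor
    · have hA0 : 0 < A := by
        have : (0 : ℝ) < A := by linarith
        exact_mod_cast this
      obtain ⟨ζ, hz1, hz2, hz3⟩ := exists_fwdDiff_iter_phase_eq c k y θ A (j + 2) i hA0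
      have hir : (i : ℝ) + (j + 2 : ℕ) + 1 ≤ L := by exact_mod_cast hi
      have hi0 : (0 : ℝ) ≤ i := Nat.cast_nonneg i
      have hs := hsign ζ (by linarith) (by linarith)
      have hζ0 : 0 < ζ := by linarith
      have hb1 := (rpow_le_two_rpow_abs_mul (c - (j + 2 : ℕ)) hX0
        (by linarith : X ≤ ζ) (by linarith)).2
      rw [hz3]
      set φ := y * fallingFact c (j + 2) + θ * fallingFact k (j + 2) * ζ ^ ((k : ℝ) - c)
      have hζp := Real.rpow_pos_of_pos hζ0 (c - (j + 2 : ℕ))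
      have hφ : 0 ≤ σ * φ := by
        have : 0 < X ^ (-ω) * Λ * X ^ (-c) := by positivity
        have h5 : 0 < C1 * (σ * φ) := this.trans_le hs
        exact (pos_of_mul_pos_right h5 (by linarith)).le
      rw [div_le_iff₀ (by linarith)]
      calc X ^ (-ω) * Λ * X ^ (-((j : ℝ) + 2))
          = (X ^ (-ω) * Λ * X ^ (-c)) * X ^ (c - (j + 2 : ℕ)) := by
            rw [mul_assoc _ (X ^ (-c)), ← Real.rpow_add hX0]
            push_cast
            ring_nf
        _ ≤ (C1 * (σ * φ)) * (2 ^ |c - (j + 2 : ℕ)| * ζ ^ (c - (j + 2 : ℕ))) := by gcongr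
        _ = (σ * (ζ ^ (c - (j + 2 : ℕ)) * φ)) * (C1 * 2 ^ |c - (j + 2 : ℕ)|) := by ring
        _ ≤ _ := by
            have : 0 ≤ σ * (ζ ^ (c - (j + 2 : ℕ)) * φ) := by
              have : σ * (ζ ^ (c - (j + 2 : ℕ)) * φ) = ζ ^ (c - (j + 2 : ℕ)) * (σ * φ) := by ring
              rw [this]; positivity
            gcongr
            linarith
    · have hb := abs_fwdDiff_iter_phase_le c k (j + 2) hX hA hL hy hθ hi
      refine (le_abs_self _).trans ?_
      rw [abs_mul, hσabs, one_mul]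
      refine hb.trans ?_
      push_cast
      gcongr
      have : E (j + 2) ≤ C0 := by linarith
      simpa [hE] using this
  · intro i hi
    have hb := abs_fwdDiff_iter_phase_le c k (j + 3) hX hA hL hy (hθ.imp_left (by omega)) hi
    refine hb.trans ?_
    push_cast
    gcongr
    have : E (j + 3) ≤ C0 := by linarith
    simpa [hE] using this

lemma exists_threshold (f : ℕ → ℝ) (ρ : ℝ) (L : ℕ)
    (hf : ∀ i i', i ≤ i' → i' < L → f i ≤ f i') :
    ∃ l ≤ L, (∀ i < l, f i ≤ ρ) ∧ ∀ i, l ≤ i → i < L → ρ < f i := by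
  induction L with
  | zero => exact ⟨0, le_rfl, by simp, by simp⟩
  | succ L ih =>
    obtain ⟨l, hl, h1, h2⟩ := ih (fun i i' h h' => hf i i' h (by omega))
    by_cases h : f L ≤ ρ
    · exact ⟨L + 1, le_rfl, fun i hi => (hf i L (by omega) (by omega)).trans h,
        fun i h3 h4 => by omega⟩
    · refine ⟨l, by omega, h1, fun i h3 h4 => ?_⟩
      rcases Nat.lt_succ_iff_lt_or_eq.1 h4 with h5 | rfl
      · exact h2 i h3 h5
      · exact not_le.1 h

lemma exists_sign_mul_eq_abs (z : ℝ) : ∃ σ : ℝ, (σ = 1 ∨ σ = -1) ∧ σ * z = |z| := by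
  rcases le_total 0 z with h | h
  · exact ⟨1, Or.inl rfl, by rw [abs_of_nonneg h, one_mul]⟩
  · exact ⟨-1, Or.inr rfl, by rw [abs_of_nonpos h, neg_one_mul]⟩

set_option maxHeartbeats 1600000 in
/-- The derivative test for `y n ^ c + x n ^ k`, allowing the derivative to vanish once. -/
theorem exists_norm_sum_phase_le (c : ℝ) (k j : ℕ) (hc : ∀ m : ℤ, c ≠ m) (η ε : ℝ)
    (hη : 0 < η) (hη1 : η ≤ 1) (hε : 0 < ε)
    (hB' : ((2 : ℝ) ^ (j + 2) - 2) * η + 2 * η + ε ≤ 1) :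
    ∃ C : ℝ, 0 < C ∧ ∀ (X Λ y x θ : ℝ) (q : ℕ) (a : ℤ) (A L : ℕ),
      1 ≤ X → 0 < Λ → 1 ≤ q → X ≤ A → (A : ℝ) + L ≤ 2 * X + 1 →
      |y| * X ^ c ≤ Λ → |θ| * X ^ k ≤ Λ →
      (Λ ≤ |y| * X ^ c ∨ (Λ ≤ |θ| * X ^ k ∧ j + 2 ≤ k)) → (x - θ) * q = a →
      (q : ℝ) * Λ ≤ X ^ (((j : ℝ) + 2) - ((2 : ℝ) ^ (j + 2) - 2) * η - ε) →
      (q : ℝ) ≤ X ^ (1 - (2 : ℝ) ^ (j + 1) * η - ε) →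
      X ^ ((j : ℝ) + (2 : ℝ) ^ (j + 1) * η + 2 * η + ε) ≤ Λ →
      ‖∑ i ∈ Finset.range L, unitExp (phase c k y x A i)‖ ≤ C * X ^ (1 - η) := by
  have hcr := fallingFact_ne_zero hc (j + 2)
  set cr := fallingFact c (j + 2) with hcr_def
  set kr := fallingFact (k : ℝ) (j + 2) with hkr_def
  have hkc : (k : ℝ) - c ≠ 0 := by
    have := hc k
    rw [sub_ne_zero]
    exact fun h => this (by exact_mod_cast h.symm)
  have hcr' : 0 < |cr| := abs_pos.2 hcr
  set B : ℝ := 2 * |kr| * 2 ^ |(k : ℝ) - c| / |cr| + 1 with hB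
  have hB1 : 1 ≤ B := by
    rw [hB]
    have : 0 ≤ 2 * |kr| * 2 ^ |(k : ℝ) - c| / |cr| := by positivity
    linarith
  have hC1' : 1 ≤ 1 + 2 / |cr| := by
    have : 0 ≤ 2 / |cr| := by positivity
    linarith
  obtain ⟨C, hC, h⟩ := exists_norm_sum_phase_le_of_sign c k j (1 + 2 / |cr|) η η ε hC1' hη hη.le
    hε hB'
  set T : ℝ := 2 * B * 2 ^ |(k : ℝ) - c - 1| / (|kr| * |(k : ℝ) - c|) with hT
  have hT0 : 0 ≤ T := by positivity
  refine ⟨2 * C + 1 + T, by positivity, ?_⟩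
  intro X Λ y x θ q a A L hX hΛ hq hA hL hy hθ hor hx h1 h2 h3
  have hX0 : 0 < X := by linarith
  have hXc : 0 < X ^ c := Real.rpow_pos_of_pos hX0 c
  have hXη : 0 < X ^ (1 - η) := Real.rpow_pos_of_pos hX0 _
  have hXη1 : 1 ≤ X ^ (1 - η) := Real.one_le_rpow hX (by linarith)
  have hXmη1 : X ^ (-η) ≤ 1 := Real.rpow_le_one_of_one_le_of_nonpos hX (by linarith)
  by_cases hcase : kr ≠ 0 ∧ |y| * X ^ c ≤ B * (|θ| * X ^ k)
  · obtain ⟨hkr, hyB⟩ := hcase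
    have hΛB : Λ ≤ B * (|θ| * X ^ k) := by
      rcases hor with h | ⟨h, -⟩
      · exact h.trans hyB
      · have : 0 ≤ |θ| * X ^ k := by positivity
        nlinarith
    have hθ0 : 0 < |θ| := by
      rcases (abs_nonneg θ).eq_or_lt with h | h
      · rw [← h] at hΛB; simp at hΛB; linarith
      · exact h
    have hkr' : 0 < |kr| := abs_pos.2 hkr
    have hkc' : 0 < |(k : ℝ) - c| := abs_pos.2 hkc
    obtain ⟨τ, hτ, hτz⟩ := exists_sign_mul_eq_abs (θ * kr * ((k : ℝ) - c))
    rw [abs_mul, abs_mul] at hτz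
    set g : ℝ → ℝ := fun t => τ * (y * cr + θ * kr * t ^ ((k : ℝ) - c)) with hg
    set m : ℝ := |θ| * |kr| * |(k : ℝ) - c| * (X ^ ((k : ℝ) - c - 1) / 2 ^ |(k : ℝ) - c - 1|)
      with hm
    have hXkc : 0 < X ^ ((k : ℝ) - c - 1) := Real.rpow_pos_of_pos hX0 _
    have hm0 : 0 < m := by positivity
    have hmvt : ∀ s t, X ≤ s → s ≤ t → t ≤ 2 * X → m * (t - s) ≤ g t - g s := by
      intro s t hs hst ht
      have hs0 : 0 < s := by linarith
      rcases hst.eq_or_lt with rfl | hst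
      · simp
      have hd : ∀ v, 0 < v →
          HasDerivAt g (τ * (θ * kr * (((k : ℝ) - c) * v ^ ((k : ℝ) - c - 1)))) v := by
        intro v hv
        exact (((Real.hasDerivAt_rpow_const (Or.inl hv.ne')).const_mul (θ * kr)).const_add
          (y * cr)).const_mul τ
      obtain ⟨ζ, hζ, hs⟩ := exists_hasDerivAt_eq_slope g _ hst
        (fun v hv => (hd v (hs0.trans_le hv.1)).continuousAt.continuousWithinAt)
        (fun v hv => hd v (hs0.trans hv.1))
      rw [eq_div_iff (by linarith)] at hs
      rw [← hs]
      have hb := (rpow_le_two_rpow_abs_mul ((k : ℝ) - c - 1) hX0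
        (by linarith [hζ.1] : X ≤ ζ) (by linarith [hζ.2])).2
      have e : τ * (θ * kr * (((k : ℝ) - c) * ζ ^ ((k : ℝ) - c - 1))) =
          |θ| * |kr| * |(k : ℝ) - c| * ζ ^ ((k : ℝ) - c - 1) := by
        rw [← hτz]; ring
      rw [e, hm]
      have : 0 ≤ t - s := by linarith
      gcongr
      rw [div_le_iff₀ (by positivity)]
      linarith
    have hmono : ∀ s t, X ≤ s → s ≤ t → t ≤ 2 * X → g s ≤ g t := by
      intro s t hs hst ht
      have h5 := hmvt s t hs hst ht
      have : 0 ≤ m * (t - s) := mul_nonneg hm0.le (by linarith)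
      linarith
    have hmonoN : ∀ i i' : ℕ, i ≤ i' → i' < L → g (A + i) ≤ g (A + i') := by
      intro i i' hi hi'
      have e1 : (i : ℝ) ≤ i' := by exact_mod_cast hi
      have e2 : (i' : ℝ) + 1 ≤ L := by exact_mod_cast hi'
      have e3 : (0 : ℝ) ≤ i := Nat.cast_nonneg i
      exact hmono _ _ (by linarith) (by linarith) (by linarith)
    set ρ : ℝ := X ^ (-η) * Λ * X ^ (-c) with hρ
    have hρ0 : 0 < ρ := by positivity
    obtain ⟨l1, hl1, hl1a, hl1b⟩ := exists_threshold (fun i => g (A + i)) (-ρ) L hmonoN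
    obtain ⟨l2, hl2, hl2a, hl2b⟩ := exists_threshold (fun i => g (A + i)) ρ L hmonoN
    have hl12 : l1 ≤ l2 := by
      by_contra! hlt
      have e1 := hl1a l2 hlt
      have e2 := hl2b l2 le_rfl (by omega)
      linarith
    have hl1L : (l1 : ℝ) ≤ L := by exact_mod_cast hl1
    have hl2L : (l2 : ℝ) ≤ L := by exact_mod_cast hl2
    have hC1ρ : ∀ v, ρ ≤ v → ρ ≤ (1 + 2 / |cr|) * v := by
      intro v hv
      calc ρ ≤ 1 * v := by linarith
        _ ≤ _ := by
          have : 0 ≤ v := by linarith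
          gcongr
    have hS1 := h (-τ) X Λ y x θ q a A l1 (by rcases hτ with rfl | rfl <;> simp) hX hΛ hq hA
      (by linarith) hy (Or.inr hθ) hx h1 h2 h3 (by
        intro t ht1 ht2
        have hl : 1 ≤ l1 := by
          have : (1 : ℝ) ≤ l1 := by linarith
          exact_mod_cast this
        have e1 := hl1a (l1 - 1) (by omega)
        simp only [Nat.cast_sub hl, Nat.cast_one] at e1
        have e2 := hmono t (A + ((l1 : ℝ) - 1)) (by linarith) (by linarith) (by linarith)
        apply hC1ρ
        have e3 : -τ * (y * cr + θ * kr * t ^ ((k : ℝ) - c)) = -g t := by rw [hg]; ring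
        rw [e3]
        linarith)
    have hS3 := h τ X Λ y x θ q a (A + l2) (L - l2) hτ hX hΛ hq (by push_cast; linarith [Nat.cast_nonneg (α := ℝ) l2])
      (by rw [Nat.cast_sub hl2]; push_cast; linarith) hy (Or.inr hθ) hx h1 h2 h3 (by
        intro t ht1 ht2
        rw [Nat.cast_sub hl2] at ht2
        push_cast at ht1 ht2
        have hl : l2 < L := by
          have : (l2 : ℝ) + 1 ≤ L := by linarith
          exact_mod_cast this
        have e1 := hl2b l2 le_rfl hl
        have e2 := hmono (A + (l2 : ℝ)) t (by linarith [Nat.cast_nonneg (α := ℝ) l2]) (by linarith) (by linarith)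
        apply hC1ρ
        have e3 : τ * (y * cr + θ * kr * t ^ ((k : ℝ) - c)) = g t := by rw [hg]
        rw [e3]
        linarith)
    have hmid : ((l2 - l1 : ℕ) : ℝ) ≤ 1 + T * X ^ (1 - η) := by
      rcases hl12.eq_or_lt with rfl | hlt
      · simp
        have : 0 ≤ T * X ^ (1 - η) := by positivity
        linarith
      have e1 := hl1b l1 le_rfl (by omega)
      have e2 := hl2a (l2 - 1) (by omega)
      have hl : 1 ≤ l2 := by omega
      simp only [Nat.cast_sub hl, Nat.cast_one] at e1 e2
      have e5 : (l1 : ℝ) + 1 ≤ l2 := by exact_mod_cast hlt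
      have e3 := hmvt (A + l1) (A + ((l2 : ℝ) - 1)) (by linarith [Nat.cast_nonneg (α := ℝ) l1])
        (by linarith) (by linarith)
      have e4 : m * ((l2 : ℝ) - 1 - l1) ≤ 2 * ρ := by
        have : A + ((l2 : ℝ) - 1) - (A + l1) = (l2 : ℝ) - 1 - l1 := by ring
        rw [this] at e3
        linarith
      have e6 : 2 * ρ ≤ (T * X ^ (1 - η)) * m := by
        calc 2 * ρ = 2 * (X ^ (-η) * Λ * X ^ (-c)) := rfl
          _ ≤ 2 * (X ^ (-η) * (B * (|θ| * X ^ k)) * X ^ (-c)) := by gcongr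
          _ = 2 * B * |θ| * (X ^ (-η) * X ^ (k : ℝ) * X ^ (-c)) := by
              rw [Real.rpow_natCast]; ring
          _ = 2 * B * |θ| * (X ^ (1 - η) * X ^ ((k : ℝ) - c - 1)) := by
              congr 1
              simp only [← Real.rpow_add hX0]
              ring_nf
          _ = _ := by
              rw [hT, hm]
              field_simp
      rw [Nat.cast_sub hl12]
      have e7 := e4.trans e6
      rw [mul_comm m] at e7
      have := le_of_mul_le_mul_right e7 hm0
      linarith
    have hsplit : ∑ i ∈ Finset.range L, unitExp (phase c k y x A i) =
        ∑ i ∈ Finset.range l1, unitExp (phase c k y x A i) +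
        ∑ i ∈ Finset.range (l2 - l1), unitExp (phase c k y x A (l1 + i)) +
        ∑ i ∈ Finset.range (L - l2), unitExp (phase c k y x (A + l2) i) := by
      simp only [phase_add]
      rw [← Finset.sum_range_add, Nat.add_sub_cancel' hl12, ← Finset.sum_range_add,
        Nat.add_sub_cancel' hl2]
    rw [hsplit]
    refine (norm_add₃_le).trans ?_
    have hS2 : ‖∑ i ∈ Finset.range (l2 - l1), unitExp (phase c k y x A (l1 + i))‖ ≤
        ((l2 - l1 : ℕ) : ℝ) := by
      refine (norm_sum_le _ _).trans ?_
      simp [norm_unitExp]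
    calc _ ≤ C * X ^ (1 - η) + (1 + T * X ^ (1 - η)) + C * X ^ (1 - η) := by
          gcongr
          exact hS2.trans hmid
      _ ≤ C * X ^ (1 - η) + (1 * X ^ (1 - η) + T * X ^ (1 - η)) + C * X ^ (1 - η) := by
          gcongr
          linarith
      _ = _ := by ring
  · have hΛs : Λ ≤ |y| * X ^ c := by
      rcases hor with h | ⟨h, hk⟩
      · exact h
      · have hkr : kr ≠ 0 := fallingFact_natCast_ne_zero hk
        have : B * (|θ| * X ^ k) < |y| * X ^ c := by
          by_contra! h'
          exact hcase ⟨hkr, h'⟩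
        have h5 : 0 ≤ |θ| * X ^ k := by positivity
        nlinarith
    obtain ⟨σ, hσ, hσz⟩ := exists_sign_mul_eq_abs (y * cr)
    have hσabs : |σ| = 1 := by rcases hσ with rfl | rfl <;> simp
    have key := h σ X Λ y x θ q a A L hσ hX hΛ hq hA hL hy (Or.inr hθ) hx h1 h2 h3 (by
      intro t ht1 ht2
      have ht0 : 0 < t := by linarith
      have hb := (rpow_le_two_rpow_abs_mul ((k : ℝ) - c) hX0 (by linarith : X ≤ t)
        (by linarith)).1
      have htp := Real.rpow_pos_of_pos ht0 ((k : ℝ) - c)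
      have hsmall : |θ * kr * t ^ ((k : ℝ) - c)| ≤ |y * cr| / 2 := by
        rw [abs_mul, abs_mul, abs_mul, abs_of_pos htp]
        by_cases hkr : kr = 0
        · rw [hkr, abs_zero, mul_zero, zero_mul]
          positivity
        · have hlt : B * (|θ| * X ^ k) < |y| * X ^ c := by
            by_contra! h'
            exact hcase ⟨hkr, h'⟩
          have hXk : X ^ k = X ^ ((k : ℝ) - c) * X ^ c := by
            rw [← Real.rpow_add hX0, sub_add_cancel, Real.rpow_natCast]
          have h5 : B * |θ| * X ^ ((k : ℝ) - c) ≤ |y| := by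
            rw [hXk] at hlt
            have : B * |θ| * X ^ ((k : ℝ) - c) * X ^ c ≤ |y| * X ^ c := by linarith
            exact le_of_mul_le_mul_right this hXc
          have h6 : |kr| * 2 ^ |(k : ℝ) - c| ≤ B * |cr| / 2 := by
            have : B * |cr| = 2 * |kr| * 2 ^ |(k : ℝ) - c| + |cr| := by
              rw [hB]; field_simp
            rw [this]
            linarith
          calc |θ| * |kr| * t ^ ((k : ℝ) - c)
              ≤ |θ| * |kr| * (2 ^ |(k : ℝ) - c| * X ^ ((k : ℝ) - c)) := by gcongr
            _ = |θ| * (|kr| * 2 ^ |(k : ℝ) - c|) * X ^ ((k : ℝ) - c) := by ring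
            _ ≤ |θ| * (B * |cr| / 2) * X ^ ((k : ℝ) - c) := by gcongr
            _ = (B * |θ| * X ^ ((k : ℝ) - c)) * |cr| / 2 := by ring
            _ ≤ _ := by gcongr
      have hlow : |y * cr| / 2 ≤ σ * (y * cr + θ * kr * t ^ ((k : ℝ) - c)) := by
        rw [mul_add, hσz]
        have : |σ * (θ * kr * t ^ ((k : ℝ) - c))| ≤ |y * cr| / 2 := by
          rwa [abs_mul, hσabs, one_mul]
        have := (abs_le.1 this).1
        linarith
      calc X ^ (-η) * Λ * X ^ (-c) ≤ 1 * (|y| * X ^ c) * X ^ (-c) := by gcongr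
        _ = |y| := by
            rw [one_mul, mul_assoc, ← Real.rpow_add hX0]; simp
        _ = (2 / |cr|) * (|y * cr| / 2) := by
            rw [abs_mul]; field_simp
        _ ≤ (1 + 2 / |cr|) * (σ * (y * cr + θ * kr * t ^ ((k : ℝ) - c))) := by
            gcongr
            linarith)
    refine key.trans ?_
    gcongr
    linarith

/-- The derivative test for `y n ^ c + x n ^ k` with more than `k` derivatives. -/
theorem exists_norm_sum_phase_le_of_lt (c : ℝ) (k j : ℕ) (hc : ∀ m : ℤ, c ≠ m) (hk : k < j + 2)
    (η ε : ℝ) (hη : 0 < η) (hε : 0 < ε) (hB' : ((2 : ℝ) ^ (j + 2) - 2) * η + ε ≤ 1) :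
    ∃ C : ℝ, 0 < C ∧ ∀ (X y x : ℝ) (A L : ℕ),
      1 ≤ X → 0 < |y| → X ≤ A → (A : ℝ) + L ≤ 2 * X + 1 →
      |y| * X ^ c ≤ X ^ (((j : ℝ) + 2) - ((2 : ℝ) ^ (j + 2) - 2) * η - ε) →
      1 ≤ X ^ (1 - (2 : ℝ) ^ (j + 1) * η - ε) →
      X ^ ((j : ℝ) + (2 : ℝ) ^ (j + 1) * η + ε) ≤ |y| * X ^ c →
      ‖∑ i ∈ Finset.range L, unitExp (phase c k y x A i)‖ ≤ C * X ^ (1 - η) := by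
  have hcr' : 0 < |fallingFact c (j + 2)| := abs_pos.2 (fallingFact_ne_zero hc (j + 2))
  obtain ⟨C, hC, h⟩ := exists_norm_sum_phase_le_of_sign c k j (1 + 1 / |fallingFact c (j + 2)|)
    η 0 ε (by have : 0 ≤ 1 / |fallingFact c (j + 2)| := by positivity
              linarith) hη le_rfl hε (by linarith)
  refine ⟨C, hC, ?_⟩
  intro X y x A L hX hy hA hL h1 h2 h3
  have hX0 : 0 < X := by linarith
  have hXc : 0 < X ^ c := Real.rpow_pos_of_pos hX0 c
  obtain ⟨σ, hσ, hσz⟩ := exists_sign_mul_eq_abs (y * fallingFact c (j + 2))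
  refine h σ X (|y| * X ^ c) y x x 1 0 A L hσ hX (by positivity) le_rfl hA hL le_rfl
    (Or.inl hk) (by simp)
    (by simpa using h1) (by simpa using h2) (by simpa using h3) ?_
  intro t _ _
  rw [fallingFact_natCast_eq_zero hk, mul_zero, zero_mul, add_zero, hσz, abs_mul, neg_zero,
    Real.rpow_zero, one_mul, mul_assoc, ← Real.rpow_add hX0, add_neg_cancel, Real.rpow_zero,
    mul_one, add_mul, one_mul]
  have : 1 / |fallingFact c (j + 2)| * (|y| * |fallingFact c (j + 2)|) = |y| := by field_simp
  rw [this]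
  have : 0 ≤ |y| * |fallingFact c (j + 2)| := by positivity
  linarith

/-- Bound for the exponential sums with phase `y n ^ c + x n ^ k` over dyadic intervals, uniform in
`x` and in `y` of moderate size. -/
theorem exists_norm_sum_phase_le_uniform (c : ℝ) (hc1 : 1 < c) (hc : ∀ m : ℤ, c ≠ m) (k d : ℕ)
    (hd : 2 ≤ d) (hcd : c < d) (hkd : k ≤ d) (hck : c < k → k = d) (η κ : ℝ)
    (hη : 0 < η) (hκ : (2 : ℝ) ^ (d - 1) * η = κ) (h64 : 6 * κ - 4 * η < 1)
    (h52 : 5 * κ - 2 * η < 1) :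
    ∃ ε C : ℝ, 0 < ε ∧ 0 < C ∧ ∀ (X x y : ℝ) (A L : ℕ), 1 ≤ X → |x| ≤ 1 / 2 → |y| ≤ X ^ ε →
      (1 / 2 ≤ |y| ∨
        (y = x ∧ (X ^ (1 / 2 : ℝ) ≤ |x| * X ^ c ∨ X ^ (1 / 2 : ℝ) ≤ |x| * X ^ k))) →
      X ≤ A → (A : ℝ) + L ≤ 2 * X + 1 →
      ‖∑ i ∈ Finset.range L, unitExp (phase c k y x A i)‖ ≤ C * X ^ (1 - η) := by
  obtain ⟨ε, hε, hε1, hε2, hε3, hε4⟩ : ∃ ε : ℝ, 0 < ε ∧ 6 * κ - 4 * η + 20 * ε ≤ 1 ∧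
      5 * κ - 2 * η + 20 * ε ≤ 1 ∧ 20 * ε ≤ d - c ∧ 20 * ε ≤ 1 := by
    obtain ⟨ε, hε, h⟩ := exists_between (show (0 : ℝ) <
      min (min ((1 - (6 * κ - 4 * η)) / 20) ((1 - (5 * κ - 2 * η)) / 20))
        (min ((d - c) / 20) (1 / 20)) by
      refine lt_min (lt_min ?_ ?_) (lt_min ?_ ?_) <;> linarith)
    simp only [lt_min_iff] at h
    exact ⟨ε, hε, by linarith, by linarith, by linarith, by linarith⟩
  have hpowle : ∀ j, j + 2 ≤ d → (2 : ℝ) ^ (j + 1) * η ≤ κ := by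
    intro j hj
    rw [← hκ]
    gcongr
    · norm_num
    · omega
  have hpow2 : ∀ j, (2 : ℝ) ^ (j + 2) = 2 * 2 ^ (j + 1) := fun j => by
    rw [pow_succ _ (j + 1)]; ring
  have hκη : 2 * η ≤ κ := by
    have := hpowle 0 (by omega)
    norm_num at this
    linarith
  have hk1 : ∀ j, j + 2 ≤ d → ∃ C : ℝ, 0 < C ∧ ∀ (X Λ y x θ : ℝ) (q : ℕ) (a : ℤ) (A L : ℕ),
      1 ≤ X → 0 < Λ → 1 ≤ q → X ≤ A → (A : ℝ) + L ≤ 2 * X + 1 →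
      |y| * X ^ c ≤ Λ → |θ| * X ^ k ≤ Λ →
      (Λ ≤ |y| * X ^ c ∨ (Λ ≤ |θ| * X ^ k ∧ j + 2 ≤ k)) → (x - θ) * q = a →
      (q : ℝ) * Λ ≤ X ^ (((j : ℝ) + 2) - (2 * κ - 2 * η) - ε) →
      (q : ℝ) ≤ X ^ (1 - κ - ε) →
      X ^ ((j : ℝ) + (2 : ℝ) ^ (j + 1) * η + 2 * η + ε) ≤ Λ →
      ‖∑ i ∈ Finset.range L, unitExp (phase c k y x A i)‖ ≤ C * X ^ (1 - η) := by
    intro j hj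
    have hp := hpowle j hj
    obtain ⟨C, hC, h⟩ := exists_norm_sum_phase_le c k j hc η ε hη (by linarith) hε
      (by rw [hpow2]; linarith)
    refine ⟨C, hC, ?_⟩
    intro X Λ y x θ q a A L hX hΛ hq hA hL hy hθ hor hx h1 h2 h3
    refine h X Λ y x θ q a A L hX hΛ hq hA hL hy hθ hor hx (h1.trans ?_) (h2.trans ?_) h3
    · refine Real.rpow_le_rpow_of_exponent_le hX ?_
      rw [hpow2]
      linarith
    · exact Real.rpow_le_rpow_of_exponent_le hX (by linarith)
  have hk2 : ∀ j, ∃ C : ℝ, 0 < C ∧ (j + 2 ≤ d → ∀ (X Λ y x θ : ℝ) (q : ℕ) (a : ℤ) (A L : ℕ),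
      1 ≤ X → 0 < Λ → 1 ≤ q → X ≤ A → (A : ℝ) + L ≤ 2 * X + 1 →
      |y| * X ^ c ≤ Λ → |θ| * X ^ k ≤ Λ →
      (Λ ≤ |y| * X ^ c ∨ (Λ ≤ |θ| * X ^ k ∧ j + 2 ≤ k)) → (x - θ) * q = a →
      (q : ℝ) * Λ ≤ X ^ (((j : ℝ) + 2) - (2 * κ - 2 * η) - ε) →
      (q : ℝ) ≤ X ^ (1 - κ - ε) →
      X ^ ((j : ℝ) + (2 : ℝ) ^ (j + 1) * η + 2 * η + ε) ≤ Λ →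
      ‖∑ i ∈ Finset.range L, unitExp (phase c k y x A i)‖ ≤ C * X ^ (1 - η)) := by
    intro j
    by_cases hj : j + 2 ≤ d
    · obtain ⟨C, hC, h⟩ := hk1 j hj
      exact ⟨C, hC, fun _ => h⟩
    · exact ⟨1, one_pos, fun h => absurd h hj⟩
  choose Cj hCj hmain using hk2
  clear hk1
  have hd1 : d - 1 + 1 = d := by omega
  have h4κ : (2 : ℝ) ^ (d - 1 + 1) * η = 2 * κ := by rw [pow_succ, ← hκ]; ring
  obtain ⟨C', hC', hlast⟩ := exists_norm_sum_phase_le_of_lt c k (d - 1) hc (by omega) η ε hη hε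
    (by rw [hpow2, sub_mul, mul_assoc, h4κ]; linarith)
  have hsumpos : 0 < ∑ j ∈ Finset.range d, Cj j :=
    Finset.sum_pos (fun j _ => hCj j) ⟨0, Finset.mem_range.2 (by omega)⟩
  have hCle : ∀ j, j + 2 ≤ d → Cj j ≤ ∑ j ∈ Finset.range d, Cj j := fun j hj =>
    Finset.single_le_sum (f := Cj) (fun j _ => (hCj j).le) (Finset.mem_range.2 (by omega))
  refine ⟨ε, 2 * (2 : ℝ) ^ (η / ε) + C' + ∑ j ∈ Finset.range d, Cj j, hε, by positivity, ?_⟩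
  intro X x y A L hX hx hy hlow hA hL
  have hX0 : 0 < X := by linarith
  have hXη : 0 < X ^ (1 - η) := Real.rpow_pos_of_pos hX0 _
  rcases lt_or_ge (X ^ ε) 2 with hsmall | hbig
  · have h1 : X ^ η ≤ 2 ^ (η / ε) := by
      have := Real.rpow_le_rpow (by positivity) hsmall.le (by positivity : 0 ≤ η / ε)
      rwa [← Real.rpow_mul hX0.le, mul_div_cancel₀ _ hε.ne'] at this
    calc ‖∑ i ∈ Finset.range L, unitExp (phase c k y x A i)‖
        ≤ ∑ i ∈ Finset.range L, ‖unitExp (phase c k y x A i)‖ := norm_sum_le _ _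
      _ = L := by simp [norm_unitExp]
      _ ≤ 2 * X := by linarith
      _ = 2 * X ^ η * X ^ (1 - η) := by
          rw [mul_assoc, ← Real.rpow_add hX0]; norm_num
      _ ≤ 2 * 2 ^ (η / ε) * X ^ (1 - η) := by gcongr
      _ ≤ _ := by
          gcongr
          linarith
  · set τ : ℝ := 2 * κ - 2 * η + 3 * ε with hτ
    set γ : ℝ := 4 * κ - 4 * η + 4 * ε with hγ
    have hXτ : 1 ≤ X ^ τ := Real.one_le_rpow hX (by linarith)
    set Q : ℕ := ⌊X ^ τ⌋₊ with hQ
    have hQ1 : 1 ≤ Q := (Nat.one_le_floor_iff _).2 hXτ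
    have hQle : (Q : ℝ) ≤ X ^ τ := Nat.floor_le (by linarith)
    have hQlt : X ^ τ < Q + 1 := Nat.lt_floor_add_one _
    obtain ⟨q, hq0, hqQ, hqx⟩ := Real.exists_nat_abs_mul_sub_round_le x (n := Q) hQ1
    have hqr : (1 : ℝ) ≤ q := by exact_mod_cast hq0
    have hqr0 : (0 : ℝ) < q := by linarith
    have hqτ : (q : ℝ) ≤ X ^ τ := le_trans (by exact_mod_cast hqQ) hQle
    set a : ℤ := round ((q : ℝ) * x) with ha
    set θ : ℝ := x - a / q with hθ
    have hqθ : |(q : ℝ) * x - a| = q * |θ| := by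
      rw [hθ, ← abs_of_pos hqr0, ← abs_mul, abs_of_pos hqr0]
      congr 1
      field_simp
    rw [hqθ] at hqx
    have hQr : (1 : ℝ) ≤ Q := by exact_mod_cast hQ1
    have hqθ2 : q * |θ| ≤ 1 / 2 := hqx.trans (by gcongr; linarith)
    have hqθτ : q * |θ| ≤ X ^ (-τ) := by
      rw [Real.rpow_neg hX0.le, ← one_div]
      exact hqx.trans (by gcongr)
    have hxθ : (x - θ) * q = a := by rw [hθ]; field_simp; ring
    have ha0 : a ≠ 0 → 1 / 2 ≤ q * |x| := by
      intro ha
      have h1 : (1 : ℝ) ≤ |(a : ℝ)| := by exact_mod_cast Int.one_le_abs ha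
      have h2 : |(a : ℝ)| ≤ |(q : ℝ) * x| + |(q : ℝ) * x - a| := by
        have := abs_sub_abs_le_abs_sub (a : ℝ) ((q : ℝ) * x)
        rw [abs_sub_comm] at this
        linarith
      rw [hqθ, abs_mul, abs_of_pos hqr0] at h2
      linarith
    have hθx : a = 0 → θ = x := fun h => by rw [hθ, h]; simp
    have hθy : |θ| ≤ |y| := by
      rcases hlow with h | ⟨rfl, -⟩
      · have : |θ| ≤ q * |θ| := le_mul_of_one_le_left (abs_nonneg _) hqr
        linarith
      · by_cases ha : a = 0
        · rw [hθx ha]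
        · have := ha0 ha
          have : q * |θ| ≤ q * |y| := by linarith
          exact le_of_mul_le_mul_left this hqr0
    set s : ℝ := |y| * X ^ c with hs
    set t : ℝ := |θ| * X ^ k with ht
    set Λ : ℝ := max s t with hΛ
    have hXc1 : X ^ (1 : ℝ) ≤ X ^ c := Real.rpow_le_rpow_of_exponent_le hX hc1.le
    have hhalf : 1 / 2 ≤ q * |y| → X ^ (1 / 2 : ℝ) ≤ s := by
      intro h
      have h1 : X ^ (1 / 2 : ℝ) * X ^ ε * X ^ τ ≤ X ^ c := by
        rw [← Real.rpow_add hX0, ← Real.rpow_add hX0]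
        exact (Real.rpow_le_rpow_of_exponent_le hX (by rw [hτ]; linarith)).trans hXc1
      have h2 : 0 < X ^ (1 / 2 : ℝ) := Real.rpow_pos_of_pos hX0 _
      have h3 : 1 / 2 * X ^ c ≤ q * s := by
        rw [hs, ← mul_assoc]
        gcongr
      have h4 : q * X ^ (1 / 2 : ℝ) ≤ q * s := by
        calc q * X ^ (1 / 2 : ℝ) ≤ X ^ τ * X ^ (1 / 2 : ℝ) := by gcongr
          _ = 1 / 2 * (X ^ (1 / 2 : ℝ) * 2 * X ^ τ) := by ring
          _ ≤ 1 / 2 * (X ^ (1 / 2 : ℝ) * X ^ ε * X ^ τ) := by gcongr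
          _ ≤ 1 / 2 * X ^ c := by gcongr
          _ ≤ _ := h3
      exact le_of_mul_le_mul_left h4 hqr0
    have hΛhalf : X ^ (1 / 2 : ℝ) ≤ Λ := by
      rcases hlow with h | ⟨rfl, h⟩
      · refine (hhalf ?_).trans (le_max_left _ _)
        have : |y| ≤ q * |y| := le_mul_of_one_le_left (abs_nonneg _) hqr
        linarith
      · by_cases ha : a = 0
        · rcases h with h | h
          · exact h.trans (le_max_left _ _)
          · refine le_trans ?_ (le_max_right _ _)
            rw [ht, hθx ha]
            exact h
        · exact (hhalf (ha0 ha)).trans (le_max_left _ _)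
    have hΛ0 : 0 < Λ := lt_of_lt_of_le (Real.rpow_pos_of_pos hX0 _) hΛhalf
    have hor : Λ ≤ s ∨ (Λ ≤ t ∧ k = d ∧ s < t) := by
      rcases le_or_gt t s with h | h
      · exact Or.inl (max_le le_rfl h)
      · refine Or.inr ⟨max_le h.le le_rfl, hck ?_, h⟩
        by_contra! hkc
        have : X ^ k ≤ X ^ c := by
          rw [← Real.rpow_natCast]
          exact Real.rpow_le_rpow_of_exponent_le hX hkc
        have : t ≤ s := by
          rw [hs, ht]
          gcongr
        linarith
    have hA' : (q : ℝ) ≤ X ^ (1 - κ - ε) :=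
      hqτ.trans (Real.rpow_le_rpow_of_exponent_le hX (by rw [hτ]; linarith))
    have hfin : ∀ j, j + 2 ≤ d → ‖∑ i ∈ Finset.range L, unitExp (phase c k y x A i)‖ ≤
        Cj j * X ^ (1 - η) → ‖∑ i ∈ Finset.range L, unitExp (phase c k y x A i)‖ ≤
        (2 * (2 : ℝ) ^ (η / ε) + C' + ∑ j ∈ Finset.range d, Cj j) * X ^ (1 - η) := by
      intro j hj h
      refine h.trans ?_
      gcongr
      have := hCle j hj
      have : 0 < (2 : ℝ) ^ (η / ε) := Real.rpow_pos_of_pos (by norm_num) _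
      linarith
    rcases le_or_gt Λ (X ^ ((d : ℝ) - γ)) with hI | hII
    · have hex : ∃ j : ℕ, j + 2 ≤ d ∧ Λ ≤ X ^ ((j : ℝ) + 2 - γ) := by
        refine ⟨d - 2, by omega, ?_⟩
        rw [Nat.cast_sub hd]
        push_cast
        rwa [sub_add_cancel]
      classical
      set j := Nat.find hex with hj
      obtain ⟨hjd, hjΛ⟩ := Nat.find_spec hex
      rw [← hj] at hjd hjΛ
      refine hfin j hjd (hmain j hjd X Λ y x θ q a A L hX hΛ0 hq0 hA hL (le_max_left _ _)
        (le_max_right _ _) ?_ hxθ ?_ hA' ?_)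
      · exact hor.imp_right fun h => ⟨h.1, by omega⟩
      · calc q * Λ ≤ X ^ τ * X ^ ((j : ℝ) + 2 - γ) := by gcongr
          _ = X ^ ((j : ℝ) + 2 - (2 * κ - 2 * η) - ε) := by
              rw [← Real.rpow_add hX0, hτ, hγ]
              ring_nf
      · have hp := hpowle j hjd
        rcases Nat.eq_zero_or_pos j with h0 | hpos
        · refine le_trans (Real.rpow_le_rpow_of_exponent_le hX ?_) hΛhalf
          rw [h0] at hp ⊢
          push_cast
          linarith
        · have hmin := Nat.find_min hex (m := j - 1) (by omega)
          rw [not_and, not_le] at hmin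
          have := hmin (by omega)
          refine le_trans (Real.rpow_le_rpow_of_exponent_le hX ?_) this.le
          rw [Nat.cast_sub hpos, hγ]
          push_cast
          linarith
    · rcases hor with hts | ⟨hts, hkd', hst⟩
      · have hΛs : Λ = s := le_antisymm hts (le_max_left _ _)
        rw [hΛs] at hII hΛ0
        have hy0 : 0 < |y| := by
          have : 0 < X ^ c := by positivity
          exact pos_of_mul_pos_left hΛ0 this.le
        refine (hlast X y x A L hX hy0 hA hL ?_ ?_ ?_).trans ?_
        · calc |y| * X ^ c ≤ X ^ ε * X ^ c := by gcongr
            _ = X ^ (ε + c) := (Real.rpow_add hX0 _ _).symm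
            _ ≤ _ := by
              refine Real.rpow_le_rpow_of_exponent_le hX ?_
              rw [hpow2, sub_mul, mul_assoc, h4κ, Nat.cast_sub (by omega)]
              push_cast
              linarith
        · refine Real.one_le_rpow hX ?_
          rw [h4κ]
          linarith
        · refine le_trans (Real.rpow_le_rpow_of_exponent_le hX ?_) hII.le
          rw [h4κ, Nat.cast_sub (by omega), hγ]
          push_cast
          linarith
        · gcongr
          have : 0 < (2 : ℝ) ^ (η / ε) := Real.rpow_pos_of_pos (by norm_num) _
          linarith
      · have hjd : d - 2 + 2 ≤ d := by omega
        have hdcast : ((d - 2 : ℕ) : ℝ) = d - 2 := by rw [Nat.cast_sub hd]; norm_num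
        refine hfin (d - 2) hjd (hmain (d - 2) hjd X Λ y x θ q a A L hX hΛ0 hq0 hA hL
          (le_max_left _ _) (le_max_right _ _) (Or.inr ⟨hts, by omega⟩) hxθ ?_ hA' ?_)
        · have hΛt : Λ = t := le_antisymm hts (le_max_right _ _)
          rw [hΛt, ht, hkd', ← mul_assoc, hdcast, ← Real.rpow_natCast]
          calc q * |θ| * X ^ (d : ℝ) ≤ X ^ (-τ) * X ^ (d : ℝ) := by gcongr
            _ ≤ _ := by
              rw [← Real.rpow_add hX0]
              refine Real.rpow_le_rpow_of_exponent_le hX ?_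
              rw [hτ]
              linarith
        · have hp := hpowle (d - 2) hjd
          refine le_trans (Real.rpow_le_rpow_of_exponent_le hX ?_) hII.le
          rw [hdcast, hγ]
          linarith

lemma hasDerivAt_unitExp_neg_mul (z u : ℝ) :
    HasDerivAt (fun u : ℝ ↦ unitExp (-(z * u)))
      (unitExp (-(z * u)) * (Complex.I * ((2 * Real.pi * -z : ℝ) : ℂ))) u := by
  have h : HasDerivAt (fun u : ℝ ↦ 2 * Real.pi * (-(z * u))) (2 * Real.pi * -z) u := by
    have h1 := ((hasDerivAt_id u).const_mul (2 * Real.pi * -z))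
    rw [mul_one] at h1
    refine h1.congr_of_eventuallyEq (Filter.Eventually.of_forall fun w ↦ ?_)
    simp only [id]
    ring
  exact (h.ofReal_comp.const_mul Complex.I).cexp

lemma continuous_unitExp : Continuous unitExp := by
  unfold unitExp
  fun_prop

open Polynomial in
lemma norm_integral_polynomial_mul_unitExp_le (s : ℕ) :
    ∀ p : ℝ[X], (X * (1 - X)) ^ s ∣ p → ∃ C : ℝ, 0 ≤ C ∧ ∀ z : ℝ, z ≠ 0 →
      ‖∫ u in (0 : ℝ)..1, ((p.eval u : ℝ) : ℂ) * unitExp (-(z * u))‖ ≤ C / |z| ^ s := by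
  induction s with
  | zero =>
    intro p _
    obtain ⟨C, hC⟩ := (isCompact_Icc (a := (0 : ℝ)) (b := 1)).exists_bound_of_continuousOn
      (f := fun u ↦ p.eval u) p.continuous.continuousOn
    refine ⟨C, (norm_nonneg _).trans (hC 0 (by simp)), fun z _ ↦ ?_⟩
    have h := intervalIntegral.norm_integral_le_of_norm_le_const (a := (0 : ℝ)) (b := 1) (C := C)
      (f := fun u ↦ ((p.eval u : ℝ) : ℂ) * unitExp (-(z * u))) (fun u hu ↦ ?_)
    · simpa using h
    · rw [Set.uIoc_of_le zero_le_one] at hu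
      rw [norm_mul, norm_unitExp, mul_one, Complex.norm_real]
      exact hC u ⟨hu.1.le, hu.2⟩
  | succ s ih =>
    intro p hp
    have hd : (X * (1 - X)) ^ s ∣ derivative p := by
      have h := pow_sub_dvd_iterate_derivative_of_pow_dvd 1 hp
      simpa using h
    obtain ⟨C, hC0, hC⟩ := ih _ hd
    refine ⟨C, hC0, fun z hz ↦ ?_⟩
    obtain ⟨q, rfl⟩ := hp
    set p := (X * (1 - X)) ^ (s + 1) * q with hp
    have hp0 : p.eval 0 = 0 := by simp [hp]
    have hp1 : p.eval 1 = 0 := by simp [hp]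
    set w : ℂ := Complex.I * ((2 * Real.pi * -z : ℝ) : ℂ) with hw
    have hwn : ‖w‖ = 2 * Real.pi * |z| := by
      rw [hw, norm_mul, Complex.norm_I, one_mul, Complex.norm_real, Real.norm_eq_abs, abs_mul,
        abs_neg, abs_of_pos (by positivity : 0 < 2 * Real.pi)]
    have hz' : 0 < |z| := abs_pos.2 hz
    have hw0 : w ≠ 0 := by
      rw [← norm_pos_iff, hwn]
      positivity
    have hparts := intervalIntegral.integral_mul_deriv_eq_deriv_mul (a := (0 : ℝ)) (b := 1)
      (u := fun u : ℝ ↦ ((p.eval u : ℝ) : ℂ)) (v := fun u : ℝ ↦ unitExp (-(z * u)))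
      (u' := fun u : ℝ ↦ ((p.derivative.eval u : ℝ) : ℂ))
      (v' := fun u : ℝ ↦ unitExp (-(z * u)) * w)
      (fun u _ ↦ (p.hasDerivAt u).ofReal_comp)
      (fun u _ ↦ hasDerivAt_unitExp_neg_mul z u)
      ((Complex.continuous_ofReal.comp p.derivative.continuous).intervalIntegrable _ _)
      (((continuous_unitExp.comp (by fun_prop)).mul continuous_const).intervalIntegrable _ _)
    simp only [hp0, hp1, Complex.ofReal_zero, zero_mul, sub_zero, zero_sub] at hparts
    simp only [← mul_assoc] at hparts
    rw [intervalIntegral.integral_mul_const] at hparts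
    have hn := congrArg norm hparts
    rw [norm_mul, norm_neg, hwn] at hn
    have hb := hC z hz
    rw [← hn, le_div_iff₀ (by positivity)] at hb
    rw [le_div_iff₀ (by positivity), pow_succ]
    refine le_trans ?_ hb
    have h3 := Real.pi_gt_three
    set I := ‖∫ u in (0 : ℝ)..1, ((p.eval u : ℝ) : ℂ) * unitExp (-(z * u))‖ with hI
    have hI0 : 0 ≤ I := norm_nonneg _
    have h4 : 0 ≤ I * (|z| ^ s * |z|) := by positivity
    nlinarith

/-- The Fourier transform of `u ↦ (u (1 - u)) ^ s` restricted to the unit interval. -/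
noncomputable def bumpTransform (s : ℕ) (z : ℝ) : ℂ :=
  ∫ u in (0 : ℝ)..1, (((u * (1 - u)) ^ s : ℝ) : ℂ) * unitExp (-(z * u))

lemma bump_mem_Icc (s : ℕ) {u : ℝ} (h0 : 0 ≤ u) (h1 : u ≤ 1) :
    0 ≤ (u * (1 - u)) ^ s ∧ (u * (1 - u)) ^ s ≤ 1 := by
  have h2 : 0 ≤ u * (1 - u) := mul_nonneg h0 (by linarith)
  exact ⟨pow_nonneg h2 _, pow_le_one₀ h2 (by nlinarith)⟩

lemma continuous_bump_mul (s : ℕ) (z : ℝ) :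
    Continuous fun u : ℝ ↦ (((u * (1 - u)) ^ s : ℝ) : ℂ) * unitExp (-(z * u)) :=
  (by fun_prop : Continuous fun u : ℝ ↦ (((u * (1 - u)) ^ s : ℝ) : ℂ)).mul
    (continuous_unitExp.comp (by fun_prop))

lemma norm_bumpTransform_le_one (s : ℕ) (z : ℝ) : ‖bumpTransform s z‖ ≤ 1 := by
  have h := intervalIntegral.norm_integral_le_of_norm_le_const (a := (0 : ℝ)) (b := 1) (C := 1)
    (f := fun u : ℝ ↦ (((u * (1 - u)) ^ s : ℝ) : ℂ) * unitExp (-(z * u))) (fun u hu ↦ ?_)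
  · simpa [bumpTransform] using h
  · rw [Set.uIoc_of_le zero_le_one] at hu
    obtain ⟨h0, h1⟩ := bump_mem_Icc s hu.1.le hu.2
    rw [norm_mul, norm_unitExp, mul_one, Complex.norm_real, Real.norm_eq_abs, abs_of_nonneg h0]
    exact h1

lemma norm_bumpTransform_sub_le (s : ℕ) (z : ℝ) :
    ‖bumpTransform s z - bumpTransform s 0‖ ≤ 2 * Real.pi * |z| := by
  rw [bumpTransform, bumpTransform, ← intervalIntegral.integral_sub
    ((continuous_bump_mul s z).intervalIntegrable _ _)
    ((continuous_bump_mul s 0).intervalIntegrable _ _)]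
  refine (intervalIntegral.norm_integral_le_of_norm_le_const (C := 2 * Real.pi * |z|)
    (fun u hu ↦ ?_)).trans_eq (by simp)
  rw [Set.uIoc_of_le zero_le_one] at hu
  obtain ⟨h0, h1⟩ := bump_mem_Icc s hu.1.le hu.2
  rw [← mul_sub, norm_mul, Complex.norm_real, Real.norm_eq_abs, abs_of_nonneg h0]
  have h2 := norm_unitExp_sub_le (-(z * u)) (-(0 * u))
  have h3 : |-(z * u) - -(0 * u)| ≤ |z| := by
    rw [zero_mul, neg_zero, sub_zero, abs_neg, abs_mul, abs_of_pos hu.1]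
    exact mul_le_of_le_one_right (abs_nonneg _) hu.2
  have h4 := Real.pi_pos
  calc _ ≤ 1 * ‖unitExp (-(z * u)) - unitExp (-(0 * u))‖ := by gcongr
    _ ≤ 2 * Real.pi * |-(z * u) - -(0 * u)| := by rw [one_mul]; exact h2
    _ ≤ _ := by gcongr

lemma exists_bumpTransform_zero (s : ℕ) : ∃ β : ℝ, 0 < β ∧ bumpTransform s 0 = (β : ℂ) := by
  refine ⟨∫ u in (0 : ℝ)..1, (u * (1 - u)) ^ s, ?_, ?_⟩
  · refine intervalIntegral.intervalIntegral_pos_of_pos_on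
      ((by fun_prop : Continuous fun u : ℝ ↦ (u * (1 - u)) ^ s).intervalIntegrable _ _)
      (fun u hu ↦ pow_pos (mul_pos hu.1 (by linarith [hu.2])) _) zero_lt_one
  · rw [bumpTransform, ← intervalIntegral.integral_ofReal]
    refine intervalIntegral.integral_congr fun u _ ↦ ?_
    simp [unitExp_zero]

lemma abs_intCast_le_two_mul_abs_add {x : ℝ} (hx : |x| ≤ 1 / 2) {m : ℤ} (hm : m ≠ 0) :
    |(m : ℝ)| ≤ 2 * |x + m| := by
  have h1 : (1 : ℝ) ≤ |(m : ℝ)| := by exact_mod_cast Int.one_le_abs hm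
  have h2 : |(m : ℝ)| ≤ |x + m| + |x| := by
    have := abs_sub (x + m) x
    simpa using this
  linarith

open Polynomial in
lemma exists_norm_bumpTransform_le (s : ℕ) :
    ∃ C : ℝ, 0 ≤ C ∧ ∀ x : ℝ, |x| ≤ 1 / 2 → ∀ m : ℤ, m ≠ 0 →
      ‖bumpTransform s (x + m)‖ ≤ C / |(m : ℝ)| ^ s := by
  obtain ⟨C, hC0, hC⟩ := norm_integral_polynomial_mul_unitExp_le s _ (dvd_refl _)
  refine ⟨C * 2 ^ s, by positivity, fun x hx m hm ↦ ?_⟩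
  have h1 := abs_intCast_le_two_mul_abs_add hx hm
  have hm' : 0 < |(m : ℝ)| := abs_pos.2 (by exact_mod_cast hm)
  have hz : x + m ≠ 0 := by
    intro h
    rw [h] at h1
    simp at h1
    exact hm h1
  have h := hC _ hz
  simp only [eval_pow, eval_mul, eval_X, eval_sub, eval_one] at h
  refine h.trans ?_
  rw [div_le_div_iff₀ (by positivity) (by positivity), mul_assoc, ← mul_pow]
  gcongr

lemma summable_norm_bumpTransform {s : ℕ} (hs : 2 ≤ s) {x : ℝ} (hx : |x| ≤ 1 / 2) :
    Summable fun m : ℤ ↦ ‖bumpTransform s (x + m)‖ := by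
  obtain ⟨C, hC0, hC⟩ := exists_norm_bumpTransform_le s
  have h1 : Summable fun m : ℤ ↦ C * |1 / (m : ℝ) ^ s| :=
    ((Real.summable_one_div_int_pow.2 (by omega)).abs).mul_left C
  refine Summable.of_norm_bounded_eventually h1 ?_
  rw [Filter.eventually_cofinite]
  refine (Set.finite_singleton (0 : ℤ)).subset fun m hm ↦ ?_
  by_contra h
  refine hm ?_
  rw [norm_norm]
  refine (hC x hx m h).trans_eq ?_
  rw [abs_div, abs_one, abs_pow]
  ring

lemma hasSum_bumpTransform {s : ℕ} (hs : 2 ≤ s) {x : ℝ} (hx : |x| ≤ 1 / 2) (v : ℝ) :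
    HasSum (fun m : ℤ ↦ bumpTransform s (x + m) * unitExp ((x + m) * v))
      ((((Int.fract v * (1 - Int.fract v)) ^ s : ℝ) : ℂ) * unitExp (x * ⌊v⌋)) := by
  have : Fact ((0 : ℝ) < 1) := ⟨one_pos⟩
  set g : ℝ → ℂ := fun u : ℝ ↦ (((u * (1 - u)) ^ s : ℝ) : ℂ) * unitExp (-(x * u)) with hg
  have hgc : Continuous g := continuous_bump_mul s x
  let f : C(AddCircle (1 : ℝ), ℂ) := ⟨AddCircle.liftIco 1 0 g,
    AddCircle.liftIco_continuous (by simp [hg, show s ≠ 0 by omega]) (hgc.continuousOn)⟩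
  have hcoef : ∀ m : ℤ, fourierCoeff f m = bumpTransform s (x + m) := by
    intro m
    change fourierCoeff (AddCircle.liftIco 1 0 g) m = _
    rw [fourierCoeff_liftIco_eq, fourierCoeffOn_eq_integral, bumpTransform]
    simp only [zero_add, sub_zero, div_one, one_smul]
    refine intervalIntegral.integral_congr fun u _ ↦ ?_
    simp only [hg, smul_eq_mul]
    have : unitExp (-((x + m) * u)) = unitExp (-(m * u)) * unitExp (-(x * u)) := by
      rw [← unitExp_add]
      ring_nf
    rw [this]
    have h2 : fourier (-m) ((u : ℝ) : AddCircle ((0 : ℝ) + 1 - 0)) = unitExp (-(m * u)) := by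
      rw [fourier_coe_apply, unitExp]
      congr 1
      push_cast
      ring
    rw [h2]
    ring
  have hsum : Summable (fourierCoeff f) := by
    refine Summable.of_norm ?_
    simp only [hcoef]
    exact summable_norm_bumpTransform hs hx
  have h := has_pointwise_sum_fourier_series_of_summable hsum ((Int.fract v : ℝ) : AddCircle (1 : ℝ))
  have hval : f ((Int.fract v : ℝ) : AddCircle (1 : ℝ)) = g (Int.fract v) :=
    AddCircle.liftIco_zero_coe_apply (f := g) ⟨Int.fract_nonneg v, Int.fract_lt_one v⟩
  rw [hval] at h
  have h2 := h.mul_right (unitExp (x * v))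
  have h3 : g (Int.fract v) * unitExp (x * v) =
      (((Int.fract v * (1 - Int.fract v)) ^ s : ℝ) : ℂ) * unitExp (x * ⌊v⌋) := by
    simp only [hg]
    rw [mul_assoc, ← unitExp_add]
    congr 2
    rw [Int.fract]
    ring
  rw [h3] at h2
  have h4 : ∀ m : ℤ, fourierCoeff f m • fourier m ((Int.fract v : ℝ) : AddCircle (1 : ℝ)) *
      unitExp (x * v) = bumpTransform s (x + m) * unitExp ((x + m) * v) := by
    intro m
    have h5 : fourier m ((Int.fract v : ℝ) : AddCircle (1 : ℝ)) = unitExp (m * v) := by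
      rw [← unitExp_add_intCast (m * v) (-(m * ⌊v⌋)), fourier_coe_apply, unitExp]
      congr 1
      rw [Int.fract]
      push_cast
      ring
    rw [hcoef, h5, smul_eq_mul, mul_assoc, ← unitExp_add]
    congr 2
    ring
  simpa only [h4] using h2

/-- The sequence `n ^ c + n ^ k`. -/
noncomputable def powSum (c : ℝ) (k n : ℕ) : ℝ := (n : ℝ) ^ c + (n : ℝ) ^ k

/-- The discrete derivative of `powSum`. -/
noncomputable def powSumDiff (c : ℝ) (k n : ℕ) : ℝ := powSum c k (n + 1) - powSum c k n

lemma powSum_nonneg (c : ℝ) (k n : ℕ) : 0 ≤ powSum c k n := by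
  unfold powSum
  positivity

lemma powSum_strictMono {c : ℝ} (hc : 1 < c) (k : ℕ) : StrictMono (powSum c k) := by
  intro m n h
  have h' : (m : ℝ) < n := by exact_mod_cast h
  exact add_lt_add_of_lt_of_le (Real.rpow_lt_rpow (by positivity) h' (by linarith))
    (by gcongr)

lemma powSumDiff_pos {c : ℝ} (hc : 1 < c) (k n : ℕ) : 0 < powSumDiff c k n :=
  sub_pos.2 (powSum_strictMono hc k (Nat.lt_succ_self n))

lemma ConvexOn.two_mul_natCast_le {f : ℝ → ℝ} (hf : ConvexOn ℝ (Set.Ici 0) f) (n : ℕ) :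
    2 * f ((n + 1 : ℕ) : ℝ) ≤ f n + f ((n + 2 : ℕ) : ℝ) := by
  have h := hf.2 (Set.mem_Ici.2 (by positivity : (0 : ℝ) ≤ (n : ℝ)))
    (Set.mem_Ici.2 (by positivity : (0 : ℝ) ≤ ((n + 2 : ℕ) : ℝ)))
    (by norm_num : (0 : ℝ) ≤ 1 / 2) (by norm_num : (0 : ℝ) ≤ 1 / 2) (by norm_num)
  have h1 : (1 / 2 : ℝ) • (n : ℝ) + (1 / 2 : ℝ) • ((n + 2 : ℕ) : ℝ) = ((n + 1 : ℕ) : ℝ) := by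
    simp only [smul_eq_mul]
    push_cast
    ring
  rw [h1] at h
  simp only [smul_eq_mul] at h
  linarith

lemma powSumDiff_monotone {c : ℝ} (hc : 1 < c) (k : ℕ) : Monotone (powSumDiff c k) := by
  refine monotone_nat_of_le_succ fun n ↦ ?_
  have h1 := (convexOn_rpow hc.le).two_mul_natCast_le n
  have h2 := (convexOn_pow (𝕜 := ℝ) k).two_mul_natCast_le n
  unfold powSumDiff powSum
  linarith

lemma add_one_rpow_sub_rpow_le {p : ℝ} (hp : 1 ≤ p) (n : ℕ) :
    ((n + 1 : ℕ) : ℝ) ^ p - (n : ℝ) ^ p ≤ p * ((n + 1 : ℕ) : ℝ) ^ (p - 1) := by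
  have hm : (0 : ℝ) < ((n + 1 : ℕ) : ℝ) := by positivity
  have h1 : (1 : ℝ) ≤ ((n + 1 : ℕ) : ℝ) := by exact_mod_cast Nat.succ_le_succ (Nat.zero_le n)
  have h := one_add_mul_self_le_rpow_one_add (s := -(1 / ((n + 1 : ℕ) : ℝ)))
    (by
      have := (div_le_one hm).2 h1
      linarith) hp
  have h2 : (n : ℝ) = ((n + 1 : ℕ) : ℝ) * (1 + -(1 / ((n + 1 : ℕ) : ℝ))) := by
    field_simp
    push_cast
    ring
  have h3 : (n : ℝ) ^ p = ((n + 1 : ℕ) : ℝ) ^ p * (1 + -(1 / ((n + 1 : ℕ) : ℝ))) ^ p := by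
    conv_lhs => rw [h2]
    refine Real.mul_rpow hm.le ?_
    have := (div_le_one hm).2 h1
    linarith
  rw [h3, Real.rpow_sub_one hm.ne']
  have h4 : 0 ≤ ((n + 1 : ℕ) : ℝ) ^ p := by positivity
  have h5 := mul_le_mul_of_nonneg_left h h4
  have h6 : p * (((n + 1 : ℕ) : ℝ) ^ p / ((n + 1 : ℕ) : ℝ)) =
      ((n + 1 : ℕ) : ℝ) ^ p * (p * (1 / ((n + 1 : ℕ) : ℝ))) := by ring
  rw [h6]
  nlinarith

lemma powSumDiff_le {c D : ℝ} {k : ℕ} (hc : 1 < c) (hk : 1 ≤ k) (hcD : c ≤ D) (hkD : k ≤ D)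
    (n : ℕ) : powSumDiff c k n ≤ 2 * D * ((n + 1 : ℕ) : ℝ) ^ (D - 1) := by
  have h1 : (1 : ℝ) ≤ ((n + 1 : ℕ) : ℝ) := by exact_mod_cast Nat.succ_le_succ (Nat.zero_le n)
  have h2 := add_one_rpow_sub_rpow_le hc.le n
  have h3 := add_one_rpow_sub_rpow_le (p := (k : ℝ)) (by exact_mod_cast hk) n
  have h4 : c * ((n + 1 : ℕ) : ℝ) ^ (c - 1) ≤ D * ((n + 1 : ℕ) : ℝ) ^ (D - 1) :=
    mul_le_mul hcD (Real.rpow_le_rpow_of_exponent_le h1 (by linarith)) (by positivity)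
      (by linarith)
  have h5 : k * ((n + 1 : ℕ) : ℝ) ^ ((k : ℝ) - 1) ≤ D * ((n + 1 : ℕ) : ℝ) ^ (D - 1) :=
    mul_le_mul hkD (Real.rpow_le_rpow_of_exponent_le h1 (by linarith)) (by positivity)
      (by linarith)
  rw [Real.rpow_natCast, Real.rpow_natCast] at h3
  unfold powSumDiff powSum
  linarith

lemma powSum_le {c D : ℝ} {k n : ℕ} (hn : 1 ≤ n) (hcD : c ≤ D) (hkD : k ≤ D) :
    powSum c k n ≤ 2 * (n : ℝ) ^ D := by
  have h1 : (1 : ℝ) ≤ n := by exact_mod_cast hn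
  have h2 := Real.rpow_le_rpow_of_exponent_le h1 hcD
  have h3 := Real.rpow_le_rpow_of_exponent_le h1 hkD
  rw [Real.rpow_natCast] at h3
  unfold powSum
  linarith

lemma rpow_max_le_powSum (c : ℝ) (k n : ℕ) : (n : ℝ) ^ max c (k : ℝ) ≤ powSum c k n := by
  have h1 : (0 : ℝ) ≤ (n : ℝ) ^ c := by positivity
  have h2 : (0 : ℝ) ≤ (n : ℝ) ^ k := by positivity
  unfold powSum
  rcases max_choice c (k : ℝ) with h | h
  · rw [h]
    linarith
  · rw [h, Real.rpow_natCast]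
    linarith

/-- The weights `(g (n + 1) - g n) (1 - g n / g (N + 1))`, where `g n = n ^ c + n ^ k`. -/
noncomputable def fejerWeight (c : ℝ) (k N n : ℕ) : ℝ :=
  powSumDiff c k n * (1 - powSum c k n / powSum c k (N + 1))

lemma powSum_pos {c : ℝ} (hc : 1 < c) (k n : ℕ) : 0 < powSum c k (n + 1) :=
  (powSum_nonneg c k n).trans_lt (powSum_strictMono hc k (Nat.lt_succ_self n))

lemma one_sub_powSum_div_mem {c : ℝ} (hc : 1 < c) (k : ℕ) {N n : ℕ} (hn : n ≤ N + 1) :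
    0 ≤ 1 - powSum c k n / powSum c k (N + 1) ∧ 1 - powSum c k n / powSum c k (N + 1) ≤ 1 := by
  have h1 := powSum_pos hc k N
  have h2 := powSum_nonneg c k n
  have h3 := (powSum_strictMono hc k).monotone hn
  constructor
  · rw [sub_nonneg, div_le_one h1]
    exact h3
  · have : 0 ≤ powSum c k n / powSum c k (N + 1) := by positivity
    linarith

lemma fejerWeight_nonneg {c : ℝ} (hc : 1 < c) (k : ℕ) {N n : ℕ} (hn : n ≤ N + 1) :
    0 ≤ fejerWeight c k N n :=
  mul_nonneg (powSumDiff_pos hc k n).le (one_sub_powSum_div_mem hc k hn).1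

lemma fejerWeight_le {c : ℝ} (hc : 1 < c) (k : ℕ) {N n : ℕ} (hn : n ≤ N + 1) :
    fejerWeight c k N n ≤ powSumDiff c k n :=
  mul_le_of_le_one_right (powSumDiff_pos hc k n).le (one_sub_powSum_div_mem hc k hn).2

lemma sum_powSumDiff (c : ℝ) (k A L : ℕ) :
    ∑ i ∈ Finset.range L, powSumDiff c k (A + i) = powSum c k (A + L) - powSum c k A :=
  Finset.sum_range_sub (fun i ↦ powSum c k (A + i)) L

lemma norm_sum_antitone_mul_le (z : ℕ → ℂ) (a : ℕ → ℝ) (B : ℝ) (L : ℕ)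
    (ha : ∀ i, i + 1 < L → a (i + 1) ≤ a i) (ha0 : ∀ i, i < L → 0 ≤ a i)
    (hz : ∀ m ≤ L, ‖∑ i ∈ Finset.range m, z i‖ ≤ B) :
    ∀ m ≤ L, 0 < m → ‖∑ i ∈ Finset.range m, (a i : ℂ) * z i‖ ≤ a 0 * B := by
  have key : ∀ m, m + 1 ≤ L → ‖∑ i ∈ Finset.range (m + 1), (a i : ℂ) * z i -
      (a m : ℂ) * ∑ i ∈ Finset.range (m + 1), z i‖ ≤ (a 0 - a m) * B := by
    intro m
    induction m with
    | zero => intro _; simp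
    | succ m ih =>
      intro hm
      have h1 := ih (by omega)
      have h2 : ∑ i ∈ Finset.range (m + 1 + 1), (a i : ℂ) * z i -
          (a (m + 1) : ℂ) * ∑ i ∈ Finset.range (m + 1 + 1), z i =
          (∑ i ∈ Finset.range (m + 1), (a i : ℂ) * z i -
            (a m : ℂ) * ∑ i ∈ Finset.range (m + 1), z i) +
          ((a m - a (m + 1) : ℝ) : ℂ) * ∑ i ∈ Finset.range (m + 1), z i := by
        rw [Finset.sum_range_succ _ (m + 1), Finset.sum_range_succ z (m + 1)]
        push_cast
        ring
      rw [h2]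
      refine (norm_add_le _ _).trans ?_
      have h3 := ha m (by omega)
      rw [norm_mul, Complex.norm_real, Real.norm_eq_abs, abs_of_nonneg (by linarith)]
      have h4 := mul_le_mul_of_nonneg_left (hz (m + 1) (by omega)) (sub_nonneg.2 h3)
      linarith
  intro m hm h0
  obtain ⟨m, rfl⟩ := Nat.exists_eq_succ_of_ne_zero h0.ne'
  have h1 := key m hm
  have h2 := norm_add_le (∑ i ∈ Finset.range (m + 1), (a i : ℂ) * z i -
      (a m : ℂ) * ∑ i ∈ Finset.range (m + 1), z i) ((a m : ℂ) * ∑ i ∈ Finset.range (m + 1), z i)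
  rw [sub_add_cancel, norm_mul, Complex.norm_real, Real.norm_eq_abs,
    abs_of_nonneg (ha0 m (by omega))] at h2
  have h3 := mul_le_mul_of_nonneg_left (hz (m + 1) hm) (ha0 m (by omega))
  rw [Nat.succ_eq_add_one]
  linarith

lemma norm_sum_monotone_mul_antitone_mul_le (z : ℕ → ℂ) (a w : ℕ → ℝ) (B M : ℝ) (L : ℕ)
    (ha : ∀ i, i + 1 < L → a i ≤ a (i + 1)) (haM : ∀ i, i < L → a i ≤ M)
    (ha0 : 0 ≤ a 0) (hM : 0 ≤ M)
    (hw : ∀ i, i + 1 < L → w (i + 1) ≤ w i) (hw0 : ∀ i, i < L → 0 ≤ w i)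
    (hw1 : ∀ i, i < L → w i ≤ 1)
    (hz : ∀ m ≤ L, ‖∑ i ∈ Finset.range m, z i‖ ≤ B) :
    ‖∑ i ∈ Finset.range L, ((a i * w i : ℝ) : ℂ) * z i‖ ≤ 2 * M * B := by
  have hB : 0 ≤ B := (norm_nonneg _).trans (hz 0 (Nat.zero_le _))
  have h1 : ∀ m ≤ L, ‖∑ i ∈ Finset.range m, ((a i : ℝ) : ℂ) * z i‖ ≤ 2 * M * B := by
    intro m hm
    rcases Nat.eq_zero_or_pos m with rfl | h0
    · simp only [Finset.range_zero, Finset.sum_empty, norm_zero]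
      positivity
    have h2 := norm_sum_antitone_mul_le z (fun i ↦ M - a i) B L
      (fun i hi ↦ by have := ha i hi; linarith)
      (fun i hi ↦ by have := haM i hi; linarith) hz m hm h0
    have h3 : ∑ i ∈ Finset.range m, ((a i : ℝ) : ℂ) * z i = (M : ℂ) * ∑ i ∈ Finset.range m, z i -
        ∑ i ∈ Finset.range m, ((M - a i : ℝ) : ℂ) * z i := by
      rw [Finset.mul_sum, ← Finset.sum_sub_distrib]
      refine Finset.sum_congr rfl fun i _ ↦ ?_
      push_cast
      ring
    rw [h3]
    refine (norm_sub_le _ _).trans ?_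
    rw [norm_mul, Complex.norm_real, Real.norm_eq_abs, abs_of_nonneg hM]
    have h4 := mul_le_mul_of_nonneg_left (hz m hm) hM
    have h5 : 0 ≤ a 0 * B := by positivity
    linarith
  rcases Nat.eq_zero_or_pos L with rfl | h0
  · simp only [Finset.range_zero, Finset.sum_empty, norm_zero]
    positivity
  have h2 := norm_sum_antitone_mul_le (fun i ↦ ((a i : ℝ) : ℂ) * z i) w (2 * M * B) L hw hw0 h1 L
    le_rfl h0
  have h3 : ∑ i ∈ Finset.range L, ((a i * w i : ℝ) : ℂ) * z i =
      ∑ i ∈ Finset.range L, (w i : ℂ) * (((a i : ℝ) : ℂ) * z i) := by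
    refine Finset.sum_congr rfl fun i _ ↦ ?_
    push_cast
    ring
  rw [h3]
  refine h2.trans (mul_le_of_le_one_left (by positivity) (hw1 0 h0))

lemma norm_sum_Ico_le_of_dyadic (F : ℕ → ℂ) (E : ℝ) (N : ℕ)
    (h : ∀ j L : ℕ, 2 ^ j + L ≤ 2 ^ (j + 1) → 2 ^ j + L ≤ N + 1 →
      ‖∑ i ∈ Finset.range L, F (2 ^ j + i)‖ ≤ E) :
    ‖∑ n ∈ Finset.Ico 1 (N + 1), F n‖ ≤ (Nat.log 2 N + 1 : ℕ) * E := by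
  have key : ∀ j : ℕ, ‖∑ n ∈ Finset.Ico 1 (min (2 ^ j) (N + 1)), F n‖ ≤ j * E := by
    intro j
    induction j with
    | zero => simp
    | succ j ih =>
      have h2 : 2 ^ (j + 1) = 2 * 2 ^ j := by ring
      have h3 : 0 < 2 ^ j := by positivity
      rcases le_or_gt (N + 1) (2 ^ j) with hj | hj
      · rw [min_eq_right hj] at ih
        rw [min_eq_right (by omega)]
        refine ih.trans ?_
        have hE : 0 ≤ E := by
          have := h 0 0 (by norm_num) (by norm_num)
          simpa using this
        push_cast
        linarith
      · rw [min_eq_left hj.le] at ih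
        obtain ⟨L, hL⟩ : ∃ L, min (2 ^ (j + 1)) (N + 1) = 2 ^ j + L :=
          ⟨min (2 ^ (j + 1)) (N + 1) - 2 ^ j, by omega⟩
        rw [hL, ← Finset.sum_Ico_consecutive F (show 1 ≤ 2 ^ j by omega) (Nat.le_add_right _ _),
          Finset.sum_Ico_eq_sum_range F (2 ^ j), Nat.add_sub_cancel_left]
        refine (norm_add_le _ _).trans ?_
        have := h j L (by omega) (by omega)
        push_cast
        linarith
  have := key (Nat.log 2 N + 1)
  rwa [min_eq_right (Nat.lt_pow_succ_log_self (by norm_num) N)] at this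

set_option maxHeartbeats 1600000 in
lemma exists_norm_sum_fejerWeight_le (c : ℝ) (hc1 : 1 < c) (hc : ∀ m : ℤ, c ≠ m) (k d : ℕ)
    (hk : 1 ≤ k) (hd : 2 ≤ d) (hcd : c < d) (hkd : k ≤ d) (hck : c < k → k = d) (η κ : ℝ)
    (hη : 0 < η) (hκ : 2 ^ (d - 1) * η = κ) (h64 : 6 * κ - 4 * η < 1) (h52 : 5 * κ - 2 * η < 1)
    (D : ℝ) (hD : D = max c (k : ℝ)) :
    ∃ ε C : ℝ, 0 < ε ∧ 0 < C ∧ ∀ (N : ℕ) (x y : ℝ), 1 ≤ N → |x| ≤ 1 / 2 → |y| ≤ (N : ℝ) ^ ε →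
      (1 / 2 ≤ |y| ∨ (y = x ∧ (N : ℝ) ^ (1 - D - η) ≤ |x|)) →
      ‖∑ n ∈ Finset.Ico 1 (N + 1), (fejerWeight c k N n : ℂ) * unitExp (phase c k y x 0 n)‖ ≤
        (Nat.log 2 N + 1 : ℕ) * (C * (N : ℝ) ^ (D - η)) := by
  obtain ⟨ε, C, hε, hC, hE⟩ := exists_norm_sum_phase_le_uniform c hc1 hc k d hd hcd hkd hck η κ hη
    hκ h64 h52
  have hcD : c ≤ D := hD ▸ le_max_left _ _
  have hkD : (k : ℝ) ≤ D := hD ▸ le_max_right _ _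
  have hη8 : η < 1 / 8 := by
    have h2 : (2 : ℝ) ^ 1 ≤ 2 ^ (d - 1) := pow_le_pow_right₀ (by norm_num) (by omega)
    nlinarith
  have hDpos : 0 < D := by linarith
  refine ⟨ε / 2, 2 * 2 ^ D + 4 * D * 2 ^ (D - 1) * C, by positivity,
    by positivity, fun N x y hN hx hyN hxy ↦ ?_⟩
  have hN1 : (1 : ℝ) ≤ N := by exact_mod_cast hN
  have hN0 : (0 : ℝ) < N := by linarith
  have hD1 : 1 < D := by linarith
  refine norm_sum_Ico_le_of_dyadic _ _ _ fun j L hj hjN ↦ ?_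
  rcases Nat.eq_zero_or_pos L with rfl | hL
  · simp only [Finset.range_zero, Finset.sum_empty, norm_zero]
    positivity
  set X : ℝ := ((2 ^ j : ℕ) : ℝ) with hX
  have hX1 : 1 ≤ X := by
    rw [hX]
    exact_mod_cast Nat.one_le_two_pow
  have hX0 : 0 < X := by linarith
  have hXN : X ≤ N := by
    rw [hX]
    exact_mod_cast (show 2 ^ j ≤ N by omega)
  have hX2 : ((2 ^ (j + 1) : ℕ) : ℝ) = 2 * X := by
    rw [hX]
    push_cast
    ring
  have hph : ∀ i, phase c k y x 0 (2 ^ j + i) = phase c k y x (2 ^ j) i := by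
    intro i
    rw [← phase_add, zero_add]
  simp only [hph]
  have hsplit : (2 * 2 ^ D + 4 * D * 2 ^ (D - 1) * C) * (N : ℝ) ^ (D - η) =
      2 * 2 ^ D * (N : ℝ) ^ (D - η) + 4 * D * 2 ^ (D - 1) * C * (N : ℝ) ^ (D - η) := by ring
  have hp1 : 0 ≤ 2 * 2 ^ D * (N : ℝ) ^ (D - η) := by positivity
  have hp2 : 0 ≤ 4 * D * 2 ^ (D - 1) * C * (N : ℝ) ^ (D - η) := by positivity
  rcases le_or_gt (X ^ D) ((N : ℝ) ^ (D - η)) with hcase | hcase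
  · have h1 : ‖∑ i ∈ Finset.range L, (fejerWeight c k N (2 ^ j + i) : ℂ) *
        unitExp (phase c k y x (2 ^ j) i)‖ ≤ ∑ i ∈ Finset.range L, powSumDiff c k (2 ^ j + i) := by
      refine (norm_sum_le _ _).trans (Finset.sum_le_sum fun i hi ↦ ?_)
      have hi' := Finset.mem_range.1 hi
      rw [norm_mul, norm_unitExp, mul_one, Complex.norm_real, Real.norm_eq_abs,
        abs_of_nonneg (fejerWeight_nonneg hc1 k (by omega))]
      exact fejerWeight_le hc1 k (by omega)
    rw [sum_powSumDiff] at h1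
    have h2 : powSum c k (2 ^ j + L) ≤ powSum c k (2 ^ (j + 1)) :=
      (powSum_strictMono hc1 k).monotone hj
    have h3 : powSum c k (2 ^ (j + 1)) ≤ 2 * (2 * X) ^ D := by
      rw [← hX2]
      exact powSum_le Nat.one_le_two_pow hcD hkD
    rw [Real.mul_rpow (by norm_num) hX0.le] at h3
    have h4 := powSum_nonneg c k (2 ^ j)
    have h5 : (2 : ℝ) ^ D * X ^ D ≤ 2 ^ D * (N : ℝ) ^ (D - η) := by gcongr
    linarith
  · have hXhalf : (N : ℝ) ^ (1 / 2 : ℝ) ≤ X := by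
      have h1 : ((N : ℝ) ^ (1 / 2 : ℝ)) ^ D ≤ X ^ D := by
        refine le_trans ?_ hcase.le
        rw [← Real.rpow_mul hN0.le]
        exact Real.rpow_le_rpow_of_exponent_le hN1 (by linarith)
      exact (Real.rpow_le_rpow_iff (by positivity) hX0.le (by linarith)).1 h1
    have hyX : |y| ≤ X ^ ε := by
      refine hyN.trans ?_
      have h1 := Real.rpow_le_rpow (by positivity) hXhalf hε.le
      rw [← Real.rpow_mul hN0.le] at h1
      rwa [show ε / 2 = 1 / 2 * ε by ring]
    have hcond : 1 / 2 ≤ |y| ∨ (y = x ∧ (X ^ (1 / 2 : ℝ) ≤ |x| * X ^ c ∨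
        X ^ (1 / 2 : ℝ) ≤ |x| * X ^ k)) := by
      refine hxy.imp id fun ⟨h1, h2⟩ ↦ ⟨h1, ?_⟩
      have h3 : X ^ (1 / 2 : ℝ) ≤ |x| * X ^ D := by
        calc X ^ (1 / 2 : ℝ) ≤ (N : ℝ) ^ (1 / 2 : ℝ) := by gcongr
          _ ≤ (N : ℝ) ^ (1 - 2 * η) := Real.rpow_le_rpow_of_exponent_le hN1 (by linarith)
          _ = (N : ℝ) ^ (1 - D - η) * (N : ℝ) ^ (D - η) := by
            rw [← Real.rpow_add hN0]
            ring_nf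
          _ ≤ |x| * X ^ D := by gcongr
      rcases max_choice c (k : ℝ) with h4 | h4
      · left
        rwa [hD, h4] at h3
      · right
        rwa [hD, h4, Real.rpow_natCast] at h3
    have hz : ∀ m ≤ L, ‖∑ i ∈ Finset.range m, unitExp (phase c k y x (2 ^ j) i)‖ ≤
        C * X ^ (1 - η) := by
      intro m hm
      refine hE X x y (2 ^ j) m hX1 hx hyX hcond le_rfl ?_
      have h1 : ((2 ^ j + m : ℕ) : ℝ) ≤ ((2 ^ (j + 1) : ℕ) : ℝ) := by
        exact_mod_cast (show 2 ^ j + m ≤ 2 ^ (j + 1) by omega)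
      rw [hX2, Nat.cast_add] at h1
      linarith
    have hmain := norm_sum_monotone_mul_antitone_mul_le
      (fun i ↦ unitExp (phase c k y x (2 ^ j) i)) (fun i ↦ powSumDiff c k (2 ^ j + i))
      (fun i ↦ 1 - powSum c k (2 ^ j + i) / powSum c k (N + 1)) (C * X ^ (1 - η))
      (2 * D * (2 * X) ^ (D - 1)) L
      (fun i _ ↦ powSumDiff_monotone hc1 k (by omega))
      (fun i hi ↦ by
        refine (powSumDiff_le hc1 hk hcD hkD _).trans ?_
        have h1 : ((2 ^ j + i + 1 : ℕ) : ℝ) ≤ 2 * X := by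
          rw [← hX2]
          exact_mod_cast (show 2 ^ j + i + 1 ≤ 2 ^ (j + 1) by omega)
        have h2 : 0 ≤ D - 1 := by linarith
        gcongr)
      (powSumDiff_pos hc1 k _).le (by positivity)
      (fun i _ ↦ by
        have h1 : powSum c k (2 ^ j + i) ≤ powSum c k (2 ^ j + (i + 1)) :=
          (powSum_strictMono hc1 k).monotone (by omega)
        have h2 := powSum_pos hc1 k N
        gcongr)
      (fun i hi ↦ (one_sub_powSum_div_mem hc1 k (by omega)).1)
      (fun i hi ↦ (one_sub_powSum_div_mem hc1 k (by omega)).2) hz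
    have heq : 2 * (2 * D * (2 * X) ^ (D - 1)) * (C * X ^ (1 - η)) =
        4 * D * 2 ^ (D - 1) * C * X ^ (D - η) := by
      rw [Real.mul_rpow (by norm_num) hX0.le,
        show X ^ (D - η) = X ^ (D - 1) * X ^ (1 - η) by
          rw [← Real.rpow_add hX0]
          ring_nf]
      ring
    rw [heq] at hmain
    have h6 : X ^ (D - η) ≤ (N : ℝ) ^ (D - η) :=
      Real.rpow_le_rpow hX0.le hXN (by linarith)
    have h7 : 4 * D * 2 ^ (D - 1) * C * X ^ (D - η) ≤
        4 * D * 2 ^ (D - 1) * C * (N : ℝ) ^ (D - η) := by gcongr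
    have h8 := hmain.trans h7
    unfold fejerWeight
    linarith

/-- A primitive of `u ↦ (1 - u / Y) cos (θ u)`. -/
noncomputable def fejerPrimitive (Y θ u : ℝ) : ℝ :=
  (1 - u / Y) * Real.sin (θ * u) / θ - Real.cos (θ * u) / (θ ^ 2 * Y)

lemma hasDerivAt_fejerPrimitive {Y θ : ℝ} (hY : 0 < Y) (hθ : θ ≠ 0) (u : ℝ) :
    HasDerivAt (fejerPrimitive Y θ) ((1 - u / Y) * Real.cos (θ * u)) u := by
  have h0 : HasDerivAt (fun u : ℝ ↦ θ * u) θ u := by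
    simpa using (hasDerivAt_id u).const_mul θ
  have h1 := h0.sin
  have h2 := h0.cos
  have h3 : HasDerivAt (fun u : ℝ ↦ 1 - u / Y) (-(1 / Y)) u := by
    simpa using ((hasDerivAt_id u).div_const Y).const_sub 1
  refine (((h3.mul h1).div_const θ).sub (h2.div_const (θ ^ 2 * Y))).congr_deriv ?_
  field_simp
  ring

lemma exists_fejerPrimitive_sub_eq {Y θ a b : ℝ} (hY : 0 < Y) (hθ : θ ≠ 0) (hab : a < b) :
    ∃ ζ ∈ Set.Ioo a b, fejerPrimitive Y θ b - fejerPrimitive Y θ a =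
      (b - a) * ((1 - ζ / Y) * Real.cos (θ * ζ)) := by
  obtain ⟨ζ, hζ, h⟩ := exists_hasDerivAt_eq_slope (fejerPrimitive Y θ)
    (fun u ↦ (1 - u / Y) * Real.cos (θ * u)) hab
    (fun u _ ↦ (hasDerivAt_fejerPrimitive hY hθ u).continuousAt.continuousWithinAt)
    (fun u _ ↦ hasDerivAt_fejerPrimitive hY hθ u)
  refine ⟨ζ, hζ, ?_⟩
  have : b - a ≠ 0 := by linarith
  rw [h]
  field_simp

lemma fejerPrimitive_sub_le {Y θ a b : ℝ} (hY : 0 < Y) (hθ : θ ≠ 0) (ha : 0 ≤ a) (hab : a < b)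
    (hb : b ≤ Y) : fejerPrimitive Y θ b - fejerPrimitive Y θ a ≤
      (b - a) * (1 - a / Y) * Real.cos (θ * a) + (b - a) * ((b - a) * (1 / Y + |θ|)) := by
  obtain ⟨ζ, ⟨h1, h2⟩, h⟩ := exists_fejerPrimitive_sub_eq hY hθ hab
  rw [h, mul_assoc, ← mul_add]
  refine mul_le_mul_of_nonneg_left ?_ (by linarith)
  have h3 : |Real.cos (θ * ζ) - Real.cos (θ * a)| ≤ |θ| * (b - a) := by
    refine (Real.abs_cos_sub_cos_le _ _).trans ?_
    rw [← mul_sub, abs_mul, abs_of_pos (by linarith : 0 < ζ - a)]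
    gcongr
  have hζ0 : 0 ≤ ζ / Y := div_nonneg (by linarith) hY.le
  have hζ1 : ζ / Y ≤ 1 := (div_le_one hY).2 (by linarith)
  have h4 : (1 - ζ / Y) * (Real.cos (θ * ζ) - Real.cos (θ * a)) ≤ |θ| * (b - a) :=
    calc _ ≤ (1 - ζ / Y) * |Real.cos (θ * ζ) - Real.cos (θ * a)| :=
        mul_le_mul_of_nonneg_left (le_abs_self _) (by linarith)
      _ ≤ 1 * |Real.cos (θ * ζ) - Real.cos (θ * a)| :=
        mul_le_mul_of_nonneg_right (by linarith) (abs_nonneg _)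
      _ ≤ _ := by rw [one_mul]; exact h3
  have h5 : -((ζ / Y - a / Y) * Real.cos (θ * a)) ≤ (b - a) * (1 / Y) := by
    have h6 : 0 ≤ ζ / Y - a / Y := by
      rw [← sub_div]
      exact div_nonneg (by linarith) hY.le
    have h7 := Real.neg_one_le_cos (θ * a)
    have h8 : ζ / Y ≤ b / Y := by gcongr
    have h9 : (b - a) * (1 / Y) = b / Y - a / Y := by ring
    nlinarith
  linarith

lemma fejerPrimitive_zero_le {Y θ : ℝ} (hY : 0 < Y) (hθ : θ ≠ 0) :
    fejerPrimitive Y θ 0 ≤ fejerPrimitive Y θ Y := by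
  simp only [fejerPrimitive, div_self hY.ne', sub_self, zero_mul, zero_div, mul_zero, Real.sin_zero,
    Real.cos_zero]
  have : 0 < θ ^ 2 * Y := by positivity
  have h := Real.cos_le_one (θ * Y)
  have := div_le_div_of_nonneg_right h this.le
  linarith

lemma le_sum_fejer_cos (G : ℕ → ℝ) (hG : StrictMono G) (hG1 : 0 < G 1) (N : ℕ) (M θ : ℝ)
    (hM : ∀ n, n ≤ N → G (n + 1) - G n ≤ M) :
    -(G 1 + M * (1 + |θ| * G (N + 1))) ≤ ∑ n ∈ Finset.Ico 1 (N + 1),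
      (G (n + 1) - G n) * (1 - G n / G (N + 1)) * Real.cos (θ * G n) := by
  have hmono := hG.monotone
  have hY : 0 < G (N + 1) := hG1.trans_le (hmono (by omega))
  have hM0 : 0 ≤ M := le_trans (sub_nonneg.2 (hmono (Nat.le_succ N))) (hM N le_rfl)
  rcases eq_or_ne θ 0 with rfl | hθ
  · refine le_trans (b := 0) (by rw [abs_zero, zero_mul]; linarith) ?_
    refine Finset.sum_nonneg fun n hn ↦ ?_
    obtain ⟨h1, h2⟩ := Finset.mem_Ico.1 hn
    rw [zero_mul, Real.cos_zero, mul_one]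
    refine mul_nonneg (sub_nonneg.2 (hmono (Nat.le_succ n))) (sub_nonneg.2 ?_)
    exact (div_le_one hY).2 (hmono (by omega))
  have hpos : ∀ n, 1 ≤ n → 0 < G n := fun n hn ↦ hG1.trans_le (hmono hn)
  have h1 : ∀ n ∈ Finset.Ico 1 (N + 1),
      fejerPrimitive (G (N + 1)) θ (G (n + 1)) - fejerPrimitive (G (N + 1)) θ (G n) ≤
      (G (n + 1) - G n) * (1 - G n / G (N + 1)) * Real.cos (θ * G n) +
        (G (n + 1) - G n) * (M * (1 / G (N + 1) + |θ|)) := by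
    intro n hn
    obtain ⟨h1, h2⟩ := Finset.mem_Ico.1 hn
    refine (fejerPrimitive_sub_le hY hθ (hpos n h1).le (hG (Nat.lt_succ_self n))
      (hmono (by omega))).trans ?_
    have h3 := hM n (by omega)
    have h4 := sub_nonneg.2 (hmono (Nat.le_succ n))
    rw [Nat.succ_eq_add_one] at h4
    gcongr
  have h2 := Finset.sum_le_sum h1
  rw [Finset.sum_add_distrib, ← Finset.sum_mul,
    Finset.sum_Ico_sub (fun n ↦ fejerPrimitive (G (N + 1)) θ (G n)) (by omega),
    Finset.sum_Ico_sub G (by omega)] at h2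
  have h3 : (G (N + 1) - G 1) * (M * (1 / G (N + 1) + |θ|)) ≤ M * (1 + |θ| * G (N + 1)) :=
    calc _ ≤ G (N + 1) * (M * (1 / G (N + 1) + |θ|)) := by
          refine mul_le_mul_of_nonneg_right (by linarith) (by positivity)
      _ = _ := by
          field_simp
  have h4 := fejerPrimitive_zero_le hY hθ
  have h5 : fejerPrimitive (G (N + 1)) θ (G 1) - fejerPrimitive (G (N + 1)) θ 0 ≤ G 1 := by
    obtain ⟨ζ, ⟨hz1, hz2⟩, h⟩ := exists_fejerPrimitive_sub_eq hY hθ hG1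
    rw [h, sub_zero]
    refine mul_le_of_le_one_right hG1.le ?_
    have h6 : 0 ≤ 1 - ζ / G (N + 1) := by
      rw [sub_nonneg, div_le_one hY]
      exact hz2.le.trans (hmono (by omega))
    have h7 : 0 ≤ ζ / G (N + 1) := by positivity
    have h8 := Real.cos_le_one (θ * ζ)
    have h9 := mul_le_mul_of_nonneg_left h8 h6
    linarith
  linarith

lemma le_sum_fejerWeight {c : ℝ} (hc : 1 < c) (k N : ℕ) :
    powSum c k (N + 1) / 2 - powSum c k 1 ≤ ∑ n ∈ Finset.Ico 1 (N + 1), fejerWeight c k N n := by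
  have hY := powSum_pos hc k N
  have h1 : ∀ n ∈ Finset.Ico 1 (N + 1),
      (powSum c k (n + 1) - powSum c k (n + 1) ^ 2 / (2 * powSum c k (N + 1))) -
      (powSum c k n - powSum c k n ^ 2 / (2 * powSum c k (N + 1))) ≤ fejerWeight c k N n := by
    intro n _
    have h2 := powSumDiff_pos hc k n
    have h3 : fejerWeight c k N n - ((powSum c k (n + 1) -
        powSum c k (n + 1) ^ 2 / (2 * powSum c k (N + 1))) -
        (powSum c k n - powSum c k n ^ 2 / (2 * powSum c k (N + 1)))) =
        powSumDiff c k n ^ 2 / (2 * powSum c k (N + 1)) := by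
      unfold fejerWeight powSumDiff
      field_simp
      ring
    have h4 : 0 ≤ powSumDiff c k n ^ 2 / (2 * powSum c k (N + 1)) := by positivity
    linarith
  have h2 := Finset.sum_le_sum h1
  rw [Finset.sum_Ico_sub (fun n ↦ powSum c k n - powSum c k n ^ 2 / (2 * powSum c k (N + 1)))
    (by omega)] at h2
  have h3 : powSum c k (N + 1) ^ 2 / (2 * powSum c k (N + 1)) = powSum c k (N + 1) / 2 := by
    field_simp
  have h4 : 0 ≤ powSum c k 1 ^ 2 / (2 * powSum c k (N + 1)) := by positivity
  simp only [h3] at h2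
  linarith

lemma sum_fejerWeight_le {c : ℝ} (hc : 1 < c) (k N : ℕ) :
    ∑ n ∈ Finset.Ico 1 (N + 1), fejerWeight c k N n ≤ powSum c k (N + 1) := by
  have h1 : ∀ n ∈ Finset.Ico 1 (N + 1), fejerWeight c k N n ≤
      powSum c k (n + 1) - powSum c k n := fun n hn ↦
    fejerWeight_le hc k (Finset.mem_Ico.1 hn).2.le
  refine (Finset.sum_le_sum h1).trans ?_
  rw [Finset.sum_Ico_sub (powSum c k) (by omega)]
  have := powSum_nonneg c k 1
  linarith

/-- The weighted exponential sum with phase `y n ^ c + x n ^ k`. -/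
noncomputable def fejerSum (c : ℝ) (k N : ℕ) (y x : ℝ) : ℂ :=
  ∑ n ∈ Finset.Ico 1 (N + 1), (fejerWeight c k N n : ℂ) * unitExp (phase c k y x 0 n)

/-- The weights `fejerWeight`, damped near the integer values of `n ^ c`. -/
noncomputable def bumpWeight (c : ℝ) (k s N n : ℕ) : ℝ :=
  fejerWeight c k N n * (Int.fract ((n : ℝ) ^ c) * (1 - Int.fract ((n : ℝ) ^ c))) ^ s

/-- The weighted exponential sum over the sequence `⌊n ^ c⌋ + n ^ k`. -/
noncomputable def floorSum (c : ℝ) (k s N : ℕ) (x : ℝ) : ℂ :=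
  ∑ n ∈ Finset.Ico 1 (N + 1), (bumpWeight c k s N n : ℂ) *
    unitExp (x * ((⌊(n : ℝ) ^ c⌋ : ℝ) + (n : ℝ) ^ k))

lemma bumpWeight_nonneg {c : ℝ} (hc : 1 < c) (k s : ℕ) {N n : ℕ} (hn : n ≤ N + 1) :
    0 ≤ bumpWeight c k s N n :=
  mul_nonneg (fejerWeight_nonneg hc k hn)
    (bump_mem_Icc s (Int.fract_nonneg _) (Int.fract_lt_one _).le).1

lemma norm_fejerSum_le {c D : ℝ} (hc : 1 < c) {k N : ℕ} (hN : 1 ≤ N) (hcD : c ≤ D) (hkD : k ≤ D)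
    (y x : ℝ) : ‖fejerSum c k N y x‖ ≤ 2 * 2 ^ D * (N : ℝ) ^ D := by
  have h1 : ‖fejerSum c k N y x‖ ≤ ∑ n ∈ Finset.Ico 1 (N + 1), fejerWeight c k N n := by
    refine (norm_sum_le _ _).trans (Finset.sum_le_sum fun n hn ↦ ?_)
    rw [norm_mul, norm_unitExp, mul_one, Complex.norm_real, Real.norm_eq_abs,
      abs_of_nonneg (fejerWeight_nonneg hc k (Finset.mem_Ico.1 hn).2.le)]
  have h2 : ((N + 1 : ℕ) : ℝ) ^ D ≤ (2 * N) ^ D := by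
    refine Real.rpow_le_rpow (by positivity) ?_ (by linarith)
    exact_mod_cast (show N + 1 ≤ 2 * N by omega)
  rw [Real.mul_rpow (by norm_num) (by positivity)] at h2
  have h3 := powSum_le (n := N + 1) (by omega) hcD hkD
  have h4 := sum_fejerWeight_le hc k N
  linarith

lemma hasSum_floorSum {s : ℕ} (hs : 2 ≤ s) (c : ℝ) (k N : ℕ) {x : ℝ} (hx : |x| ≤ 1 / 2) :
    HasSum (fun m : ℤ ↦ bumpTransform s (x + m) * fejerSum c k N (x + m) x)
      (floorSum c k s N x) := by
  have h : HasSum (fun m : ℤ ↦ ∑ n ∈ Finset.Ico 1 (N + 1), (fejerWeight c k N n : ℂ) *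
      unitExp (x * (n : ℝ) ^ k) * (bumpTransform s (x + m) * unitExp ((x + m) * (n : ℝ) ^ c)))
      (∑ n ∈ Finset.Ico 1 (N + 1), (fejerWeight c k N n : ℂ) * unitExp (x * (n : ℝ) ^ k) *
        ((((Int.fract ((n : ℝ) ^ c) * (1 - Int.fract ((n : ℝ) ^ c))) ^ s : ℝ) : ℂ) *
          unitExp (x * ⌊(n : ℝ) ^ c⌋))) :=
    hasSum_sum fun n _ ↦ (hasSum_bumpTransform hs hx ((n : ℝ) ^ c)).mul_left _
  have h1 : ∀ m : ℤ, ∑ n ∈ Finset.Ico 1 (N + 1), (fejerWeight c k N n : ℂ) *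
      unitExp (x * (n : ℝ) ^ k) * (bumpTransform s (x + m) * unitExp ((x + m) * (n : ℝ) ^ c)) =
      bumpTransform s (x + m) * fejerSum c k N (x + m) x := by
    intro m
    rw [fejerSum, Finset.mul_sum]
    refine Finset.sum_congr rfl fun n _ ↦ ?_
    rw [phase, zero_add, unitExp_add]
    ring
  have h2 : ∑ n ∈ Finset.Ico 1 (N + 1), (fejerWeight c k N n : ℂ) * unitExp (x * (n : ℝ) ^ k) *
      ((((Int.fract ((n : ℝ) ^ c) * (1 - Int.fract ((n : ℝ) ^ c))) ^ s : ℝ) : ℂ) *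
          unitExp (x * ⌊(n : ℝ) ^ c⌋)) = floorSum c k s N x := by
    rw [floorSum]
    refine Finset.sum_congr rfl fun n _ ↦ ?_
    rw [mul_add, unitExp_add, bumpWeight]
    push_cast
    ring
  rw [h2] at h
  simpa only [h1] using h

lemma norm_floorSum_sub_le {s : ℕ} (hs : 2 ≤ s) (c : ℝ) (k N : ℕ) {x : ℝ} (hx : |x| ≤ 1 / 2)
    (A : ℝ) (hA : ∀ m : ℤ, m ≠ 0 →
      ‖bumpTransform s (x + m) * fejerSum c k N (x + m) x‖ ≤ A * (1 / (m : ℝ) ^ 2)) :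
    ‖floorSum c k s N x - bumpTransform s x * fejerSum c k N x x‖ ≤
      A * ∑' m : ℤ, 1 / (m : ℝ) ^ 2 := by
  have h1 := (hasSum_floorSum hs c k N hx).sub
    (hasSum_ite_eq (0 : ℤ) (bumpTransform s x * fejerSum c k N x x))
  refine h1.norm_le_of_bounded
    ((Real.summable_one_div_int_pow.2 (by norm_num : 1 < 2)).hasSum.mul_left A) fun m ↦ ?_
  by_cases hm : m = 0
  · subst hm
    simp
  · rw [if_neg hm, sub_zero]
    exact hA m hm

set_option maxHeartbeats 800000 in
lemma exists_norm_floorSum_sub_le (c : ℝ) (hc1 : 1 < c) (k : ℕ) (η D ε C : ℝ) (hη1 : η < 1)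
    (hcD : c ≤ D) (hkD : k ≤ D) (hε : 0 < ε) (hC : 0 < C)
    (h : ∀ (N : ℕ) (x y : ℝ), 1 ≤ N → |x| ≤ 1 / 2 → |y| ≤ (N : ℝ) ^ ε → 1 / 2 ≤ |y| →
      ‖fejerSum c k N y x‖ ≤ (Nat.log 2 N + 1 : ℕ) * (C * (N : ℝ) ^ (D - η))) :
    ∃ (s : ℕ) (C' : ℝ), 2 ≤ s ∧ 0 ≤ C' ∧ ∀ (N : ℕ) (x : ℝ), 1 ≤ N → |x| ≤ 1 / 2 →
      ‖floorSum c k s N x - bumpTransform s x * fejerSum c k N x x‖ ≤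
        C' * ((Nat.log 2 N + 1 : ℕ) * (N : ℝ) ^ (D - η)) := by
  obtain ⟨t, ht⟩ := exists_nat_gt (1 / ε)
  obtain ⟨B, hB0, hB⟩ := exists_norm_bumpTransform_le (t + 2)
  refine ⟨t + 2, B * (C + 2 ^ t * (2 * 2 ^ D)) * ∑' m : ℤ, 1 / (m : ℝ) ^ 2, by omega,
    mul_nonneg (by positivity) (tsum_nonneg fun m ↦ by positivity), fun N x hN hx ↦ ?_⟩
  have hN1 : (1 : ℝ) ≤ N := by exact_mod_cast hN
  have hN0 : (0 : ℝ) < N := by linarith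
  set E : ℝ := (Nat.log 2 N + 1 : ℕ) * (N : ℝ) ^ (D - η) with hE
  have hNE : (N : ℝ) ^ (D - η) ≤ E :=
    le_mul_of_one_le_left (by positivity) (by exact_mod_cast Nat.succ_le_succ (Nat.zero_le _))
  have hE0 : 0 < E := by positivity
  refine (norm_floorSum_sub_le (by omega) c k N hx (B * (C + 2 ^ t * (2 * 2 ^ D)) * E)
    fun m hm ↦ ?_).trans_eq (by ring)
  have hm1 : (1 : ℝ) ≤ |(m : ℝ)| := by exact_mod_cast Int.one_le_abs hm
  have hm0 : 0 < |(m : ℝ)| := by linarith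
  have hBm := hB x hx m hm
  rw [norm_mul, ← sq_abs (m : ℝ)]
  have hlow := abs_intCast_le_two_mul_abs_add hx hm
  have hsum : C * E + 2 ^ t * (2 * 2 ^ D) * E = (C + 2 ^ t * (2 * 2 ^ D)) * E := by ring
  have hfirst : 0 ≤ C * E := by positivity
  have hsecond : 0 ≤ 2 ^ t * (2 * 2 ^ D) * E := by positivity
  suffices hmain : (1 / |(m : ℝ)| ^ t) * ‖fejerSum c k N (x + m) x‖ ≤
      (C + 2 ^ t * (2 * 2 ^ D)) * E by
    calc _ ≤ B / |(m : ℝ)| ^ (t + 2) * ‖fejerSum c k N (x + m) x‖ := by gcongr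
      _ = B * (1 / |(m : ℝ)| ^ 2) * ((1 / |(m : ℝ)| ^ t) * ‖fejerSum c k N (x + m) x‖) := by
        rw [pow_add]
        field_simp
      _ ≤ B * (1 / |(m : ℝ)| ^ 2) * ((C + 2 ^ t * (2 * 2 ^ D)) * E) := by gcongr
      _ = _ := by ring
  rcases le_or_gt (|(m : ℝ)| + 1) ((N : ℝ) ^ ε) with hcase | hcase
  · have h1 : |x + m| ≤ (N : ℝ) ^ ε := by
      have := abs_add_le x m
      linarith
    have h2 := h N x (x + m) hN hx h1 (by linarith)
    have h3 : 1 / |(m : ℝ)| ^ t ≤ 1 := (div_le_one (by positivity)).2 (one_le_pow₀ hm1)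
    calc _ ≤ 1 * ‖fejerSum c k N (x + m) x‖ := by gcongr
      _ ≤ C * E := by
        rw [one_mul, hE]
        linarith
      _ ≤ _ := by linarith
  · have h1 := norm_fejerSum_le hc1 hN hcD hkD (x + m) x
    have h2 : (N : ℝ) ≤ (2 * |(m : ℝ)|) ^ t := by
      have h3 : (N : ℝ) ≤ ((N : ℝ) ^ ε) ^ t := by
        rw [← Real.rpow_natCast, ← Real.rpow_mul hN0.le]
        conv_lhs => rw [← Real.rpow_one (N : ℝ)]
        refine Real.rpow_le_rpow_of_exponent_le hN1 ?_
        rw [div_lt_iff₀ hε] at ht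
        linarith
      refine h3.trans (pow_le_pow_left₀ (by positivity) (by linarith) _)
    rw [mul_pow] at h2
    have h4 : 1 / |(m : ℝ)| ^ t ≤ 2 ^ t / N := by
      rw [div_le_div_iff₀ (by positivity) hN0]
      linarith
    have h5 : (N : ℝ) ^ D / N ≤ E := by
      rw [← Real.rpow_sub_one hN0.ne']
      exact (Real.rpow_le_rpow_of_exponent_le hN1 (by linarith)).trans hNE
    calc _ ≤ 2 ^ t / N * (2 * 2 ^ D * (N : ℝ) ^ D) := by gcongr
      _ = 2 ^ t * (2 * 2 ^ D) * ((N : ℝ) ^ D / N) := by ring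
      _ ≤ 2 ^ t * (2 * 2 ^ D) * E := by gcongr
      _ ≤ _ := by linarith

lemma fejerSum_self_re (c : ℝ) (k N : ℕ) (x : ℝ) : (fejerSum c k N x x).re =
    ∑ n ∈ Finset.Ico 1 (N + 1), (powSum c k (n + 1) - powSum c k n) *
      (1 - powSum c k n / powSum c k (N + 1)) * Real.cos (2 * Real.pi * x * powSum c k n) := by
  rw [fejerSum, Complex.re_sum]
  refine Finset.sum_congr rfl fun n _ ↦ ?_
  have h : phase c k x x 0 n = x * powSum c k n := by
    rw [phase, zero_add, powSum]
    ring
  rw [Complex.re_ofReal_mul, unitExp_re, fejerWeight, powSumDiff, h, mul_assoc (2 * Real.pi)]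

lemma exists_le_fejerSum_self_re (c : ℝ) (hc1 : 1 < c) (k : ℕ) (hk : 1 ≤ k) (η D : ℝ)
    (hη1 : η < 1) (hcD : c ≤ D) (hkD : k ≤ D) :
    ∃ C : ℝ, 0 ≤ C ∧ ∀ (N : ℕ) (x : ℝ), 1 ≤ N → |x| ≤ (N : ℝ) ^ (1 - D - η) →
      -(C * (N : ℝ) ^ (D - η)) ≤ (fejerSum c k N x x).re := by
  have hpi := Real.pi_pos
  have hD0 : 0 < D := by linarith
  refine ⟨2 + 2 * D * 2 ^ (D - 1) * (1 + 2 * Real.pi * (2 * 2 ^ D)), by positivity,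
    fun N x hN hx ↦ ?_⟩
  have hN1 : (1 : ℝ) ≤ N := by exact_mod_cast hN
  have hN0 : (0 : ℝ) < N := by linarith
  have hsucc : ((N + 1 : ℕ) : ℝ) ≤ 2 * N := by exact_mod_cast (show N + 1 ≤ 2 * N by omega)
  have h1 := le_sum_fejer_cos (powSum c k) (powSum_strictMono hc1 k) (powSum_pos hc1 k 0) N
    (2 * D * (2 * N) ^ (D - 1)) (2 * Real.pi * x) (fun n hn ↦ by
      refine (powSumDiff_le hc1 hk hcD hkD n).trans ?_
      have h2 : ((n + 1 : ℕ) : ℝ) ≤ 2 * N :=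
        le_trans (by exact_mod_cast Nat.succ_le_succ hn) hsucc
      have h3 : 0 ≤ D - 1 := by linarith
      gcongr)
  rw [← fejerSum_self_re] at h1
  refine le_trans (neg_le_neg ?_) h1
  have hY : powSum c k (N + 1) ≤ 2 * 2 ^ D * (N : ℝ) ^ D := by
    refine (powSum_le (by omega) hcD hkD).trans ?_
    rw [mul_assoc, ← Real.mul_rpow (by norm_num) hN0.le]
    gcongr
  have hone : powSum c k 1 = 2 := by
    norm_num [powSum]
  have h2 : (1 : ℝ) ≤ (N : ℝ) ^ (D - η) := Real.one_le_rpow hN1 (by linarith)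
  have h3 : (1 : ℝ) ≤ (N : ℝ) ^ (1 - η) := Real.one_le_rpow hN1 (by linarith)
  rw [hone, abs_mul, abs_of_pos (by positivity : 0 < 2 * Real.pi)]
  have h4 : 2 * Real.pi * |x| * powSum c k (N + 1) ≤
      2 * Real.pi * (2 * 2 ^ D) * (N : ℝ) ^ (1 - η) := by
    calc _ ≤ 2 * Real.pi * (N : ℝ) ^ (1 - D - η) * (2 * 2 ^ D * (N : ℝ) ^ D) := by
          have := powSum_nonneg c k (N + 1)
          gcongr
      _ = _ := by
        rw [show (N : ℝ) ^ (1 - η) = (N : ℝ) ^ (1 - D - η) * (N : ℝ) ^ D by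
          rw [← Real.rpow_add hN0]
          ring_nf]
        ring
  have h5 : 1 + 2 * Real.pi * |x| * powSum c k (N + 1) ≤
      (1 + 2 * Real.pi * (2 * 2 ^ D)) * (N : ℝ) ^ (1 - η) := by linarith
  calc _ ≤ 2 * (N : ℝ) ^ (D - η) + 2 * D * (2 * N) ^ (D - 1) *
        ((1 + 2 * Real.pi * (2 * 2 ^ D)) * (N : ℝ) ^ (1 - η)) := by
        have : 0 ≤ 2 * D * (2 * (N : ℝ)) ^ (D - 1) := by positivity
        have := mul_le_mul_of_nonneg_left h5 this
        linarith
    _ = _ := by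
      rw [Real.mul_rpow (by norm_num) hN0.le,
        show (N : ℝ) ^ (D - η) = (N : ℝ) ^ (D - 1) * (N : ℝ) ^ (1 - η) by
          rw [← Real.rpow_add hN0]
          ring_nf]
      ring

lemma floorSum_sub_intCast (c : ℝ) (k s N : ℕ) (x : ℝ) (m : ℤ) :
    floorSum c k s N (x - m) = floorSum c k s N x := by
  rw [floorSum, floorSum]
  refine Finset.sum_congr rfl fun n _ ↦ ?_
  rw [← unitExp_add_intCast ((x - m) * _) (m * (⌊(n : ℝ) ^ c⌋ + (n : ℤ) ^ k))]
  congr 2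
  push_cast
  ring

lemma floorSum_zero (c : ℝ) (k s N : ℕ) :
    floorSum c k s N 0 = ((∑ n ∈ Finset.Ico 1 (N + 1), bumpWeight c k s N n : ℝ) : ℂ) := by
  rw [floorSum, Complex.ofReal_sum]
  refine Finset.sum_congr rfl fun n _ ↦ ?_
  rw [zero_mul, unitExp_zero, mul_one]

lemma fejerSum_zero (c : ℝ) (k N : ℕ) :
    fejerSum c k N 0 0 = ((∑ n ∈ Finset.Ico 1 (N + 1), fejerWeight c k N n : ℝ) : ℂ) := by
  rw [fejerSum, Complex.ofReal_sum]
  refine Finset.sum_congr rfl fun n _ ↦ ?_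
  rw [phase, zero_mul, zero_mul, add_zero, unitExp_zero, mul_one]

set_option maxHeartbeats 800000 in
lemma exists_floorSum_bounds (c : ℝ) (hc1 : 1 < c) (hc : ∀ m : ℤ, c ≠ m) (k d : ℕ)
    (hk : 1 ≤ k) (hd : 2 ≤ d) (hcd : c < d) (hkd : k ≤ d) (hck : c < k → k = d) (η κ : ℝ)
    (hη : 0 < η) (hκ : 2 ^ (d - 1) * η = κ) (h64 : 6 * κ - 4 * η < 1) (h52 : 5 * κ - 2 * η < 1)
    (D : ℝ) (hD : D = max c (k : ℝ)) :
    ∃ (s : ℕ) (C β : ℝ), 0 < C ∧ 0 < β ∧ ∀ N : ℕ, 1 ≤ N →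
      (∀ x : ℝ, -(C * ((Nat.log 2 N + 1 : ℕ) * (N : ℝ) ^ (D - η))) ≤ (floorSum c k s N x).re) ∧
      β * (N : ℝ) ^ D - C * ((Nat.log 2 N + 1 : ℕ) * (N : ℝ) ^ (D - η)) ≤
        ∑ n ∈ Finset.Ico 1 (N + 1), bumpWeight c k s N n := by
  have hcD : c ≤ D := hD ▸ le_max_left _ _
  have hkD : (k : ℝ) ≤ D := hD ▸ le_max_right _ _
  have hη8 : η < 1 / 8 := by
    have h2 : (2 : ℝ) ^ 1 ≤ 2 ^ (d - 1) := pow_le_pow_right₀ (by norm_num) (by omega)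
    nlinarith
  obtain ⟨ε, C₁, hε, hC₁, h₁⟩ := exists_norm_sum_fejerWeight_le c hc1 hc k d hk hd hcd hkd hck η κ
    hη hκ h64 h52 D hD
  obtain ⟨s, C₂, hs, hC₂, h₂⟩ := exists_norm_floorSum_sub_le c hc1 k η D ε C₁ (by linarith) hcD hkD
    hε hC₁ (fun N x y h1 h2 h3 h4 ↦ h₁ N x y h1 h2 h3 (Or.inl h4))
  obtain ⟨C₃, hC₃, h₃⟩ := exists_le_fejerSum_self_re c hc1 k hk η D (by linarith) hcD hkD
  obtain ⟨β, hβ, hβeq⟩ := exists_bumpTransform_zero s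
  have hβ1 : β ≤ 1 := by
    have := norm_bumpTransform_le_one s 0
    rwa [hβeq, Complex.norm_real, Real.norm_eq_abs, abs_of_pos hβ] at this
  have hpi := Real.pi_pos
  refine ⟨s, C₁ + C₂ + C₃ + 2 * Real.pi * (2 * 2 ^ D) + 2, β / 2, by positivity, by positivity,
    fun N hN ↦ ?_⟩
  have hN1 : (1 : ℝ) ≤ N := by exact_mod_cast hN
  have hN0 : (0 : ℝ) < N := by linarith
  set E : ℝ := (Nat.log 2 N + 1 : ℕ) * (N : ℝ) ^ (D - η) with hE
  have hNE : (N : ℝ) ^ (D - η) ≤ E :=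
    le_mul_of_one_le_left (by positivity) (by exact_mod_cast Nat.succ_le_succ (Nat.zero_le _))
  have hE0 : 0 < E := by positivity
  have hp1 : 0 ≤ C₁ * E := by positivity
  have hp2 : 0 ≤ C₂ * E := by positivity
  have hp3 : 0 ≤ C₃ * E := by positivity
  have hp4 : 0 ≤ 2 * Real.pi * (2 * 2 ^ D) * E := by positivity
  have hsplit : (C₁ + C₂ + C₃ + 2 * Real.pi * (2 * 2 ^ D) + 2) * E =
      C₁ * E + C₂ * E + C₃ * E + 2 * Real.pi * (2 * 2 ^ D) * E + 2 * E := by ring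
  have hC3E : C₃ * (N : ℝ) ^ (D - η) ≤ C₃ * E := by gcongr
  constructor
  · have key : ∀ x : ℝ, |x| ≤ 1 / 2 → -((C₁ + C₂ + C₃ + 2 * Real.pi * (2 * 2 ^ D) + 2) * E) ≤
        (floorSum c k s N x).re := by
      intro x hx
      have h4 := (Complex.abs_re_le_norm _).trans (h₂ N x hN hx)
      rw [Complex.sub_re] at h4
      have h4' := neg_le_of_abs_le h4
      suffices h5 : -(C₁ * E + C₃ * E + 2 * Real.pi * (2 * 2 ^ D) * E) ≤
          (bumpTransform s x * fejerSum c k N x x).re by linarith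
      rcases le_or_gt ((N : ℝ) ^ (1 - D - η)) |x| with hcase | hcase
      · have h6 := h₁ N x x hN hx
          (hx.trans ((by norm_num : (1 / 2 : ℝ) ≤ 1).trans (Real.one_le_rpow hN1 hε.le)))
          (Or.inr ⟨rfl, hcase⟩)
        have h7 : ‖bumpTransform s x * fejerSum c k N x x‖ ≤ C₁ * E := by
          rw [norm_mul]
          calc _ ≤ 1 * ‖fejerSum c k N x x‖ := by
                gcongr
                exact norm_bumpTransform_le_one s x
            _ ≤ (Nat.log 2 N + 1 : ℕ) * (C₁ * (N : ℝ) ^ (D - η)) := by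
                rw [one_mul]
                exact h6
            _ = _ := by
                rw [hE]
                ring
        have h8 := neg_le_of_abs_le ((Complex.abs_re_le_norm _).trans h7)
        linarith
      · have h6 := h₃ N x hN hcase.le
        have h7 : bumpTransform s x * fejerSum c k N x x = (β : ℂ) * fejerSum c k N x x +
            (bumpTransform s x - bumpTransform s 0) * fejerSum c k N x x := by
          rw [hβeq]
          ring
        have h8 : ‖(bumpTransform s x - bumpTransform s 0) * fejerSum c k N x x‖ ≤
            2 * Real.pi * (2 * 2 ^ D) * E := by
          rw [norm_mul]
          calc _ ≤ 2 * Real.pi * |x| * (2 * 2 ^ D * (N : ℝ) ^ D) := by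
                gcongr
                · exact norm_bumpTransform_sub_le s x
                · exact norm_fejerSum_le hc1 hN hcD hkD x x
            _ ≤ 2 * Real.pi * (N : ℝ) ^ (1 - D - η) * (2 * 2 ^ D * (N : ℝ) ^ D) := by gcongr
            _ = 2 * Real.pi * (2 * 2 ^ D) * (N : ℝ) ^ (1 - η) := by
                rw [show (N : ℝ) ^ (1 - η) = (N : ℝ) ^ (1 - D - η) * (N : ℝ) ^ D by
                  rw [← Real.rpow_add hN0]
                  ring_nf]
                ring
            _ ≤ _ := by
                gcongr
                exact (Real.rpow_le_rpow_of_exponent_le hN1 (by linarith)).trans hNE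
        have h9 := neg_le_of_abs_le ((Complex.abs_re_le_norm _).trans h8)
        rw [h7, Complex.add_re, Complex.re_ofReal_mul]
        have h10 : -(C₃ * E) ≤ β * (fejerSum c k N x x).re := by
          have h11 := mul_le_mul_of_nonneg_left h6 hβ.le
          have h12 : β * (C₃ * (N : ℝ) ^ (D - η)) ≤ 1 * (C₃ * E) := by gcongr
          linarith
        linarith
    intro x
    rw [← floorSum_sub_intCast c k s N x (round x)]
    exact key _ (abs_sub_round x)
  · have h4 := (Complex.abs_re_le_norm _).trans (h₂ N 0 hN (by norm_num))
    rw [floorSum_zero, fejerSum_zero, hβeq, ← Complex.ofReal_mul, ← Complex.ofReal_sub,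
      Complex.ofReal_re] at h4
    have h5 := neg_le_of_abs_le h4
    have h6 := le_sum_fejerWeight hc1 k N
    have hone : powSum c k 1 = 2 := by
      norm_num [powSum]
    have h7 : (N : ℝ) ^ D ≤ powSum c k (N + 1) := by
      rw [hD]
      exact (rpow_max_le_powSum c k N).trans
        ((powSum_strictMono hc1 k).monotone (Nat.le_succ N))
    have h8 : (1 : ℝ) ≤ (N : ℝ) ^ (D - η) := Real.one_le_rpow hN1 (by linarith)
    have h9 : (N : ℝ) ^ D / 2 - 2 * E ≤ ∑ n ∈ Finset.Ico 1 (N + 1), fejerWeight c k N n := by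
      rw [hone] at h6
      linarith
    have h10 := mul_le_mul_of_nonneg_left h9 hβ.le
    have h11 : β * (2 * E) ≤ 1 * (2 * E) := by gcongr
    linarith

lemma four_mul_nearestIntDist_le (v : ℝ) : 4 * nearestIntDist v ≤ ‖unitExp v - 1‖ := by
  have h0 : unitExp v = unitExp (v - round v) := by
    have := unitExp_add_intCast (v - round v) (round v)
    rwa [sub_add_cancel] at this
  have h1 := abs_sub_round v
  rw [h0, nearestIntDist]
  rcases le_total 0 (v - round v) with h | h
  · rw [abs_of_nonneg h] at h1 ⊢
    exact four_mul_le_norm_unitExp_sub_one h h1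
  · rw [abs_of_nonpos h] at h1 ⊢
    refine (four_mul_le_norm_unitExp_sub_one (neg_nonneg.2 h) h1).trans_eq ?_
    rw [unitExp_neg, ← Complex.norm_conj, map_sub, Complex.conj_conj, map_one]

lemma unitExp_natCast_mul (h : ℕ) (v : ℝ) : unitExp (h * v) = unitExp v ^ h := by
  induction h with
  | zero => simp [unitExp_zero]
  | succ h ih => rw [pow_succ, ← ih, ← unitExp_add]; push_cast; ring_nf

lemma norm_sum_unitExp_natCast_mul_le (H : ℕ) {v ρ : ℝ} (hρ : 0 < ρ) (hv : ρ ≤ nearestIntDist v) :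
    ‖∑ h ∈ Finset.range H, unitExp (h * v)‖ ≤ 1 / (2 * ρ) := by
  have h1 := geom_sum_mul (unitExp v) H
  have h2 := congrArg norm h1
  simp only [← unitExp_natCast_mul] at h2
  rw [norm_mul] at h2
  have h3 := four_mul_nearestIntDist_le v
  have h4 : ‖unitExp (H * v) - 1‖ ≤ 2 := by
    refine (norm_sub_le _ _).trans ?_
    rw [norm_unitExp, norm_one]
    norm_num
  rw [le_div_iff₀ (by positivity)]
  have h5 : ‖∑ h ∈ Finset.range H, unitExp (h * v)‖ * (4 * ρ) ≤
      ‖∑ h ∈ Finset.range H, unitExp (h * v)‖ * ‖unitExp v - 1‖ := by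
    gcongr
    linarith
  linarith

lemma sq_card_le_mul_sum_ite_eq {τ : Type*} [Fintype τ] (σ : τ → ℕ) (K : ℕ)
    (hσ : ∀ t, σ t < K) :
    (Fintype.card τ : ℝ) ^ 2 ≤ K * ∑ t, ∑ t', if σ t = σ t' then (1 : ℝ) else 0 := by
  classical
  set r : ℕ → ℝ := fun v ↦ ∑ t', if v = σ t' then (1 : ℝ) else 0 with hr
  have h1 : ∑ v ∈ Finset.range K, r v = Fintype.card τ := by
    rw [hr, Finset.sum_comm]
    simp [hσ]
  have h2 : ∑ v ∈ Finset.range K, r v ^ 2 = ∑ t, r (σ t) := by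
    rw [← Finset.sum_fiberwise_of_maps_to (s := Finset.univ) (t := Finset.range K) (g := σ)
      (fun t _ ↦ Finset.mem_range.2 (hσ t))]
    refine Finset.sum_congr rfl fun v _ ↦ ?_
    rw [Finset.sum_congr rfl (g := fun _ ↦ r v)
      (fun t ht ↦ by rw [(Finset.mem_filter.1 ht).2]), Finset.sum_const, nsmul_eq_mul, sq]
    congr 1
    simp [hr, eq_comm]
  have h3 := sq_sum_le_card_mul_sum_sq (s := Finset.range K) (f := r)
  rw [h1, h2, Finset.card_range] at h3
  exact h3

lemma pow_sum_unitExp (H p : ℕ) (v : ℝ) : (∑ h ∈ Finset.range H, unitExp (h * v)) ^ p =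
    ∑ t : Fin p → Fin H, unitExp ((∑ i, (t i : ℕ) : ℕ) * v) := by
  rw [Finset.sum_range, Fintype.sum_pow]
  refine Finset.sum_congr rfl fun t _ ↦ ?_
  simp only [unitExp_natCast_mul]
  rw [Finset.prod_pow_eq_pow_sum]

lemma norm_sum_unitExp_pow_eq (H p : ℕ) (v : ℝ) :
    ‖∑ h ∈ Finset.range H, unitExp (h * v)‖ ^ (2 * p) =
      ∑ t : Fin p → Fin H, ∑ t' : Fin p → Fin H,
        (unitExp ((((∑ i, (t i : ℕ) : ℕ) : ℤ) - ((∑ i, (t' i : ℕ) : ℕ) : ℤ) : ℤ) * v)).re := by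
  rw [mul_comm 2 p, pow_mul, ← norm_pow, pow_sum_unitExp]
  set Z := ∑ t : Fin p → Fin H, unitExp ((∑ i, (t i : ℕ) : ℕ) * v) with hZ
  have h1 : ‖Z‖ ^ 2 = (Z * (starRingEnd ℂ) Z).re := by
    rw [Complex.mul_conj, Complex.ofReal_re, Complex.normSq_eq_norm_sq]
  rw [h1, hZ, map_sum, Finset.sum_mul_sum, Complex.re_sum]
  refine Finset.sum_congr rfl fun t _ ↦ ?_
  rw [Complex.re_sum]
  refine Finset.sum_congr rfl fun t' _ ↦ ?_
  rw [← unitExp_sub, ← sub_mul]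
  push_cast
  rfl

/-- A lower bound for the average of a power of the Dirichlet kernel against weights whose Fourier
transform is almost nonnegative. -/
lemma le_sum_mul_norm_sum_unitExp_pow {ι : Type*} (T : Finset ι) (a v : ι → ℝ) (δ : ℝ)
    (hδ : 0 ≤ δ) (ha : ∀ n ∈ T, 0 ≤ a n)
    (hre : ∀ h : ℤ, -δ ≤ ∑ n ∈ T, a n * (unitExp (h * v n)).re) (H p : ℕ) (hH : 1 ≤ H)
    (hp : 1 ≤ p) :
    ((∑ n ∈ T, a n) / (p * H) - δ) * (H : ℝ) ^ (2 * p) ≤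
      ∑ n ∈ T, a n * ‖∑ h ∈ Finset.range H, unitExp (h * v n)‖ ^ (2 * p) := by
  set W := ∑ n ∈ T, a n with hW
  have hW0 : 0 ≤ W := Finset.sum_nonneg ha
  have hH0 : (0 : ℝ) < H := by exact_mod_cast hH
  have hp0 : (0 : ℝ) < p := by exact_mod_cast hp
  set σ : (Fin p → Fin H) → ℕ := fun t ↦ ∑ i, (t i : ℕ) with hσ
  have h1 : ∑ n ∈ T, a n * ‖∑ h ∈ Finset.range H, unitExp (h * v n)‖ ^ (2 * p) =
      ∑ t : Fin p → Fin H, ∑ t' : Fin p → Fin H,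
        ∑ n ∈ T, a n * (unitExp (((σ t : ℤ) - (σ t' : ℤ) : ℤ) * v n)).re := by
    simp only [norm_sum_unitExp_pow_eq, Finset.mul_sum]
    rw [Finset.sum_comm]
    refine Finset.sum_congr rfl fun t _ ↦ ?_
    rw [Finset.sum_comm]
  have h2 : ∀ t t' : Fin p → Fin H, W * (if σ t = σ t' then (1 : ℝ) else 0) - δ ≤
      ∑ n ∈ T, a n * (unitExp (((σ t : ℤ) - (σ t' : ℤ) : ℤ) * v n)).re := by
    intro t t'
    by_cases h : σ t = σ t'
    · rw [if_pos h, h, sub_self]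
      simp only [Int.cast_zero, zero_mul, unitExp_zero, Complex.one_re, mul_one]
      linarith
    · rw [if_neg h]
      have := hre ((σ t : ℤ) - (σ t' : ℤ))
      linarith
  have hcard : (Fintype.card (Fin p → Fin H) : ℝ) = (H : ℝ) ^ p := by
    simp
  have h3 := sq_card_le_mul_sum_ite_eq σ (p * H) (fun t ↦ by
    have h4 : σ t ≤ ∑ _i : Fin p, (H - 1) := Finset.sum_le_sum fun i _ ↦ by
      have := (t i).2
      omega
    rw [Finset.sum_const, Finset.card_univ, Fintype.card_fin, smul_eq_mul] at h4
    refine h4.trans_lt (Nat.mul_lt_mul_of_pos_left (by omega) hp))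
  rw [hcard] at h3
  set Q := ∑ t : Fin p → Fin H, ∑ t' : Fin p → Fin H, if σ t = σ t' then (1 : ℝ) else 0 with hQ
  have h5 : W * Q - δ * (H : ℝ) ^ p * (H : ℝ) ^ p ≤
      ∑ n ∈ T, a n * ‖∑ h ∈ Finset.range H, unitExp (h * v n)‖ ^ (2 * p) := by
    rw [h1]
    refine le_trans (le_of_eq ?_)
      (Finset.sum_le_sum fun t _ ↦ Finset.sum_le_sum fun t' _ ↦ h2 t t')
    simp only [Finset.sum_sub_distrib, Finset.sum_const, Finset.card_univ, nsmul_eq_mul, hcard,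
      hQ, Finset.mul_sum]
    ring
  refine le_trans ?_ h5
  have h6 : (H : ℝ) ^ (2 * p) / (p * H) ≤ Q := by
    rw [div_le_iff₀ (by positivity)]
    push_cast at h3
    rw [mul_comm 2 p, pow_mul]
    linarith
  have h7 := mul_le_mul_of_nonneg_left h6 hW0
  have h8 : (W / (p * H) - δ) * (H : ℝ) ^ (2 * p) = W * ((H : ℝ) ^ (2 * p) / (p * H)) -
      δ * (H : ℝ) ^ p * (H : ℝ) ^ p := by
    rw [two_mul, pow_add]
    ring
  linarith

lemma sum_div_sub_le_of_forall_le_nearestIntDist {ι : Type*} (T : Finset ι) (a v : ι → ℝ) (δ ρ : ℝ)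
    (hδ : 0 ≤ δ) (hρ : 0 < ρ) (ha : ∀ n ∈ T, 0 ≤ a n)
    (hre : ∀ h : ℤ, -δ ≤ ∑ n ∈ T, a n * (unitExp (h * v n)).re) (H p : ℕ) (hH : 1 ≤ H)
    (hp : 1 ≤ p) (hv : ∀ n ∈ T, ρ ≤ nearestIntDist (v n)) :
    (∑ n ∈ T, a n) / (p * H) - δ ≤ (∑ n ∈ T, a n) * (1 / (2 * ρ * H)) ^ (2 * p) := by
  have hH0 : (0 : ℝ) < H := by exact_mod_cast hH
  have h1 := le_sum_mul_norm_sum_unitExp_pow T a v δ hδ ha hre H p hH hp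
  have h2 : ∑ n ∈ T, a n * ‖∑ h ∈ Finset.range H, unitExp (h * v n)‖ ^ (2 * p) ≤
      ∑ n ∈ T, a n * (1 / (2 * ρ)) ^ (2 * p) := by
    refine Finset.sum_le_sum fun n hn ↦ mul_le_mul_of_nonneg_left ?_ (ha n hn)
    exact pow_le_pow_left₀ (norm_nonneg _) (norm_sum_unitExp_natCast_mul_le H hρ (hv n hn)) _
  rw [← Finset.sum_mul] at h2
  have h3 : (∑ n ∈ T, a n) * (1 / (2 * ρ)) ^ (2 * p) =
      (∑ n ∈ T, a n) * (1 / (2 * ρ * H)) ^ (2 * p) * (H : ℝ) ^ (2 * p) := by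
    rw [mul_assoc, ← mul_pow]
    congr 2
    field_simp
  rw [h3] at h2
  exact le_of_mul_le_mul_right (h1.trans h2) (by positivity)

open Filter in
lemma eventually_natLog_add_one_le_rpow {ε : ℝ} (hε : 0 < ε) :
    ∀ᶠ N : ℕ in atTop, ((Nat.log 2 N + 1 : ℕ) : ℝ) ≤ (N : ℝ) ^ ε := by
  have hlog2 : 0 < Real.log 2 := Real.log_pos (by norm_num)
  have h := ((tendsto_rpow_atTop (half_pos hε)).comp tendsto_natCast_atTop_atTop).eventually_ge_atTop
    (1 / (ε / 2 * Real.log 2) + 1)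
  filter_upwards [h, eventually_ge_atTop 1] with N hN hN1
  have hN1' : (1 : ℝ) ≤ N := by exact_mod_cast hN1
  have h0 : (0 : ℝ) < N := by linarith
  simp only [Function.comp_apply] at hN
  have h1 : (Nat.log 2 N : ℝ) ≤ Real.log N / Real.log 2 := by
    have := Real.natLog_le_logb N 2
    simpa [Real.logb] using this
  have h2 := Real.log_le_rpow_div h0.le (half_pos hε)
  have h3 : Real.log N / Real.log 2 ≤ 1 / (ε / 2 * Real.log 2) * (N : ℝ) ^ (ε / 2) := by
    rw [div_le_iff₀ hlog2]
    refine h2.trans_eq ?_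
    field_simp
  have h4 : (1 : ℝ) ≤ (N : ℝ) ^ (ε / 2) := Real.one_le_rpow hN1' (by linarith)
  push_cast
  calc _ ≤ (1 / (ε / 2 * Real.log 2) + 1) * (N : ℝ) ^ (ε / 2) := by linarith
    _ ≤ (N : ℝ) ^ (ε / 2) * (N : ℝ) ^ (ε / 2) := by gcongr
    _ = _ := by
      rw [← Real.rpow_add h0, add_halves]

open Filter in
lemma eventually_le_natCast_rpow {ε : ℝ} (hε : 0 < ε) (K : ℝ) :
    ∀ᶠ N : ℕ in atTop, K ≤ (N : ℝ) ^ ε :=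
  ((tendsto_rpow_atTop hε).comp tendsto_natCast_atTop_atTop).eventually_ge_atTop K

open Filter in
set_option maxHeartbeats 800000 in
lemma eventually_exists_nearestIntDist_le (c : ℝ) (hc1 : 1 < c) (hc : ∀ m : ℤ, c ≠ m) (k d : ℕ)
    (hk : 1 ≤ k) (hd : 2 ≤ d) (hcd : c < d) (hkd : k ≤ d) (hck : c < k → k = d) (η ε : ℝ)
    (h64 : (6 * 2 ^ (d - 1) - 4) * η ≤ 1) (h52 : (5 * 2 ^ (d - 1) - 2) * η ≤ 1)
    (hε : 0 < ε) (hεη : ε < η) :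
    ∀ᶠ N : ℕ in atTop, ∀ ξ : ℝ, ∃ n : ℕ, 1 ≤ n ∧ n ≤ N ∧
      nearestIntDist (ξ * ((⌊(n : ℝ) ^ c⌋ : ℝ) + (n : ℝ) ^ k)) ≤ (N : ℝ) ^ (-η + ε) := by
  have hpow : (2 : ℝ) ≤ 2 ^ (d - 1) := by
    have : (2 : ℝ) ^ 1 ≤ 2 ^ (d - 1) := pow_le_pow_right₀ (by norm_num) (by omega)
    linarith
  have hη1 : η < 1 := by nlinarith
  obtain ⟨s, C, β, hC, hβ, hmain⟩ := exists_floorSum_bounds c hc1 hc k d hk hd hcd hkd hck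
    (η - ε / 8) (2 ^ (d - 1) * (η - ε / 8)) (by linarith) rfl (by nlinarith) (by nlinarith)
    (max c (k : ℝ)) rfl
  set D := max c (k : ℝ) with hD
  obtain ⟨p, hp⟩ := exists_nat_gt (1 / ε)
  have hp0 : (0 : ℝ) < p := lt_trans (by positivity) hp
  have hp1 : 1 ≤ p := by exact_mod_cast hp0
  filter_upwards [eventually_natLog_add_one_le_rpow (by positivity : 0 < ε / 8),
    eventually_le_natCast_rpow (by linarith : 0 < 1 - η + ε / 2) (2 * p),
    eventually_le_natCast_rpow (by positivity : 0 < ε / 4) (C * (2 * p + 1) / β + 1),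
    eventually_ge_atTop 1] with N hlog hlarge hcontra hN ξ
  by_contra! hall
  obtain ⟨hre, hW⟩ := hmain N hN
  have hN1 : (1 : ℝ) ≤ N := by exact_mod_cast hN
  have hN0 : (0 : ℝ) < N := by linarith
  set E : ℝ := (Nat.log 2 N + 1 : ℕ) * (N : ℝ) ^ (D - (η - ε / 8)) with hE
  have hE0 : 0 < E := by positivity
  have hEle : E ≤ (N : ℝ) ^ (D - η + ε / 4) := by
    calc E ≤ (N : ℝ) ^ (ε / 8) * (N : ℝ) ^ (D - (η - ε / 8)) :=
        mul_le_mul_of_nonneg_right hlog (by positivity)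
      _ = _ := by
        rw [← Real.rpow_add hN0]
        ring_nf
  set H : ℕ := ⌊(N : ℝ) ^ (η - ε / 2)⌋₊ with hH
  have hpos : 1 ≤ (N : ℝ) ^ (η - ε / 2) := Real.one_le_rpow hN1 (by linarith)
  have hH1 : 1 ≤ H := (Nat.one_le_floor_iff _).2 hpos
  have hH0 : (0 : ℝ) < H := by exact_mod_cast hH1
  have hHle : (H : ℝ) ≤ (N : ℝ) ^ (η - ε / 2) := Nat.floor_le (by positivity)
  have hHge : (N : ℝ) ^ (η - ε / 2) ≤ 2 * H := by
    have h1 := Nat.lt_floor_add_one ((N : ℝ) ^ (η - ε / 2))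
    have h2 : (1 : ℝ) ≤ H := by exact_mod_cast hH1
    rw [← hH] at h1
    linarith
  have hmem : ∀ n ∈ Finset.Ico 1 (N + 1), 1 ≤ n ∧ n ≤ N := fun n hn ↦ by
    obtain ⟨h1, h2⟩ := Finset.mem_Ico.1 hn
    exact ⟨h1, by omega⟩
  have hρ : 0 < (N : ℝ) ^ (-η + ε) := by positivity
  set W := ∑ n ∈ Finset.Ico 1 (N + 1), bumpWeight c k s N n with hWdef
  have hker := sum_div_sub_le_of_forall_le_nearestIntDist (Finset.Ico 1 (N + 1))
    (bumpWeight c k s N) (fun n ↦ ξ * ((⌊(n : ℝ) ^ c⌋ : ℝ) + (n : ℝ) ^ k)) (C * E)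
    ((N : ℝ) ^ (-η + ε)) (by positivity) hρ
    (fun n hn ↦ bumpWeight_nonneg hc1 k s ((hmem n hn).2.trans (Nat.le_succ N)))
    (fun h ↦ by
      refine (hre (h * ξ)).trans_eq ?_
      rw [floorSum, Complex.re_sum]
      refine Finset.sum_congr rfl fun n _ ↦ ?_
      rw [Complex.re_ofReal_mul, mul_assoc (h : ℝ)]) H p hH1 hp1
    (fun n hn ↦ (hall n (hmem n hn).1 (hmem n hn).2).le)
  rw [← hWdef] at hker
  have hW0 : 0 ≤ W := Finset.sum_nonneg fun n hn ↦
    bumpWeight_nonneg hc1 k s ((hmem n hn).2.trans (Nat.le_succ N))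
  have hsmall : (1 / (2 * (N : ℝ) ^ (-η + ε) * H)) ^ (2 * p) ≤ (N : ℝ) ^ (-1 : ℝ) := by
    have h1 : 1 / (2 * (N : ℝ) ^ (-η + ε) * H) ≤ (N : ℝ) ^ (-(ε / 2)) := by
      rw [div_le_iff₀ (by positivity)]
      calc (1 : ℝ) = (N : ℝ) ^ (-(ε / 2)) * ((N : ℝ) ^ (-η + ε) * (N : ℝ) ^ (η - ε / 2)) := by
            rw [← Real.rpow_add hN0, ← Real.rpow_add hN0, ← Real.rpow_zero (N : ℝ)]
            ring_nf
        _ ≤ (N : ℝ) ^ (-(ε / 2)) * ((N : ℝ) ^ (-η + ε) * (2 * H)) := by gcongr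
        _ = _ := by ring
    refine (pow_le_pow_left₀ (by positivity) h1 _).trans ?_
    rw [← Real.rpow_natCast, ← Real.rpow_mul hN0.le]
    refine Real.rpow_le_rpow_of_exponent_le hN1 ?_
    rw [div_lt_iff₀ hε] at hp
    push_cast
    linarith
  have hinv : (N : ℝ) ^ (-1 : ℝ) ≤ (N : ℝ) ^ (-η + ε / 2) / (2 * p) := by
    rw [le_div_iff₀ (by positivity)]
    calc _ ≤ (N : ℝ) ^ (-1 : ℝ) * (N : ℝ) ^ (1 - η + ε / 2) := by gcongr
      _ = _ := by
        rw [← Real.rpow_add hN0]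
        ring_nf
  have hHinv : (N : ℝ) ^ (-η + ε / 2) / p ≤ 1 / (p * H) := by
    rw [div_le_div_iff₀ hp0 (by positivity)]
    have h1 : (N : ℝ) ^ (-η + ε / 2) * H ≤ 1 := by
      calc _ ≤ (N : ℝ) ^ (-η + ε / 2) * (N : ℝ) ^ (η - ε / 2) := by gcongr
        _ = 1 := by
          rw [← Real.rpow_add hN0, ← Real.rpow_zero (N : ℝ)]
          ring_nf
    calc _ = p * ((N : ℝ) ^ (-η + ε / 2) * H) := by ring
      _ ≤ p * 1 := by gcongr
      _ = _ := by ring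
  have hWle : W * ((N : ℝ) ^ (-η + ε / 2) / (2 * p)) ≤ C * (N : ℝ) ^ (D - η + ε / 4) := by
    have h1 : W * (1 / (2 * (N : ℝ) ^ (-η + ε) * H)) ^ (2 * p) ≤
        W * ((N : ℝ) ^ (-η + ε / 2) / (2 * p)) := by
      gcongr
      exact hsmall.trans hinv
    have h2 : W * ((N : ℝ) ^ (-η + ε / 2) / p) ≤ W / (p * H) := by
      rw [div_eq_mul_one_div W]
      gcongr
    have h3 : (N : ℝ) ^ (-η + ε / 2) / p = 2 * ((N : ℝ) ^ (-η + ε / 2) / (2 * p)) := by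
      field_simp
    have h4 : C * E ≤ C * (N : ℝ) ^ (D - η + ε / 4) := by gcongr
    rw [h3] at h2
    linarith
  have hWle' : W ≤ 2 * p * C * (N : ℝ) ^ (D - ε / 4) := by
    have h1 : C * (N : ℝ) ^ (D - η + ε / 4) =
        2 * p * C * (N : ℝ) ^ (D - ε / 4) * ((N : ℝ) ^ (-η + ε / 2) / (2 * p)) := by
      rw [show (N : ℝ) ^ (D - η + ε / 4) = (N : ℝ) ^ (D - ε / 4) * (N : ℝ) ^ (-η + ε / 2) by
        rw [← Real.rpow_add hN0]
        ring_nf]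
      field_simp
    rw [h1] at hWle
    exact le_of_mul_le_mul_right hWle (by positivity)
  have hEle' : C * E ≤ C * (N : ℝ) ^ (D - ε / 4) := by
    gcongr
    exact hEle.trans (Real.rpow_le_rpow_of_exponent_le hN1 (by linarith))
  have hfin : β * (N : ℝ) ^ D ≤ C * (2 * p + 1) * (N : ℝ) ^ (D - ε / 4) := by linarith
  have hfin' : β * (N : ℝ) ^ (ε / 4) ≤ C * (2 * p + 1) := by
    have h1 : (N : ℝ) ^ D = (N : ℝ) ^ (ε / 4) * (N : ℝ) ^ (D - ε / 4) := by
      rw [← Real.rpow_add hN0]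
      ring_nf
    rw [h1, ← mul_assoc] at hfin
    exact le_of_mul_le_mul_right hfin (by positivity)
  have h1 := mul_le_mul_of_nonneg_left hcontra hβ.le
  have h2 : β * (C * (2 * p + 1) / β + 1) = C * (2 * p + 1) + β := by
    field_simp
  linarith

lemma exists_nearestIntDist_floor_le_of_bounds (c : ℝ) (hc1 : 1 < c) (hc : ∀ m : ℤ, c ≠ m)
    (k d : ℕ) (hk : 1 ≤ k) (hd : 2 ≤ d) (hcd : c < d) (hkd : k ≤ d) (hck : c < k → k = d)
    (η ε : ℝ) (hη : 0 < η) (h64 : (6 * 2 ^ (d - 1) - 4) * η ≤ 1)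
    (h52 : (5 * 2 ^ (d - 1) - 2) * η ≤ 1) (hε : 0 < ε) :
    ∃ (C : ℝ) (N₀ : ℕ), 0 < C ∧ ∀ (ξ : ℝ) (N : ℕ), N₀ ≤ N → ∃ n : ℕ, 1 ≤ n ∧ n ≤ N ∧
      nearestIntDist (ξ * (⌊(n : ℝ) ^ c + (n : ℝ) ^ (k : ℕ)⌋ : ℝ)) ≤ C * (N : ℝ) ^ (-η + ε) := by
  have hmin : 0 < min ε (η / 2) := lt_min hε (by linarith)
  obtain ⟨N₀, hN₀⟩ := Filter.eventually_atTop.1 (eventually_exists_nearestIntDist_le c hc1 hc k d hk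
    hd hcd hkd hck η (min ε (η / 2)) h64 h52 hmin
    ((min_le_right _ _).trans_lt (by linarith)))
  refine ⟨1, N₀, one_pos, fun ξ N hN ↦ ?_⟩
  obtain ⟨n, hn1, hnN, hn⟩ := hN₀ N hN ξ
  refine ⟨n, hn1, hnN, ?_⟩
  have h1 : ⌊(n : ℝ) ^ c + (n : ℝ) ^ k⌋ = ⌊(n : ℝ) ^ c⌋ + (n : ℤ) ^ k := by
    rw [← Int.floor_add_intCast]
    push_cast
    rfl
  have hN1 : (1 : ℝ) ≤ N := by exact_mod_cast hn1.trans hnN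
  rw [h1, one_mul]
  push_cast
  refine hn.trans (Real.rpow_le_rpow_of_exponent_le hN1 ?_)
  have := min_le_left ε (η / 2)
  linarith

/-- Let `c > 1` be a non-integral real, `k ≥ 1` an integer, and
`ε > 0`. With `η = (1/2)·1/(2^{⌈c⌉+1} − 1)` if `c > k` and
`η = 1/(2^{k−1}(k+2))` if `c < k`, there exist `C > 0` and `N₀` such that for
all real `ξ` and `N ≥ N₀`, `min_{1 ≤ n ≤ N} ‖ξ⌊n^c + n^k⌋‖ ≤ C·N^{−η+ε}`. -/
theorem stmt_3 (c : ℝ) (hc : 1 < c) (hci : ∀ m : ℤ, c ≠ (m : ℝ))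
    (k : ℕ) (hk : 1 ≤ k) (ε : ℝ) (hε : 0 < ε) :
    ∃ (C : ℝ) (N₀ : ℕ), 0 < C ∧
      ∀ (ξ : ℝ) (N : ℕ), N₀ ≤ N →
        ∃ n : ℕ, 1 ≤ n ∧ n ≤ N ∧
          nearestIntDist (ξ * (⌊(n : ℝ) ^ c + (n : ℝ) ^ (k : ℕ)⌋ : ℝ)) ≤
            C * (N : ℝ) ^
              (-(if (k : ℝ) < c then
                    (1 / 2) * (1 / ((2 : ℝ) ^ (⌈c⌉ + 1) - 1))
                  else
                    1 / ((2 : ℝ) ^ (k - 1) * ((k : ℝ) + 2))) + ε) := by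
  split_ifs with hkc
  · obtain ⟨d, hd⟩ : ∃ d : ℕ, ⌈c⌉ = d := Int.eq_ofNat_of_zero_le (Int.ceil_nonneg (by linarith))
    have hcd : c < d := by
      refine lt_of_le_of_ne ?_ (by exact_mod_cast hci d)
      have := Int.le_ceil c
      rw [hd] at this
      exact_mod_cast this
    have hd2 : 2 ≤ d := by
      have : (1 : ℝ) < d := hc.trans hcd
      exact_mod_cast this
    have hkd : k ≤ d := by
      have : (k : ℝ) < d := hkc.trans hcd
      exact_mod_cast this.le
    have hpow : (2 : ℝ) ^ (⌈c⌉ + 1) = 4 * 2 ^ (d - 1) := by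
      rw [hd, show (d : ℤ) + 1 = ((d - 1 + 2 : ℕ) : ℤ) by omega, zpow_natCast, pow_add]
      ring
    have h1 : (1 : ℝ) ≤ 2 ^ (d - 1) := one_le_pow₀ (by norm_num)
    rw [hpow]
    have h2 : (0 : ℝ) < 4 * 2 ^ (d - 1) - 1 := by linarith
    have h3 : (1 / 2 : ℝ) * (1 / (4 * 2 ^ (d - 1) - 1)) = 1 / (2 * (4 * 2 ^ (d - 1) - 1)) := by
      field_simp
    refine exists_nearestIntDist_floor_le_of_bounds c hc hci k d hk hd2 hcd hkd
      (fun h ↦ absurd h hkc.not_gt) _ ε (by positivity) ?_ ?_ hε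
    · rw [h3, mul_one_div, div_le_one (by positivity)]
      linarith
    · rw [h3, mul_one_div, div_le_one (by positivity)]
      linarith
  · have hck : c < k := lt_of_le_of_ne (not_lt.1 hkc) (by exact_mod_cast hci k)
    have hk2 : 2 ≤ k := by
      have : (1 : ℝ) < k := hc.trans hck
      exact_mod_cast this
    have hbound : (6 : ℝ) * 2 ^ (k - 1) - 4 ≤ 2 ^ (k - 1) * (k + 2) ∧
        (5 : ℝ) * 2 ^ (k - 1) - 2 ≤ 2 ^ (k - 1) * (k + 2) := by
      rcases (show k = 2 ∨ k = 3 ∨ 4 ≤ k by omega) with rfl | rfl | h4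
      · norm_num
      · norm_num
      · have h4' : (4 : ℝ) ≤ k := by exact_mod_cast h4
        have h1 : (1 : ℝ) ≤ 2 ^ (k - 1) := one_le_pow₀ (by norm_num)
        constructor <;> nlinarith
    refine exists_nearestIntDist_floor_le_of_bounds c hc hci k k hk hk2 hck le_rfl
      (fun _ ↦ rfl) _ ε (by positivity) ?_ ?_ hε
    · rw [mul_one_div, div_le_one (by positivity)]
      exact hbound.1
    · rw [mul_one_div, div_le_one (by positivity)]
      exact hbound.2
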